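/- arXiv:1505.08083 — 2 statements merged into one kernel-verified Lean document; each statement's English description precedes it below -/
import Mathlib

section
/- Let h be the free Haar trace on the Brown algebra U_n^nc (the unique tracial state with φ ⋆_F h = h = h ⋆_F φ for all tracial states φ). Then the free cumulants of the family {u_{ij}, u_{ij}* : 1 ≤ i,j ≤ n} in (U_n^nc, h) are as follows: for every r ≥ 1 and all indices i_1,…,i_r, j_1,…,j_r ∈ {1,…,n}, κ_{2r}(u_{i_1 j_1}, u_{i_2 j_1}*, u_{i_2 j_2}, u_{i_3 j_2}*, …, u_{i_r j_r}, u_{i_1 j_r}*) = n^{1−2r}(−1)^{r−1}C_{r−1} and κ_{2r}(u_{i_1 j_1}*, u_{i_1 j_2}, u_{i_2 j_2}*, u_{i_2 j_3}, …, u_{i_r j_r}*, u_{i_r j_1}) = n^{1−2r}(−1)^{r−1}C_{r−1}; every free cumulant of elements of {u_{ij}, u_{ij}*} which is not of one of these two forms is equal to 0. -/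
noncomputable section

/-- A state on a unital `⋆`-algebra over `ℂ`. -/
def IsState {A : Type} [Ring A] [Algebra ℂ A] [StarRing A]
    (φ : A →ₗ[ℂ] ℂ) : Prop :=
  φ 1 = 1 ∧ ∀ a : A, 0 ≤ (φ (star a * a)).re ∧ (φ (star a * a)).im = 0

/-- A tracial state. -/
def IsTracialState {A : Type} [Ring A] [Algebra ℂ A] [StarRing A]
    (φ : A →ₗ[ℂ] ℂ) : Prop :=
  IsState φ ∧ ∀ a b : A, φ (a * b) = φ (b * a)

/-- The Brown algebra `U_n^nc`: a unital `⋆`-algebra generated by `n²` elements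
`u i j` subject to the unitarity relations, together with its universal property. -/
structure BrownAlg (n : ℕ) where
  carrier : Type
  [ring : Ring carrier]
  [algebra : Algebra ℂ carrier]
  [starRing : StarRing carrier]
  [starModule : StarModule ℂ carrier]
  u : Fin n → Fin n → carrier
  rel_left : ∀ i j, (∑ k, star (u k i) * u k j) = if i = j then 1 else 0
  rel_right : ∀ i j, (∑ k, u i k * star (u j k)) = if i = j then 1 else 0
  universal : ∀ (C : Type) [Ring C] [Algebra ℂ C] [StarRing C] [StarModule ℂ C]
      (v : Fin n → Fin n → C),
      (∀ i j, (∑ k, star (v k i) * v k j) = if i = j then 1 else 0) →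
      (∀ i j, (∑ k, v i k * star (v j k)) = if i = j then 1 else 0) →
      ∃! f : carrier →⋆ₐ[ℂ] C, ∀ i j, f (u i j) = v i j

attribute [instance] BrownAlg.ring BrownAlg.algebra BrownAlg.starRing BrownAlg.starModule

/-- The free product (coproduct) of two unital `⋆`-algebras over `ℂ`,
presented through its universal property. -/
structure FreeProd (A B : Type) [Ring A] [Algebra ℂ A] [StarRing A]
    [Ring B] [Algebra ℂ B] [StarRing B] where
  carrier : Type
  [ring : Ring carrier]
  [algebra : Algebra ℂ carrier]
  [starRing : StarRing carrier]
  [starModule : StarModule ℂ carrier]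
  inl : A →⋆ₐ[ℂ] carrier
  inr : B →⋆ₐ[ℂ] carrier
  universal : ∀ (D : Type) [Ring D] [Algebra ℂ D] [StarRing D] [StarModule ℂ D]
      (f : A →⋆ₐ[ℂ] D) (g : B →⋆ₐ[ℂ] D),
      ∃! h : carrier →⋆ₐ[ℂ] D, (∀ a, h (inl a) = f a) ∧ (∀ b, h (inr b) = g b)

attribute [instance] FreeProd.ring FreeProd.algebra FreeProd.starRing FreeProd.starModule

namespace FreeProd

variable {A B : Type} [Ring A] [Algebra ℂ A] [StarRing A]
    [Ring B] [Algebra ℂ B] [StarRing B]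

/-- The canonical embedding of a tagged element into the free product. -/
def embed (F : FreeProd A B) : A ⊕ B → F.carrier :=
  Sum.elim (fun a => F.inl a) (fun b => F.inr b)

/-- `Ψ` is the free product functional of `φ` and `ψ` on the free product `F`:
it is unital, restricts to `φ` and `ψ` on the two legs, and vanishes on alternating
products of centered elements. -/
def IsFreeProdFunctional (F : FreeProd A B) (φ : A →ₗ[ℂ] ℂ) (ψ : B →ₗ[ℂ] ℂ)
    (Ψ : F.carrier →ₗ[ℂ] ℂ) : Prop :=
  Ψ 1 = 1 ∧ (∀ a, Ψ (F.inl a) = φ a) ∧ (∀ b, Ψ (F.inr b) = ψ b) ∧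
  ∀ l : List (A ⊕ B), l ≠ [] →
    l.Chain' (fun x y => x.isLeft ≠ y.isLeft) →
    (∀ x ∈ l, Sum.elim (fun a => φ a = 0) (fun b => ψ b = 0) x) →
    Ψ ((l.map F.embed).prod) = 0

end FreeProd

section ProdFunctionals

variable {A : Type} [Ring A] [Algebra ℂ A] [StarRing A]

/-- `Ψ` is the tensor (tensor-independent) product functional of `φ` and `ψ`
relative to the counit `δc`. -/
def IsTensorProdFunctional (F : FreeProd A A) (δc : A →⋆ₐ[ℂ] ℂ)
    (φ ψ : A →ₗ[ℂ] ℂ) (Ψ : F.carrier →ₗ[ℂ] ℂ) : Prop :=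
  Ψ 1 = 1 ∧
  ∀ l : List (A ⊕ A), l ≠ [] →
    l.Chain' (fun x y => x.isLeft ≠ y.isLeft) →
    (∀ x ∈ l, Sum.elim (fun a => δc a = 0) (fun b => δc b = 0) x) →
    Ψ ((l.map F.embed).prod) =
      φ (l.filterMap Sum.getLeft?).prod * ψ (l.filterMap Sum.getRight?).prod

/-- `Ψ` is the boolean product functional of `φ` and `ψ` relative to the counit `δc`. -/
def IsBooleanProdFunctional (F : FreeProd A A) (δc : A →⋆ₐ[ℂ] ℂ)
    (φ ψ : A →ₗ[ℂ] ℂ) (Ψ : F.carrier →ₗ[ℂ] ℂ) : Prop :=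
  Ψ 1 = 1 ∧
  ∀ l : List (A ⊕ A), l ≠ [] →
    l.Chain' (fun x y => x.isLeft ≠ y.isLeft) →
    (∀ x ∈ l, Sum.elim (fun a => δc a = 0) (fun b => δc b = 0) x) →
    Ψ ((l.map F.embed).prod) = (l.map (Sum.elim (fun a => φ a) (fun b => ψ b))).prod

/-- `Ψ` is the monotone product functional of `φ` and `ψ` relative to the counit `δc`. -/
def IsMonotoneProdFunctional (F : FreeProd A A) (δc : A →⋆ₐ[ℂ] ℂ)
    (φ ψ : A →ₗ[ℂ] ℂ) (Ψ : F.carrier →ₗ[ℂ] ℂ) : Prop :=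
  Ψ 1 = 1 ∧
  ∀ l : List (A ⊕ A), l ≠ [] →
    l.Chain' (fun x y => x.isLeft ≠ y.isLeft) →
    (∀ x ∈ l, Sum.elim (fun a => δc a = 0) (fun b => δc b = 0) x) →
    Ψ ((l.map F.embed).prod) =
      φ (l.filterMap Sum.getLeft?).prod * ((l.filterMap Sum.getRight?).map (fun b => ψ b)).prod

/-- `Ψ` is the anti-monotone product functional of `φ` and `ψ` relative to the counit `δc`. -/
def IsAntiMonotoneProdFunctional (F : FreeProd A A) (δc : A →⋆ₐ[ℂ] ℂ)
    (φ ψ : A →ₗ[ℂ] ℂ) (Ψ : F.carrier →ₗ[ℂ] ℂ) : Prop :=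
  Ψ 1 = 1 ∧
  ∀ l : List (A ⊕ A), l ≠ [] →
    l.Chain' (fun x y => x.isLeft ≠ y.isLeft) →
    (∀ x ∈ l, Sum.elim (fun a => δc a = 0) (fun b => δc b = 0) x) →
    Ψ ((l.map F.embed).prod) =
      ((l.filterMap Sum.getLeft?).map (fun a => φ a)).prod * ψ (l.filterMap Sum.getRight?).prod

end ProdFunctionals

namespace BrownAlg

variable {n : ℕ}

/-- `Δ` is the coproduct of the unitary dual group `U⟨n⟩`. -/
def IsCoprod (U : BrownAlg n) (F : FreeProd U.carrier U.carrier)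
    (Δ : U.carrier →⋆ₐ[ℂ] F.carrier) : Prop :=
  ∀ i j, Δ (U.u i j) = ∑ k, F.inl (U.u i k) * F.inr (U.u k j)

/-- `δc` is the counit of the unitary dual group `U⟨n⟩`. -/
def IsCounit (U : BrownAlg n) (δc : U.carrier →⋆ₐ[ℂ] ℂ) : Prop :=
  ∀ i j, δc (U.u i j) = if i = j then 1 else 0

/-- `Σ` is the antipode of the unitary dual group `U⟨n⟩`. -/
def IsAntipode (U : BrownAlg n) (Sa : U.carrier →⋆ₐ[ℂ] U.carrier) : Prop :=
  ∀ i j, Sa (U.u i j) = star (U.u j i)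

/-- `χ = φ ⋆_F ψ`, the free convolution of the states `φ` and `ψ` on `U⟨n⟩`. -/
def FreeConv (U : BrownAlg n) (F : FreeProd U.carrier U.carrier)
    (Δ : U.carrier →⋆ₐ[ℂ] F.carrier) (φ ψ χ : U.carrier →ₗ[ℂ] ℂ) : Prop :=
  ∃ Ψ : F.carrier →ₗ[ℂ] ℂ, F.IsFreeProdFunctional φ ψ Ψ ∧ ∀ a, Ψ (Δ a) = χ a

/-- `χ = φ ⋆_T ψ`, the tensor convolution of the states `φ` and `ψ` on `U⟨n⟩`. -/
def TensorConv (U : BrownAlg n) (F : FreeProd U.carrier U.carrier)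
    (Δ : U.carrier →⋆ₐ[ℂ] F.carrier) (δc : U.carrier →⋆ₐ[ℂ] ℂ)
    (φ ψ χ : U.carrier →ₗ[ℂ] ℂ) : Prop :=
  ∃ Ψ : F.carrier →ₗ[ℂ] ℂ, IsTensorProdFunctional F δc φ ψ Ψ ∧ ∀ a, Ψ (Δ a) = χ a

/-- `χ = φ ⋆_B ψ`, the boolean convolution. -/
def BooleanConv (U : BrownAlg n) (F : FreeProd U.carrier U.carrier)
    (Δ : U.carrier →⋆ₐ[ℂ] F.carrier) (δc : U.carrier →⋆ₐ[ℂ] ℂ)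
    (φ ψ χ : U.carrier →ₗ[ℂ] ℂ) : Prop :=
  ∃ Ψ : F.carrier →ₗ[ℂ] ℂ, IsBooleanProdFunctional F δc φ ψ Ψ ∧ ∀ a, Ψ (Δ a) = χ a

/-- `χ = φ ⋆_M ψ`, the monotone convolution. -/
def MonotoneConv (U : BrownAlg n) (F : FreeProd U.carrier U.carrier)
    (Δ : U.carrier →⋆ₐ[ℂ] F.carrier) (δc : U.carrier →⋆ₐ[ℂ] ℂ)
    (φ ψ χ : U.carrier →ₗ[ℂ] ℂ) : Prop :=
  ∃ Ψ : F.carrier →ₗ[ℂ] ℂ, IsMonotoneProdFunctional F δc φ ψ Ψ ∧ ∀ a, Ψ (Δ a) = χ a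

/-- `χ = φ ⋆_AM ψ`, the anti-monotone convolution. -/
def AntiMonotoneConv (U : BrownAlg n) (F : FreeProd U.carrier U.carrier)
    (Δ : U.carrier →⋆ₐ[ℂ] F.carrier) (δc : U.carrier →⋆ₐ[ℂ] ℂ)
    (φ ψ χ : U.carrier →ₗ[ℂ] ℂ) : Prop :=
  ∃ Ψ : F.carrier →ₗ[ℂ] ℂ, IsAntiMonotoneProdFunctional F δc φ ψ Ψ ∧ ∀ a, Ψ (Δ a) = χ a

end BrownAlg

open scoped Classical

/-- `P` is a partition of the subset `S` of `{0, …, q-1}`. -/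
def IsPartitionOn (q : ℕ) (S : Finset (Fin q)) (P : Finset (Finset (Fin q))) : Prop :=
  (∀ B ∈ P, B.Nonempty ∧ B ⊆ S) ∧ ∀ i ∈ S, ∃! B, B ∈ P ∧ i ∈ B

/-- The collection of blocks `P` is non-crossing. -/
def IsNonCrossing (q : ℕ) (P : Finset (Finset (Fin q))) : Prop :=
  ¬ ∃ (B₁ B₂ : Finset (Fin q)) (i j k l : Fin q),
      B₁ ∈ P ∧ B₂ ∈ P ∧ B₁ ≠ B₂ ∧
      i < j ∧ j < k ∧ k < l ∧ i ∈ B₁ ∧ k ∈ B₁ ∧ j ∈ B₂ ∧ l ∈ B₂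

/-- The elements of the block `B`, listed in increasing order of their indices. -/
def blockList {A : Type} {q : ℕ} (a : Fin q → A) (B : Finset (Fin q)) : List A :=
  (B.sort (· ≤ ·)).map a

/-- `κ_P(a₁, …, a_q)`: the product over the blocks of `P` of the cumulants. -/
def cumPart {A : Type} (κ : List A → ℂ) {q : ℕ} (a : Fin q → A)
    (P : Finset (Finset (Fin q))) : ℂ :=
  ∏ B ∈ P, κ (blockList a B)

/-- `φ_P(a₁, …, a_q)`: the product over the blocks of `P` of the moments. -/
def momPart {A : Type} [Ring A] [Algebra ℂ A] (φ : A →ₗ[ℂ] ℂ) {q : ℕ}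
    (a : Fin q → A) (P : Finset (Finset (Fin q))) : ℂ :=
  ∏ B ∈ P, φ (blockList a B).prod

/-- `κ` is the family of free cumulants of `(A, φ)`, encoded as a function on lists:
`κ [a₁, …, a_q] = κ_q(a₁, …, a_q)`.  It is multilinear and satisfies the
moment-cumulant relations over non-crossing partitions. -/
def IsCumulantFamily {A : Type} [Ring A] [Algebra ℂ A] (φ : A →ₗ[ℂ] ℂ)
    (κ : List A → ℂ) : Prop :=
  (∀ (l₁ l₂ : List A) (c : ℂ) (x y : A),
      κ (l₁ ++ (c • x + y) :: l₂) = c * κ (l₁ ++ x :: l₂) + κ (l₁ ++ y :: l₂)) ∧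
  ∀ q : ℕ, 0 < q → ∀ a : Fin q → A,
    φ (List.ofFn a).prod =
      ∑ P ∈ Finset.univ.filter (fun P : Finset (Finset (Fin q)) =>
          IsPartitionOn q Finset.univ P ∧ IsNonCrossing q P),
        cumPart κ a P

/-- The alternating cyclic word
`u_{i₁j₁}, u_{i₂j₁}*, u_{i₂j₂}, u_{i₃j₂}*, …, u_{i_rj_r}, u_{i₁j_r}*` (of length `2r`). -/
def altCycle1 {n : ℕ} (U : BrownAlg n) (r : ℕ) (i j : ℕ → Fin n) : List U.carrier :=
  ((List.range r).map (fun m => [U.u (i m) (j m), star (U.u (i ((m + 1) % r)) (j m))])).flatten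

/-- The alternating cyclic word
`u_{i₁j₁}*, u_{i₁j₂}, u_{i₂j₂}*, u_{i₂j₃}, …, u_{i_rj_r}*, u_{i_rj₁}` (of length `2r`). -/
def altCycle2 {n : ℕ} (U : BrownAlg n) (r : ℕ) (i j : ℕ → Fin n) : List U.carrier :=
  ((List.range r).map (fun m => [star (U.u (i m) (j m)), U.u (i m) (j ((m + 1) % r))])).flatten

/-- A word in the generators `u_{ij}` and their adjoints, prescribed by a star pattern
`ε` and index patterns `a`, `b`. -/
def genWord {n : ℕ} (U : BrownAlg n) (q : ℕ) (ε : ℕ → Bool) (a b : ℕ → Fin n) :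
    List U.carrier :=
  (List.range q).map (fun m => if ε m then star (U.u (a m) (b m)) else U.u (a m) (b m))

namespace FreeHaar

section ListSums

variable {L R : Type}

/-- The sum of `F x b y` over all ways to write a list as `x ++ b :: y`. -/
def splitSum [AddCommMonoid R] : List L → (List L → L → List L → R) → R
  | [], _ => 0
  | a :: w, F => F [] a w + splitSum w (fun x b y => F (a :: x) b y)

theorem splitSum_congr [AddCommMonoid R] {w : List L} {F G : List L → L → List L → R}
    (h : ∀ x b y, w = x ++ b :: y → F x b y = G x b y) : splitSum w F = splitSum w G := by
  induction w generalizing F G with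
  | nil => rfl
  | cons a w ih =>
    simp only [splitSum]
    rw [h [] a w rfl, ih fun x b y e => h (a :: x) b y (by simp [e])]

theorem splitSum_add [AddCommMonoid R] (w : List L) (F G : List L → L → List L → R) :
    splitSum w (fun x b y => F x b y + G x b y) = splitSum w F + splitSum w G := by
  induction w generalizing F G with
  | nil => simp [splitSum]
  | cons a w ih => simp only [splitSum, ih]; exact add_add_add_comm _ _ _ _

theorem map_splitSum {S : Type} [AddCommMonoid R] [AddCommMonoid S] (f : R →+ S) (w : List L)
    (F : List L → L → List L → R) :
    f (splitSum w F) = splitSum w (fun x b y => f (F x b y)) := by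
  induction w generalizing F with
  | nil => simp [splitSum]
  | cons a w ih => simp [splitSum, ih]

theorem mul_splitSum [Semiring R] (c : R) (w : List L) (F : List L → L → List L → R) :
    c * splitSum w F = splitSum w (fun x b y => c * F x b y) :=
  map_splitSum (AddMonoidHom.mulLeft c) w F

theorem splitSum_zero [AddCommMonoid R] (w : List L) :
    splitSum w (fun _ _ _ => (0 : R)) = 0 := by
  induction w with
  | nil => rfl
  | cons a w ih => simp [splitSum, ih]

theorem splitSum_const (w : List L) (c : ℂ) :
    splitSum w (fun _ _ _ => c) = w.length * c := by
  induction w with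
  | nil => simp [splitSum]
  | cons a w ih => simp only [splitSum, ih, List.length_cons]; push_cast; ring

theorem splitSum_length (w : List L) (f : ℕ → ℕ → ℂ) :
    splitSum w (fun x _ y => f x.length y.length) =
      ∑ i ∈ Finset.range w.length, f i (w.length - 1 - i) := by
  induction w generalizing f with
  | nil => simp [splitSum]
  | cons a w ih =>
    simp only [splitSum, List.length_cons, ih fun i j => f (i + 1) j, List.length_nil]
    rw [Finset.sum_range_succ', add_comm]
    congr 1
    exact Finset.sum_congr rfl fun i _ => by congr 1; omega

theorem splitSum_append [AddCommMonoid R] (v x : List L) (F : List L → L → List L → R) :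
    splitSum (v ++ x) F = splitSum v (fun y b z => F y b (z ++ x)) +
      splitSum x (fun y b z => F (v ++ y) b z) := by
  induction v generalizing F with
  | nil => simp [splitSum]
  | cons a v ih => simp [splitSum, ih, add_assoc]

/-- Two successive cuts can be summed in either order. -/
theorem splitSum_splitSum [AddCommMonoid R] (w : List L)
    (F : List L → L → List L → L → List L → R) :
    splitSum w (fun x b y => splitSum y (fun x' b' y' => F x b x' b' y')) =
      splitSum w (fun z b' y' => splitSum z (fun x b x' => F x b x' b' y')) := by
  induction w generalizing F with
  | nil => rfl
  | cons a w ih =>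
    simp only [splitSum, ih, splitSum_add, zero_add]

/-- The sum over all sublists `s` of `w` of `f s` times the product of the values of `N` on the
maximal intervals of `g ++ w` disjoint from `s`. -/
def gapSum (N : List L → ℂ) : List L → List L → (List L → ℂ) → ℂ
  | g, [], f => N g * f []
  | g, b :: w, f => gapSum N (g ++ [b]) w f + N g * gapSum N [] w (fun s => f (b :: s))

theorem gapSum_congr {N N' : List L → ℂ} {g w : List L} {f f' : List L → ℂ}
    (hN : ∀ v, v.Sublist (g ++ w) → N v = N' v) (hf : ∀ s, s.Sublist w → f s = f' s) :
    gapSum N g w f = gapSum N' g w f' := by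
  induction w generalizing g f f' with
  | nil => simp only [gapSum]; rw [hN g (by simp), hf [] (by simp)]
  | cons b w ih =>
    simp only [gapSum]
    rw [ih (fun v hv => hN v (by simpa using hv)) (fun s hs => hf s (hs.cons b)), hN g (by simp),
      ih (g := []) (f := fun s => f (b :: s)) (f' := fun s => f' (b :: s))
        (fun v hv => hN v ?_) (fun s hs => hf _ (hs.cons_cons b))]
    exact (hv.trans (List.sublist_cons_self b w)).trans (List.sublist_append_right g _)

theorem gapSum_map {L' : Type} (e : L → L') (N : List L' → ℂ) (g w : List L) (f : List L' → ℂ) :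
    gapSum (fun v => N (v.map e)) g w (fun s => f (s.map e)) =
      gapSum N (g.map e) (w.map e) f := by
  induction w generalizing g f with
  | nil => simp [gapSum]
  | cons b w ih =>
    simp only [gapSum, List.map_cons, ih (g ++ [b]), ih [] (fun s => f (e b :: s))]
    simp

theorem gapSum_sub (N : List L → ℂ) (g w : List L) (f f' : List L → ℂ) :
    gapSum N g w (fun s => f s - f' s) = gapSum N g w f - gapSum N g w f' := by
  induction w generalizing g f f' with
  | nil => simp only [gapSum]; ring
  | cons b w ih => simp only [gapSum, ih]; ring

theorem gapSum_add (N : List L → ℂ) (g w : List L) (f f' : List L → ℂ) :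
    gapSum N g w (fun s => f s + f' s) = gapSum N g w f + gapSum N g w f' := by
  induction w generalizing g f f' with
  | nil => simp only [gapSum]; ring
  | cons b w ih => simp only [gapSum, ih]; ring

theorem gapSum_mul (N : List L → ℂ) (g w : List L) (c : ℂ) (f : List L → ℂ) :
    gapSum N g w (fun s => c * f s) = c * gapSum N g w f := by
  induction w generalizing g f with
  | nil => simp only [gapSum]; ring
  | cons b w ih => simp only [gapSum, ih]; ring

theorem gapSum_zero (N : List L → ℂ) (g w : List L) : gapSum N g w (fun _ => 0) = 0 := by
  simpa using gapSum_mul N g w 0 (fun _ => 0)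

theorem gapSum_splitSum (N : List L → ℂ) (g w : List L) (A B : L → List L → ℂ) :
    gapSum N g w (fun s => splitSum s (fun x b y => A b x * B b y)) =
      splitSum w (fun x b y => gapSum N g x (A b) * gapSum N [] y (B b)) := by
  induction w generalizing g A with
  | nil => simp [gapSum, splitSum]
  | cons c w ih =>
    simp only [gapSum, splitSum, gapSum_add, gapSum_mul, ih, add_mul, splitSum_add]
    simp only [mul_assoc, ← mul_splitSum]
    ring

theorem gapSum_nil_indicator [DecidableEq L] (N : List L → ℂ) (g w : List L) :
    gapSum N g w (fun s => if s = [] then 1 else 0) = N (g ++ w) := by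
  induction w generalizing g with
  | nil => simp [gapSum]
  | cons b w ih => simp [gapSum, ih, gapSum_zero]

theorem gapSum_singleton_indicator [DecidableEq L] (N : List L → ℂ) (g w : List L) (c : L) :
    gapSum N g w (fun s => if s = [c] then 1 else 0) =
      splitSum w (fun y b z => if b = c then N (g ++ y) * N z else 0) := by
  induction w generalizing g with
  | nil => simp [gapSum, splitSum]
  | cons b w ih =>
    simp only [gapSum, splitSum, ih, List.cons.injEq, List.append_nil, List.append_assoc,
      List.singleton_append]
    rw [add_comm]
    congr 1
    by_cases h : b = c
    · simp [h, gapSum_nil_indicator]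
    · simp [h, gapSum_zero]

/-- The moments attached to a family of free cumulants, by recursion on the block of the first
letter. -/
def freeMoment (κ : List L → ℂ) : List L → ℂ
  | [] => 1
  | a :: w => gapSum (fun g => if _h : g.length ≤ w.length then freeMoment κ g else 0) [] w
      (fun s => κ (a :: s))
termination_by w => w.length
decreasing_by simp; omega

theorem freeMoment_nil (κ : List L → ℂ) : freeMoment κ [] = 1 := by
  rw [freeMoment]

theorem freeMoment_cons (κ : List L → ℂ) (a : L) (w : List L) :
    freeMoment κ (a :: w) = gapSum (freeMoment κ) [] w (fun s => κ (a :: s)) := by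
  rw [freeMoment]
  refine gapSum_congr (fun v hv => ?_) fun _ _ => rfl
  simp only [List.nil_append] at hv
  simp [hv.length_le]

theorem freeMoment_map {L' : Type} (e : L → L') (κ : List L' → ℂ) (w : List L) :
    freeMoment (fun v => κ (v.map e)) w = freeMoment κ (w.map e) := by
  induction hw : w.length using Nat.strong_induction_on generalizing w with
  | _ k ih =>
    cases w with
    | nil => simp [freeMoment_nil]
    | cons a w =>
      rw [List.map_cons, freeMoment_cons, freeMoment_cons,
        ← List.map_nil (f := e), ← gapSum_map e]
      refine gapSum_congr (fun v hv => ih _ ?_ v rfl) fun s _ => by simp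
      have := hv.length_le
      simp at this hw
      omega

theorem gapSum_sub_eq_of_eqOn_shorter (N : List L → ℂ) (hN : N [] = 1) (f f' : List L → ℂ)
    (g w : List L) (h : ∀ s, s.Sublist w → s.length < w.length → f s = f' s) :
    gapSum N g w f - gapSum N g w f' =
      N g * (f w - f' w) := by
  induction w generalizing g f f' with
  | nil => simp only [gapSum]; ring
  | cons b w ih =>
    have h1 : gapSum N (g ++ [b]) w f = gapSum N (g ++ [b]) w f' :=
      gapSum_congr (fun _ _ => rfl) fun s hs =>
        h s (hs.cons b) (by have := hs.length_le; simp; omega)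
    have h2 := ih (fun s => f (b :: s)) (fun s => f' (b :: s)) []
      fun s hs hl => h _ (hs.cons_cons b) (by simpa using hl)
    simp only [gapSum, h1]
    rw [hN, one_mul] at h2
    linear_combination N g * h2

/-- Cumulants are determined by moments. -/
theorem eq_of_freeMoment_eq {κ κ' : List L → ℂ}
    (h : ∀ w, freeMoment κ w = freeMoment κ' w) (w : List L) (hw : w ≠ []) :
    κ w = κ' w := by
  induction hl : w.length using Nat.strong_induction_on generalizing w with
  | _ k ih =>
    cases w with
    | nil => exact absurd rfl hw
    | cons a w =>
      have h0 := h (a :: w)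
      have e : freeMoment κ' = freeMoment κ := funext fun v => (h v).symm
      rw [freeMoment_cons, freeMoment_cons, e] at h0
      have := gapSum_sub_eq_of_eqOn_shorter (freeMoment κ) (freeMoment_nil κ)
        (fun s => κ (a :: s)) (fun s => κ' (a :: s)) [] w
        (fun s hs hlt => ih _ (by simp at hl ⊢; omega) _ (by simp) rfl)
      rw [h0, sub_self, freeMoment_nil, one_mul] at this
      exact (sub_eq_zero.mp this.symm)

end ListSums

end FreeHaar

namespace FreeHaar

section Letters

variable {n : ℕ}

/-- A generator of the Brown algebra: `(false, p, s)` stands for the `(p, s)` entry of the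
fundamental unitary matrix, and `(true, p, s)` for the `(p, s)` entry of its adjoint. -/
abbrev Letter (n : ℕ) := Bool × Fin n × Fin n

/-- The adjoint of a letter. -/
def Letter.adj (a : Letter n) : Letter n := (!a.1, a.2.2, a.2.1)

/-- The letter `a` with its left index replaced by that of `b`. -/
def Letter.mix (a b : Letter n) : Letter n := (a.1, b.2.1, a.2.2)

/-- `AltPath c w d`: the types of the letters of `w` alternate, the right index of each letter is
the left index of the next one, and `c`, `d` are the types and left indices of the first letter
and of the letter that may come after the last one. -/
def AltPath : Bool × Fin n → List (Letter n) → Bool × Fin n → Prop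
  | c, [], d => c = d
  | c, x :: t, d => (x.1, x.2.1) = c ∧ AltPath (!x.1, x.2.2) t d

theorem altPath_append {c d : Bool × Fin n} (x y : List (Letter n)) :
    AltPath c (x ++ y) d ↔ ∃ e, AltPath c x e ∧ AltPath e y d := by
  induction x generalizing c with
  | nil => simp [AltPath]
  | cons a x ih => simp [AltPath, ih, and_assoc]

theorem AltPath.type_eq {c d : Bool × Fin n} {x : List (Letter n)} (h : AltPath c x d) :
    Even x.length ↔ c.1 = d.1 := by
  induction x generalizing c with
  | nil => simp [AltPath] at h; simp [h]
  | cons a x ih =>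
    obtain ⟨rfl, h2⟩ := h
    rw [List.length_cons, Nat.even_add_one, ih h2]
    cases a.1 <;> cases d.1 <;> simp

/-- `a :: t` is a cyclically alternating word. -/
def IsAltCycle : List (Letter n) → Prop
  | [] => False
  | a :: t => AltPath (a.1, a.2.1) (a :: t) (a.1, a.2.1)

theorem isAltCycle_rotate (a : Letter n) (w : List (Letter n)) :
    IsAltCycle (a :: w) ↔ IsAltCycle (w ++ [a]) := by
  cases w with
  | nil => simp
  | cons b w =>
    simp only [IsAltCycle, List.cons_append, AltPath, true_and, altPath_append]
    constructor
    · rintro ⟨h1, h2⟩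
      exact ⟨_, h2, rfl, h1.symm⟩
    · rintro ⟨e, h1, rfl, h2⟩
      exact ⟨h2.symm, h1⟩

/-- The cumulant of a cyclically alternating word of length `l`. -/
def altCumulant (n l : ℕ) : ℂ :=
  if Even l ∧ 0 < l then
    (n : ℂ) ^ ((1 : ℤ) - 2 * (l / 2 : ℕ)) * (-1) ^ (l / 2 - 1) * (catalan (l / 2 - 1) : ℂ)
  else 0

theorem altCumulant_two_mul (n r : ℕ) : altCumulant n (2 * r + 2) =
    (n : ℂ) ^ (-(1 : ℤ) - 2 * r) * (-1) ^ r * (catalan r : ℂ) := by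
  have : (2 * r + 2) / 2 = r + 1 := by omega
  rw [altCumulant, if_pos ⟨by use r + 1; ring, by omega⟩, this]
  simp only [Nat.add_sub_cancel]
  congr 3
  push_cast
  ring

theorem altCumulant_odd (n r : ℕ) : altCumulant n (2 * r + 1) = 0 := by
  rw [altCumulant, if_neg]
  rintro ⟨h, -⟩
  exact absurd h (by simp)

/-- The recursion of the alternating cumulants, which is that of the Catalan numbers. -/
theorem altCumulant_recursion (hn : 1 ≤ n) (r : ℕ) :
    (n : ℂ) * altCumulant n (2 * r + 2) = (if r = 0 then 1 else 0) -
      ∑ i ∈ Finset.range (2 * r + 1), altCumulant n (i + 1) * altCumulant n (2 * r - i + 1) := by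
  have hn0 : (n : ℂ) ≠ 0 := by exact_mod_cast (by omega : n ≠ 0)
  cases r with
  | zero =>
    have h1 : altCumulant n 1 = 0 := altCumulant_odd n 0
    have h2 := altCumulant_two_mul n 0
    simp at h2
    simp [h1, h2, hn0]
  | succ r =>
    have key : ∑ i ∈ Finset.range (2 * (r + 1) + 1),
        altCumulant n (i + 1) * altCumulant n (2 * (r + 1) - i + 1) =
        ∑ k ∈ Finset.range (r + 1),
          altCumulant n (2 * k + 2) * altCumulant n (2 * (r - k) + 2) := by
      have h3 : ∀ m ≤ r + 1, ∑ i ∈ Finset.range (2 * m + 1),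
          altCumulant n (i + 1) * altCumulant n (2 * (r + 1) - i + 1) =
          ∑ k ∈ Finset.range m, altCumulant n (2 * k + 2) * altCumulant n (2 * (r - k) + 2) := by
        intro m hm
        induction m with
        | zero => simp [show altCumulant n 1 = 0 from altCumulant_odd n 0]
        | succ m ih =>
          rw [show 2 * (m + 1) + 1 = 2 * m + 1 + 1 + 1 by ring, Finset.sum_range_succ,
            Finset.sum_range_succ, ih (by omega), Finset.sum_range_succ _ m,
            show 2 * m + 1 + 1 + 1 = 2 * (m + 1) + 1 by ring, altCumulant_odd,
            show 2 * (r + 1) - (2 * m + 1) + 1 = 2 * (r - m) + 2 by omega]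
          ring
      exact h3 _ le_rfl
    rw [key, altCumulant_two_mul, catalan_succ, if_neg (by omega)]
    push_cast
    rw [Finset.mul_sum, Finset.mul_sum, zero_sub, ← Finset.sum_neg_distrib,
      ← Fin.sum_univ_eq_sum_range (fun k => -(altCumulant n (2 * k + 2) *
        altCumulant n (2 * (r - k) + 2)))]
    refine Finset.sum_congr rfl fun k _ => ?_
    rw [altCumulant_two_mul, altCumulant_two_mul]
    obtain ⟨k, hk'⟩ := k
    obtain ⟨m, rfl⟩ := Nat.exists_eq_add_of_le (Nat.lt_succ_iff.1 hk')
    simp only [Nat.add_sub_cancel_left]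
    have e1 : (n : ℂ) * (n : ℂ) ^ (-(1 : ℤ) - 2 * ((k + m : ℕ) + 1)) =
        (n : ℂ) ^ (-(1 : ℤ) - 2 * k) * (n : ℂ) ^ (-(1 : ℤ) - 2 * m) := by
      rw [← zpow_one_add₀ hn0, ← zpow_add₀ hn0]
      congr 1
      push_cast
      ring
    push_cast at e1 ⊢
    linear_combination (-1 : ℂ) ^ (k + m + 1) * catalan k * catalan m * e1

/-- The free cumulants of the letters under the free Haar trace. -/
def haarCumulant (w : List (Letter n)) : ℂ :=
  if IsAltCycle w then altCumulant n w.length else 0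

theorem haarCumulant_rotate (a : Letter n) (w : List (Letter n)) :
    haarCumulant (a :: w) = haarCumulant (w ++ [a]) := by
  simp only [haarCumulant, isAltCycle_rotate a w, List.length_cons, List.length_append,
    List.length_nil]

theorem haarCumulant_recursion (hn : 1 ≤ n) (a : Letter n) (t : List (Letter n)) :
    (n : ℂ) * haarCumulant (a :: t) = (if t = [a.adj] then 1 else 0) -
      splitSum t (fun x b y => (if b.1 = a.1 then haarCumulant (a.mix b :: x) else 0) *
        haarCumulant (b.mix a :: y)) := by
  by_cases hc : IsAltCycle (a :: t)
  · have hpath := hc.2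
    have hodd : Odd t.length := by
      rw [← Nat.not_even_iff_odd, hpath.type_eq]; simp
    obtain ⟨r, hr⟩ := hodd
    have hsum : splitSum t (fun x b y => (if b.1 = a.1 then haarCumulant (a.mix b :: x) else 0) *
        haarCumulant (b.mix a :: y)) =
        splitSum t (fun x b y => altCumulant n (x.length + 1) * altCumulant n (y.length + 1)) := by
      refine splitSum_congr fun x b y e => ?_
      rw [e, altPath_append] at hpath
      obtain ⟨e, h1, rfl, h2⟩ := hpath
      have ht := h1.type_eq
      by_cases hb : b.1 = a.1
      · have c1 : IsAltCycle (a.mix b :: x) := by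
          refine ⟨rfl, ?_⟩
          simpa [Letter.mix, ← hb] using h1
        have c2 : IsAltCycle (b.mix a :: y) := by
          refine ⟨rfl, ?_⟩
          simpa [Letter.mix, hb] using h2
        simp [haarCumulant, c1, c2, hb]
      · have he : Even x.length := ht.2 (by revert hb; cases a.1 <;> cases b.1 <;> simp)
        obtain ⟨m, hm⟩ := he
        rw [if_neg hb, hm, ← two_mul, altCumulant_odd]
        simp
    rw [hsum, splitSum_length t fun i j => altCumulant n (i + 1) * altCumulant n (j + 1),
      haarCumulant, if_pos hc, List.length_cons, hr]
    have hiff : t = [a.adj] ↔ r = 0 := by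
      constructor
      · rintro rfl
        simpa using hr
      · rintro rfl
        obtain ⟨b, rfl⟩ := List.length_eq_one_iff.1 (by simpa using hr)
        obtain ⟨h1, h2⟩ := hpath
        obtain ⟨x, y, z⟩ := b
        simp_all [AltPath, Letter.adj]
    simp only [hiff]
    exact altCumulant_recursion hn r
  · have h1 : t ≠ [a.adj] := by
      rintro rfl
      exact hc (by simp [IsAltCycle, AltPath, Letter.adj])
    rw [haarCumulant, if_neg hc, if_neg h1, mul_zero, eq_comm, zero_sub, neg_eq_zero]
    refine (splitSum_congr fun x b y e => ?_).trans (splitSum_zero t)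
    by_contra hne
    apply hc
    have h2 := left_ne_zero_of_mul hne
    have h3 := right_ne_zero_of_mul hne
    simp only [haarCumulant, ne_eq, ite_eq_right_iff, Classical.not_imp] at h2 h3
    obtain ⟨hb, ⟨-, h2⟩, -⟩ := h2
    obtain ⟨⟨-, h3⟩, -⟩ := h3
    refine ⟨rfl, ?_⟩
    rw [e, altPath_append]
    refine ⟨(b.1, b.2.1), ?_, rfl, ?_⟩
    · simpa [Letter.mix, hb] using h2
    · simpa [Letter.mix, hb] using h3

/-- The contribution of a pair of letters `a`, `b` to the Schwinger–Dyson equation of the word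
`x ++ a :: y ++ b :: z`. -/
def pairTerm (M : List (Letter n) → ℂ) (x : List (Letter n)) (a : Letter n) (y : List (Letter n))
    (b : Letter n) (z : List (Letter n)) : ℂ :=
  if b.1 = a.1 then -(M (a.mix b :: y) * M (x ++ b.mix a :: z))
  else if b = a.adj then M y * M (x ++ z) else 0

/-- The Schwinger–Dyson equation at the first letter. -/
theorem freeMoment_haarCumulant_cons (hn : 1 ≤ n) (a : Letter n) (w : List (Letter n)) :
    (n : ℂ) * freeMoment haarCumulant (a :: w) =
      splitSum w (fun y b z => pairTerm (freeMoment haarCumulant) [] a y b z) := by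
  rw [freeMoment_cons, ← gapSum_mul]
  simp only [haarCumulant_recursion hn]
  rw [gapSum_sub, gapSum_singleton_indicator, gapSum_splitSum _ _ _
    (fun b x => if b.1 = a.1 then haarCumulant (a.mix b :: x) else 0)
    (fun b y => haarCumulant (b.mix a :: y)), sub_eq_add_neg, neg_eq_neg_one_mul, mul_splitSum,
    ← splitSum_add]
  refine splitSum_congr fun y b z _ => ?_
  simp only [pairTerm, List.nil_append]
  by_cases hb : b.1 = a.1
  · have : b ≠ a.adj := by
      rintro rfl
      simp [Letter.adj] at hb
    simp [hb, this, freeMoment_cons]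
  · simp [hb, gapSum_zero]

/-- The Schwinger–Dyson equation summed over all letters, for a tracial moment functional. -/
theorem freeMoment_haarCumulant_pairs (hn : 1 ≤ n)
    (htr : ∀ (a : Letter n) w, freeMoment haarCumulant (a :: w) =
      freeMoment haarCumulant (w ++ [a])) (w : List (Letter n)) :
    (n : ℂ) * w.length * freeMoment haarCumulant w = 2 * splitSum w (fun x a v =>
      splitSum v (fun y b z => pairTerm (freeMoment haarCumulant) x a y b z)) := by
  have hrot : ∀ x y : List (Letter n),
      freeMoment haarCumulant (x ++ y) = freeMoment haarCumulant (y ++ x) := by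
    intro x
    induction x with
    | nil => simp
    | cons a x ih =>
      intro y
      rw [List.cons_append, htr, List.append_assoc, ih, List.append_assoc, List.singleton_append]
  have h1 : (n : ℂ) * w.length * freeMoment haarCumulant w = splitSum w (fun x a v =>
      (n : ℂ) * freeMoment haarCumulant (a :: (v ++ x))) := by
    rw [mul_comm (n : ℂ), mul_assoc, ← splitSum_const]
    refine splitSum_congr fun x a v e => ?_
    rw [e, hrot, List.cons_append]
  rw [h1]
  simp only [freeMoment_haarCumulant_cons hn, splitSum_append, splitSum_add]
  rw [two_mul]
  congr 1
  · refine splitSum_congr fun x a v _ => splitSum_congr fun y b z _ => ?_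
    simp only [pairTerm, List.nil_append]
    rw [hrot x, List.cons_append, hrot x]
  · rw [← splitSum_splitSum w fun x b y a v => pairTerm (freeMoment haarCumulant) [] a (v ++ x) b y]
    refine splitSum_congr fun x b v _ => splitSum_congr fun y a z _ => ?_
    simp only [pairTerm, List.nil_append]
    have hs : b = a.adj ↔ a = b.adj := by
      constructor <;> rintro rfl <;> simp [Letter.adj]
    simp only [hs, eq_comm (a := b.1)]
    rw [hrot x, List.cons_append, hrot x z, mul_comm (freeMoment haarCumulant (a.mix b :: _)),
      mul_comm (freeMoment haarCumulant (z ++ x))]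

end Letters

end FreeHaar

namespace FreeHaar

section Partitions

variable {q : ℕ}

/-- The non-crossing partitions of the set `S`. -/
def ncPart (q : ℕ) (S : Finset (Fin q)) : Finset (Finset (Finset (Fin q))) :=
  Finset.univ.filter fun P => IsPartitionOn q S P ∧ IsNonCrossing q P

theorem mem_ncPart {S : Finset (Fin q)} {P : Finset (Finset (Fin q))} :
    P ∈ ncPart q S ↔ IsPartitionOn q S P ∧ IsNonCrossing q P := by
  simp [ncPart]

theorem _root_.IsPartitionOn.eq_of_mem {S : Finset (Fin q)} {P : Finset (Finset (Fin q))}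
    (h : IsPartitionOn q S P) {B C : Finset (Fin q)} (hB : B ∈ P) (hC : C ∈ P) {i : Fin q}
    (hiB : i ∈ B) (hiC : i ∈ C) : B = C :=
  (h.2 i ((h.1 B hB).2 hiB)).unique ⟨hB, hiB⟩ ⟨hC, hiC⟩

/-- The sum over the non-crossing partitions of `S` of the product of the weights of the blocks. -/
def ncSum (W : Finset (Fin q) → ℂ) (S : Finset (Fin q)) : ℂ :=
  ∑ P ∈ ncPart q S, ∏ B ∈ P, W B

theorem ncSum_empty (W : Finset (Fin q) → ℂ) : ncSum W ∅ = 1 := by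
  have : ncPart q ∅ = {∅} := by
    ext P
    rw [mem_ncPart, Finset.mem_singleton]
    constructor
    · rintro ⟨h, -⟩
      refine Finset.eq_empty_of_forall_notMem fun B hB => ?_
      obtain ⟨h1, h2⟩ := h.1 B hB
      obtain ⟨x, hx⟩ := h1
      exact absurd (h2 hx) (by simp)
    · rintro rfl
      exact ⟨⟨by simp, by simp⟩, by simp [IsNonCrossing]⟩
  simp [ncSum, this]

theorem union_mem_ncPart {S T : Finset (Fin q)}
    (hsep : ∀ e ∈ T, (∀ x ∈ S, e < x) ∨ (∀ x ∈ S, x < e))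
    {P Q : Finset (Finset (Fin q))} (hP : P ∈ ncPart q S) (hQ : Q ∈ ncPart q T) :
    P ∪ Q ∈ ncPart q (S ∪ T) := by
  rw [mem_ncPart] at *
  obtain ⟨⟨hP1, hP2⟩, hP3⟩ := hP
  obtain ⟨⟨hQ1, hQ2⟩, hQ3⟩ := hQ
  have hST : ∀ x ∈ S, x ∉ T := fun x hS hT => by
    rcases hsep x hT with h | h <;> exact lt_irrefl _ (h x hS)
  refine ⟨⟨?_, ?_⟩, ?_⟩
  · intro B hB
    rcases Finset.mem_union.1 hB with h | h
    · exact ⟨(hP1 B h).1, (hP1 B h).2.trans Finset.subset_union_left⟩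
    · exact ⟨(hQ1 B h).1, (hQ1 B h).2.trans Finset.subset_union_right⟩
  · intro i hi
    rcases Finset.mem_union.1 hi with h | h
    · obtain ⟨B, ⟨hB1, hB2⟩, hB3⟩ := hP2 i h
      refine ⟨B, ⟨Finset.mem_union_left _ hB1, hB2⟩, ?_⟩
      rintro C ⟨hC1, hC2⟩
      rcases Finset.mem_union.1 hC1 with h' | h'
      · exact hB3 C ⟨h', hC2⟩
      · exact absurd ((hQ1 C h').2 hC2) (hST i h)
    · obtain ⟨B, ⟨hB1, hB2⟩, hB3⟩ := hQ2 i h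
      refine ⟨B, ⟨Finset.mem_union_right _ hB1, hB2⟩, ?_⟩
      rintro C ⟨hC1, hC2⟩
      rcases Finset.mem_union.1 hC1 with h' | h'
      · exact absurd h (hST i ((hP1 C h').2 hC2))
      · exact hB3 C ⟨h', hC2⟩
  · rintro ⟨B, C, i, j, k, l, hB, hC, hne, hij, hjk, hkl, hiB, hkB, hjC, hlC⟩
    rcases Finset.mem_union.1 hB with hB | hB <;> rcases Finset.mem_union.1 hC with hC | hC
    · exact hP3 ⟨B, C, i, j, k, l, hB, hC, hne, hij, hjk, hkl, hiB, hkB, hjC, hlC⟩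
    · rcases hsep j ((hQ1 C hC).2 hjC) with h | h
      · exact absurd (h i ((hP1 B hB).2 hiB)) (not_lt.2 hij.le)
      · exact absurd (h k ((hP1 B hB).2 hkB)) (not_lt.2 hjk.le)
    · rcases hsep k ((hQ1 B hB).2 hkB) with h | h
      · exact absurd (h j ((hP1 C hC).2 hjC)) (not_lt.2 hjk.le)
      · exact absurd (h l ((hP1 C hC).2 hlC)) (not_lt.2 hkl.le)
    · exact hQ3 ⟨B, C, i, j, k, l, hB, hC, hne, hij, hjk, hkl, hiB, hkB, hjC, hlC⟩

theorem filter_mem_ncPart {S T : Finset (Fin q)} (hST : Disjoint S T)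
    {P : Finset (Finset (Fin q))} (hP : P ∈ ncPart q (S ∪ T))
    (hb : ∀ C ∈ P, C ⊆ S ∨ C ⊆ T) : P.filter (· ⊆ S) ∈ ncPart q S := by
  rw [mem_ncPart] at *
  obtain ⟨⟨hP1, hP2⟩, hP3⟩ := hP
  refine ⟨⟨?_, ?_⟩, ?_⟩
  · intro B hB
    rw [Finset.mem_filter] at hB
    exact ⟨(hP1 B hB.1).1, hB.2⟩
  · intro i hi
    obtain ⟨B, ⟨hB1, hB2⟩, hB3⟩ := hP2 i (Finset.mem_union_left _ hi)
    refine ⟨B, ⟨Finset.mem_filter.2 ⟨hB1, ?_⟩, hB2⟩, ?_⟩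
    · refine (hb B hB1).resolve_right fun h => ?_
      exact Finset.disjoint_left.1 hST hi (h hB2)
    · rintro C ⟨hC1, hC2⟩
      exact hB3 C ⟨(Finset.mem_filter.1 hC1).1, hC2⟩
  · rintro ⟨B, C, i, j, k, l, hB, hC, h⟩
    exact hP3 ⟨B, C, i, j, k, l, (Finset.mem_filter.1 hB).1, (Finset.mem_filter.1 hC).1, h⟩

/-- The non-crossing partitions of `S ∪ T` having a block disjoint from `S` that contains `R ⊆ T`,
when `R` separates `S` from `T \ R`. -/
theorem sum_ncPart_union (W : Finset (Fin q) → ℂ) {S T R : Finset (Fin q)} (hR : R.Nonempty)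
    (hsep : ∀ e ∈ T, (∀ x ∈ S, e < x) ∨ (∀ x ∈ S, x < e))
    (hcross : ∀ e ∈ S, ∀ f ∈ T, f ∉ R → ∃ r ∈ R, ∃ r' ∈ R,
      (r < e ∧ e < r' ∧ r' < f) ∨ (e < r ∧ r < f ∧ f < r')) :
    (∑ P ∈ (ncPart q (S ∪ T)).filter (fun P => ∃ B ∈ P, R ⊆ B ∧ Disjoint B S), ∏ B ∈ P, W B) =
      ncSum W S * ∑ P ∈ (ncPart q T).filter (fun P => ∃ B ∈ P, R ⊆ B), ∏ B ∈ P, W B := by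
  have hST : Disjoint S T := Finset.disjoint_left.2 fun x hS hT => by
    rcases hsep x hT with h | h <;> exact lt_irrefl _ (h x hS)
  have hblocks : ∀ P ∈ ncPart q (S ∪ T), (∃ B ∈ P, R ⊆ B ∧ Disjoint B S) →
      ∀ C ∈ P, C ⊆ S ∨ C ⊆ T := by
    rintro P hP ⟨B, hB, hRB, hBS⟩ C hC
    rw [mem_ncPart] at hP
    by_contra! hcon
    obtain ⟨h1, h2⟩ := hcon
    obtain ⟨f, hfC, hfS⟩ := Finset.not_subset.1 h1
    obtain ⟨e, heC, heT⟩ := Finset.not_subset.1 h2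
    have hfT : f ∈ T := (Finset.mem_union.1 ((hP.1.1 C hC).2 hfC)).resolve_left hfS
    have heS : e ∈ S := (Finset.mem_union.1 ((hP.1.1 C hC).2 heC)).resolve_right heT
    have hBC : B ≠ C := by
      rintro rfl
      exact Finset.disjoint_left.1 hBS heC heS
    have hfR : f ∉ R := fun h => hBC (hP.1.eq_of_mem hB hC (hRB h) hfC)
    obtain ⟨r, hr, r', hr', h | h⟩ := hcross e heS f hfT hfR
    · exact hP.2 ⟨B, C, r, e, r', f, hB, hC, hBC, h.1, h.2.1, h.2.2, hRB hr, hRB hr', heC, hfC⟩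
    · exact hP.2 ⟨C, B, e, r, f, r', hC, hB, hBC.symm, h.1, h.2.1, h.2.2, heC, hfC, hRB hr,
        hRB hr'⟩
  rw [ncSum, Finset.sum_mul_sum, ← Finset.sum_product']
  refine Finset.sum_nbij' (fun P => (P.filter (· ⊆ S), P.filter (· ⊆ T))) (fun P => P.1 ∪ P.2)
    ?_ ?_ ?_ ?_ ?_
  · intro P hP
    obtain ⟨hP, B, hB, hRB, hBS⟩ := Finset.mem_filter.1 hP
    have hb := hblocks P hP ⟨B, hB, hRB, hBS⟩
    refine Finset.mem_product.2 ⟨filter_mem_ncPart hST hP hb, Finset.mem_filter.2 ⟨?_, ?_⟩⟩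
    · exact filter_mem_ncPart hST.symm (by rwa [Finset.union_comm]) fun C hC => (hb C hC).symm
    · refine ⟨B, Finset.mem_filter.2 ⟨hB, (hb B hB).resolve_left fun h => ?_⟩, hRB⟩
      obtain ⟨r, hr⟩ := hR
      exact Finset.disjoint_left.1 hBS (hRB hr) (h (hRB hr))
  · rintro ⟨P, Q⟩ hPQ
    obtain ⟨hP, hQ⟩ := Finset.mem_product.1 hPQ
    obtain ⟨hQ, B, hB, hRB⟩ := Finset.mem_filter.1 hQ
    refine Finset.mem_filter.2 ⟨union_mem_ncPart hsep hP hQ, B,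
      Finset.mem_union_right _ hB, hRB, ?_⟩
    exact hST.symm.mono_left ((mem_ncPart.1 hQ).1.1 B hB).2
  · intro P hP
    obtain ⟨hP, hex⟩ := Finset.mem_filter.1 hP
    have hb := hblocks P hP hex
    ext C
    simp only [Finset.mem_union, Finset.mem_filter]
    exact ⟨fun h => h.elim And.left And.left,
      fun h => (hb C h).imp (fun h' => ⟨h, h'⟩) fun h' => ⟨h, h'⟩⟩
  · rintro ⟨P, Q⟩ hPQ
    obtain ⟨hP, hQ⟩ := Finset.mem_product.1 hPQ
    have hP1 := (mem_ncPart.1 hP).1.1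
    have hQ1 := (mem_ncPart.1 (Finset.mem_filter.1 hQ).1).1.1
    have hcontra : ∀ C : Finset (Fin q), C.Nonempty → C ⊆ S → ¬ C ⊆ T := by
      rintro C ⟨x, hx⟩ h1 h2
      exact Finset.disjoint_left.1 hST (h1 hx) (h2 hx)
    refine Prod.ext ?_ ?_
    · ext C
      simp only [Finset.mem_filter, Finset.mem_union]
      constructor
      · rintro ⟨h | h, hC⟩
        · exact h
        · exact absurd (hQ1 C h).2 (hcontra C (hQ1 C h).1 hC)
      · exact fun h => ⟨Or.inl h, (hP1 C h).2⟩
    · ext C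
      simp only [Finset.mem_filter, Finset.mem_union]
      constructor
      · rintro ⟨h | h, hC⟩
        · exact absurd hC (hcontra C (hP1 C h).1 (hP1 C h).2)
        · exact h
      · exact fun h => ⟨Or.inr h, (hQ1 C h).2⟩
  · intro P hP
    obtain ⟨hP, hex⟩ := Finset.mem_filter.1 hP
    have hb := hblocks P hP hex
    have hP1 := (mem_ncPart.1 hP).1.1
    rw [← Finset.prod_union]
    · refine Finset.prod_congr ?_ fun _ _ => rfl
      ext C
      simp only [Finset.mem_union, Finset.mem_filter]
      exact ⟨fun h => (hb C h).imp (fun h' => ⟨h, h'⟩) fun h' => ⟨h, h'⟩,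
        fun h => h.elim And.left And.left⟩
    · refine Finset.disjoint_left.2 fun C h1 h2 => ?_
      rw [Finset.mem_filter] at h1 h2
      obtain ⟨x, hx⟩ := (hP1 C h1.1).1
      exact Finset.disjoint_left.1 hST (h1.2 hx) (h2.2 hx)

theorem sum_ncPart_self (W : Finset (Fin q) → ℂ) {R : Finset (Fin q)} (hR : R.Nonempty) :
    (∑ P ∈ (ncPart q R).filter (fun P => ∃ B ∈ P, R ⊆ B), ∏ B ∈ P, W B) = W R := by
  have : (ncPart q R).filter (fun P => ∃ B ∈ P, R ⊆ B) = {{R}} := by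
    ext P
    rw [Finset.mem_filter, mem_ncPart, Finset.mem_singleton]
    constructor
    · rintro ⟨⟨h, -⟩, B, hB, hRB⟩
      have hBR : B = R := (h.1 B hB).2.antisymm hRB
      subst hBR
      ext C
      rw [Finset.mem_singleton]
      constructor
      · intro hC
        obtain ⟨x, hx⟩ := (h.1 C hC).1
        exact h.eq_of_mem hC hB hx ((h.1 C hC).2 hx)
      · rintro rfl
        exact hB
    · rintro rfl
      refine ⟨⟨⟨by simp [hR], fun i hi => ⟨R, by simp [hi], by simp +contextual⟩⟩, ?_⟩, R, by simp⟩
      rintro ⟨B, C, i, j, k, l, hB, hC, hne, -⟩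
      simp at hB hC
      exact hne (hB.trans hC.symm)
  rw [this]
  simp

theorem sum_ncPart_eq_gapSum (W : Finset (Fin q) → ℂ) (g w : List (Fin q)) (R : Finset (Fin q))
    (hR : R.Nonempty) (hsort : (g ++ w).Pairwise (· < ·))
    (hsep : ∀ r ∈ R, (∀ x ∈ g ++ w, r < x) ∨ (∀ x ∈ g ++ w, x < r)) :
    (∑ P ∈ (ncPart q (R ∪ (g ++ w).toFinset)).filter
        (fun P => ∃ B ∈ P, R ⊆ B ∧ Disjoint B g.toFinset), ∏ B ∈ P, W B) =
      gapSum (fun v => ncSum W v.toFinset) g w (fun s => W (R ∪ s.toFinset)) := by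
  induction w generalizing g R with
  | nil =>
    rw [List.append_nil, Finset.union_comm, sum_ncPart_union W hR, sum_ncPart_self W hR]
    · simp [gapSum]
    · simpa using hsep
    · exact fun e _ f hf hf' => absurd hf hf'
  | cons b w ih =>
    simp only [gapSum]
    have e1 : (g ++ [b]) ++ w = g ++ b :: w := by simp
    have hgw := List.pairwise_append.1 hsort
    have hbw := List.pairwise_cons.1 hgw.2.1
    have hbR : b ∉ R := fun h => by
      rcases hsep b h with h' | h' <;> exact lt_irrefl _ (h' b (by simp))
    rw [← ih (g ++ [b]) R hR (by rwa [e1]) (by rwa [e1])]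
    have e2 : R ∪ (g ++ b :: w).toFinset = g.toFinset ∪ (insert b R ∪ w.toFinset) := by
      ext x
      simp
      tauto
    have e3 : ∀ s : List (Fin q), R ∪ (b :: s).toFinset = insert b R ∪ s.toFinset := by
      intro s
      ext x
      simp
    have h2 := sum_ncPart_union W (S := g.toFinset) (T := insert b R ∪ w.toFinset)
      (R := insert b R) (Finset.insert_nonempty _ _) ?_ ?_
    · have h3 := ih [] (insert b R) (Finset.insert_nonempty _ _) (by simpa using hbw.2) ?_
      · simp only [List.nil_append, List.toFinset_nil, Finset.disjoint_empty_right, and_true] at h3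
        simp only [e3]
        rw [← h3, ← h2, e1, ← e2, ← Finset.sum_union]
        · refine Finset.sum_congr ?_ fun _ _ => rfl
          ext P
          simp only [Finset.mem_union, Finset.mem_filter]
          rw [← and_or_left]
          refine and_congr_right fun hP => ?_
          constructor
          · rintro ⟨B, hB, hRB, hBg⟩
            by_cases hb : b ∈ B
            · exact Or.inr ⟨B, hB, Finset.insert_subset hb hRB, hBg⟩
            · refine Or.inl ⟨B, hB, hRB, ?_⟩
              simp [List.toFinset_append, hBg, hb]
          · rintro (⟨B, hB, hRB, hBg⟩ | ⟨B, hB, hRB, hBg⟩)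
            · rw [List.toFinset_append, Finset.disjoint_union_right] at hBg
              exact ⟨B, hB, hRB, hBg.1⟩
            · exact ⟨B, hB, (Finset.subset_insert _ _).trans hRB, hBg⟩
        · refine Finset.disjoint_left.2 fun P h4 h5 => ?_
          obtain ⟨hP, B, hB, hRB, hBg⟩ := Finset.mem_filter.1 h4
          obtain ⟨-, C, hC, hRC, hCg⟩ := Finset.mem_filter.1 h5
          obtain ⟨r, hr⟩ := hR
          have hBC := (mem_ncPart.1 hP).1.eq_of_mem hB hC (hRB hr)
            (hRC (Finset.mem_insert_of_mem hr))
          subst hBC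
          refine Finset.disjoint_left.1 hBg (hRC (Finset.mem_insert_self _ _)) ?_
          simp
      · intro r hr
        rcases Finset.mem_insert.1 hr with rfl | hr
        · exact Or.inl (by simpa using hbw.1)
        · exact (hsep r hr).imp (fun h x hx => h x (by simp at hx; simp [hx]))
            fun h x hx => h x (by simp at hx; simp [hx])
    · intro e he
      simp only [Finset.mem_union, Finset.mem_insert, List.mem_toFinset] at he
      simp only [List.mem_toFinset]
      rcases he with (rfl | he) | he
      · exact Or.inr fun x hx => hgw.2.2 x hx e (by simp)
      · exact (hsep e he).imp (fun h x hx => h x (by simp [hx])) fun h x hx => h x (by simp [hx])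
      · exact Or.inr fun x hx => hgw.2.2 x hx e (by simp [he])
    · intro e he f hf hfR
      rw [List.mem_toFinset] at he
      have hfw : f ∈ w := by simpa using (Finset.mem_union.1 hf).resolve_left hfR
      have heb : e < b := hgw.2.2 e he b (by simp)
      have hbf : b < f := hbw.1 f hfw
      obtain ⟨r, hr⟩ := hR
      rcases hsep r hr with h | h
      · exact ⟨r, Finset.mem_insert_of_mem hr, b, Finset.mem_insert_self _ _,
          Or.inl ⟨h e (by simp [he]), heb, hbf⟩⟩
      · exact ⟨b, Finset.mem_insert_self _ _, r, Finset.mem_insert_of_mem hr,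
          Or.inr ⟨heb, hbf, h f (by simp [hfw])⟩⟩

theorem ncSum_insert (W : Finset (Fin q) → ℂ) (a : Fin q) (w : List (Fin q))
    (hsort : w.Pairwise (· < ·)) (hsep : (∀ x ∈ w, a < x) ∨ (∀ x ∈ w, x < a)) :
    ncSum W (insert a w.toFinset) =
      gapSum (fun v => ncSum W v.toFinset) [] w (fun s => W (insert a s.toFinset)) := by
  have := sum_ncPart_eq_gapSum W [] w {a} (by simp) (by simpa using hsort) (by simpa using hsep)
  simp only [List.nil_append, ← Finset.insert_eq] at this
  rw [← this, ncSum, Finset.filter_true_of_mem]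
  intro P hP
  obtain ⟨B, hB, -⟩ := (mem_ncPart.1 hP).1.2 a (by simp)
  exact ⟨B, hB.1, by simpa using hB.2, by simp⟩

theorem ncSum_eq_freeMoment (κ : List (Fin q) → ℂ) (w : List (Fin q))
    (hw : w.Pairwise (· < ·)) :
    ncSum (fun B => κ (B.sort (· ≤ ·))) w.toFinset = freeMoment κ w := by
  induction hl : w.length using Nat.strong_induction_on generalizing w with
  | _ k ih =>
    cases w with
    | nil => simp [ncSum_empty, freeMoment_nil]
    | cons a w =>
      have hw' := List.pairwise_cons.1 hw
      rw [List.toFinset_cons, ncSum_insert _ _ _ hw'.2 (Or.inl hw'.1), freeMoment_cons]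
      refine gapSum_congr (fun v hv => ?_) fun s hs => ?_
      · have := hv.length_le
        simp at this hl hv
        exact ih _ (by omega) v (hw'.2.sublist hv) rfl
      · have hs' : (a :: s).Pairwise (· < ·) := hw.sublist (hs.cons_cons a)
        rw [← List.toFinset_cons, (List.toFinset_sort (· ≤ ·) (hs'.imp ne_of_lt)).2
          (hs'.imp le_of_lt)]

/-- The moments computed from the block of the last letter. -/
theorem freeMoment_concat {L : Type} (κ : List L → ℂ) (w : List L) (a : L) :
    freeMoment κ (w ++ [a]) = gapSum (freeMoment κ) [] w (fun s => κ (s ++ [a])) := by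
  obtain ⟨q, e, v, z, hv, hz, hs⟩ : ∃ (q : ℕ) (e : Fin q → L) (v : List (Fin q)) (z : Fin q),
      v.map e = w ∧ e z = a ∧ (v ++ [z]).Pairwise (· < ·) := by
    refine ⟨w.length + 1, fun i => (w ++ [a]).get (i.cast (by simp)),
      (List.finRange w.length).map Fin.castSucc, Fin.last _, ?_, by simp, ?_⟩
    · refine List.ext_get (by simp) fun m h1 h2 => ?_
      simp [List.getElem_append_left h2]
    · rw [← List.finRange_succ_last]
      exact List.pairwise_lt_finRange _
  subst hv hz
  have hs' := List.pairwise_append.1 hs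
  have hlt : ∀ x ∈ v, x < z := fun x hx => hs'.2.2 x hx z (by simp)
  rw [← List.map_singleton, ← List.map_append, ← freeMoment_map, ← ncSum_eq_freeMoment _ _ hs]
  have : (v ++ [z]).toFinset = insert z v.toFinset := by
    ext; simp
  rw [this, ncSum_insert _ _ _ hs'.1 (Or.inr hlt), ← List.map_nil (f := e),
    ← gapSum_map e _ _ _ (fun s => κ (s ++ List.map e [z]))]
  refine gapSum_congr (fun u hu => ?_) fun s hs0 => ?_
  · rw [← freeMoment_map]
    exact ncSum_eq_freeMoment (fun l => κ (l.map e)) _ (hs'.1.sublist (by simpa using hu))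
  · have hp : (s ++ [z]).Pairwise (· < ·) := hs.sublist (hs0.append_right [z])
    have : insert z s.toFinset = (s ++ [z]).toFinset := by
      ext; simp
    rw [this, (List.toFinset_sort (· ≤ ·) (hp.imp ne_of_lt)).2 (hp.imp le_of_lt), List.map_append]

theorem freeMoment_rotate {L : Type} {κ : List L → ℂ} (hκ : ∀ a w, κ (a :: w) = κ (w ++ [a]))
    (a : L) (w : List L) : freeMoment κ (a :: w) = freeMoment κ (w ++ [a]) := by
  simp only [freeMoment_cons, freeMoment_concat, hκ]

theorem map_prod_eq_freeMoment {A : Type} [Ring A] [Algebra ℂ A] {φ : A →ₗ[ℂ] ℂ} (h1 : φ 1 = 1)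
    {κ : List A → ℂ} (hκ : IsCumulantFamily φ κ) (w : List A) :
    φ w.prod = freeMoment κ w := by
  rcases w.eq_nil_or_concat with rfl | ⟨w, b, rfl⟩
  · simp [h1, freeMoment_nil]
  · generalize hv : w.concat b = v
    have hpos : 0 < v.length := by simp [← hv]
    have := hκ.2 v.length hpos v.get
    rw [List.ofFn_get] at this
    rw [this]
    have e : (Finset.univ : Finset (Fin v.length)) = (List.finRange v.length).toFinset := by
      ext; simp
    rw [e]
    refine (ncSum_eq_freeMoment (fun s => κ (s.map v.get)) _
      (List.pairwise_lt_finRange _)).trans ?_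
    rw [freeMoment_map, List.map_get_finRange]

end Partitions

end FreeHaar

namespace FreeHaar

section FreeProduct

variable {A B : Type} [Ring A] [Algebra ℂ A] [StarRing A] [Ring B] [Algebra ℂ B] [StarRing B]
  {F : FreeProd A B}

section Formulas

variable {φ : A →ₗ[ℂ] ℂ} {ψ : B →ₗ[ℂ] ℂ} {Ψ : F.carrier →ₗ[ℂ] ℂ}

theorem freeProd_centered (hΨ : F.IsFreeProdFunctional φ ψ Ψ) (l : List (A ⊕ B)) (hl : l ≠ [])
    (hc : l.IsChain (fun x y => x.isLeft ≠ y.isLeft))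
    (h0 : ∀ x ∈ l, Sum.elim (fun a => φ a = 0) (fun b => ψ b = 0) x) :
    Ψ ((l.map F.embed).prod) = 0 :=
  hΨ.2.2.2 l hl hc h0

/-- Centered alternating products that begin and end in the left leg stay null when they are
multiplied by arbitrary elements of the right leg. -/
theorem freeProd_sandwich_eq_zero (hψ : ψ 1 = 1) (hΨ : F.IsFreeProdFunctional φ ψ Ψ)
    (l : List (A ⊕ B)) (hl : l ≠ [])
    (hc : l.IsChain (fun x y => x.isLeft ≠ y.isLeft))
    (h0 : ∀ x ∈ l, Sum.elim (fun a => φ a = 0) (fun b => ψ b = 0) x)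
    (hhead : ∀ x ∈ l.head?, x.isLeft) (hlast : ∀ x ∈ l.getLast?, x.isLeft) (b b' : B) :
    Ψ (F.inr b * (l.map F.embed).prod * F.inr b') = 0 := by
  have hd : ∀ d : B, ∃ d₀ : B, ψ d₀ = 0 ∧ F.inr d = F.inr d₀ + (ψ d) • 1 := fun d =>
    ⟨d - ψ d • 1, by simp [hψ], by simp [map_sub]⟩
  obtain ⟨b₀, hb, eb⟩ := hd b
  obtain ⟨b₀', hb', eb'⟩ := hd b'
  have h1 : Ψ ((l.map F.embed).prod) = 0 := freeProd_centered hΨ l hl hc h0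
  have hcl : (Sum.inr b₀ :: l).IsChain (fun x y => x.isLeft ≠ y.isLeft) := by
    refine List.isChain_cons.2 ⟨fun y hy => ?_, hc⟩
    simp [hhead y hy]
  have h2 := freeProd_centered hΨ (Sum.inr b₀ :: l) (by simp) hcl (by simpa [hb] using h0)
  have h3 := freeProd_centered hΨ (l ++ [Sum.inr b₀']) (by simp)
    (List.isChain_append.2 ⟨hc, by simp, fun x hx y hy => by
      simp at hy; subst hy; simp [hlast x hx]⟩) (by
      intro x hx
      rcases List.mem_append.1 hx with hx | hx
      · exact h0 x hx
      · simp at hx; subst hx; exact hb')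
  have h4 := freeProd_centered hΨ ((Sum.inr b₀ :: l) ++ [Sum.inr b₀']) (by simp)
    (List.isChain_append.2 ⟨hcl, by simp, fun x hx y hy => by
      simp at hy; subst hy
      rw [List.getLast?_cons_of_ne_nil hl] at hx
      simp [hlast x hx]⟩) (by
      intro x hx
      rcases List.mem_append.1 hx with hx | hx
      · rcases List.mem_cons.1 hx with rfl | hx
        · exact hb
        · exact h0 x hx
      · simp at hx; subst hx; exact hb')
  simp only [List.map_append, List.map_cons, List.map_nil, List.prod_append, List.prod_cons,
    List.prod_nil, mul_one, FreeProd.embed, Sum.elim_inr] at h1 h2 h3 h4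
  simp only [FreeProd.embed]
  rw [eb, eb']
  simp only [add_mul, mul_add, smul_mul_assoc, mul_smul_comm, one_mul, mul_one, map_add, map_smul]
  simp only [h1, h2, h3, h4, smul_zero, add_zero]

theorem freeProd_inr_inl_inr (hφ : φ 1 = 1) (hψ : ψ 1 = 1) (hΨ : F.IsFreeProdFunctional φ ψ Ψ)
    (x : A) (b b' : B) : Ψ (F.inr b * F.inl x * F.inr b') = φ x * ψ (b * b') := by
  have ex : F.inl x = F.inl (x - φ x • 1) + φ x • 1 := by simp [map_sub]
  have h0 := freeProd_sandwich_eq_zero hψ hΨ [Sum.inl (x - φ x • 1)] (by simp) (by simp)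
    (by simp [hφ]) (by simp) (by simp) b b'
  simp only [List.map_cons, List.map_nil, List.prod_singleton, FreeProd.embed, Sum.elim_inl] at h0
  rw [ex, mul_add, add_mul, map_add, h0, zero_add, mul_smul_comm, mul_one, smul_mul_assoc,
    map_smul, ← map_mul, hΨ.2.2.1, smul_eq_mul]

theorem freeProd_two_left (hφ : φ 1 = 1) (hψ : ψ 1 = 1) (hΨ : F.IsFreeProdFunctional φ ψ Ψ)
    {x y : A} (hx : φ x = 0) (hy : φ y = 0) (b b' b'' : B) :
    Ψ (F.inr b * F.inl x * F.inr b' * F.inl y * F.inr b'') =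
      φ (x * y) * (ψ b' * ψ (b * b'')) := by
  have eb : F.inr b' = F.inr (b' - ψ b' • 1) + ψ b' • 1 := by simp [map_sub]
  have h0 := freeProd_sandwich_eq_zero hψ hΨ [Sum.inl x, Sum.inr (b' - ψ b' • 1), Sum.inl y]
    (by simp) (by simp) (by simp [hψ, hx, hy]) (by simp) (by simp) b b''
  simp only [List.map_cons, List.map_nil, List.prod_cons, List.prod_nil, mul_one,
    FreeProd.embed, Sum.elim_inl, Sum.elim_inr, ← mul_assoc] at h0
  have h1 := freeProd_inr_inl_inr hφ hψ hΨ (x * y) b b''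
  rw [map_mul F.inl, ← mul_assoc] at h1
  rw [eb]
  simp only [mul_add, add_mul, map_add, h0, zero_add, mul_smul_comm, mul_one, smul_mul_assoc,
    map_smul, h1, smul_eq_mul]
  ring

end Formulas

section Degree

variable {Θ M : Type} [Ring M] [Algebra ℂ M]

/-- A factor of a product in the free product depending on a parameter: a family in the left leg
together with a degree, or a constant in the right leg. -/
abbrev Item (Θ A B : Type) : Type := ((Θ → A) × ℕ) ⊕ B

/-- The degree of a factor. -/
def Item.deg : Item Θ A B → ℕ := Sum.elim Prod.snd fun _ => 0

/-- The element of one of the legs given by a factor. -/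
def Item.toSum (θ : Θ) : Item Θ A B → A ⊕ B := Sum.map (fun x => x.1 θ) id

/-- The element of the free product given by a factor. -/
def Item.val (F : FreeProd A B) (x : Item Θ A B) (θ : Θ) : F.carrier := F.embed (x.toSum θ)

/-- The left factors of degree `d` are mapped by `ρ θ` to multiples by `σ θ ^ d` of a constant. -/
def Item.Homogeneous (ρ : Θ → A →ₐ[ℂ] M) (σ : Θ → ℂ) : Item Θ A B → Prop :=
  Sum.elim (fun x => ∃ X : M, ∀ θ, ρ θ (x.1 θ) = σ θ ^ x.2 • X) fun _ => True

variable {ρ : Θ → A →ₐ[ℂ] M} {σ : Θ → ℂ} {τ : M →ₗ[ℂ] ℂ} {ψ : B →ₗ[ℂ] ℂ}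
  {Ψ : Θ → F.carrier →ₗ[ℂ] ℂ}

theorem Item.exists_merge {x y : Item Θ A B} (hx : x.Homogeneous ρ σ) (hy : y.Homogeneous ρ σ)
    (hxy : x.isLeft = y.isLeft) :
    ∃ z : Item Θ A B, z.Homogeneous ρ σ ∧ z.deg = x.deg + y.deg ∧
      ∀ θ, z.val F θ = x.val F θ * y.val F θ := by
  rcases x with ⟨x, d⟩ | b <;> rcases y with ⟨y, e⟩ | b' <;> simp at hxy
  · obtain ⟨X, hX⟩ := hx
    obtain ⟨Y, hY⟩ := hy
    refine ⟨Sum.inl (fun θ => x θ * y θ, d + e), ⟨X * Y, fun θ => ?_⟩, rfl, fun θ => ?_⟩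
    · simp only at hX hY ⊢
      rw [map_mul, hX, hY, smul_mul_smul_comm, pow_add]
    · exact map_mul _ _ _
  · exact ⟨Sum.inr (b * b'), trivial, rfl, fun θ => map_mul _ _ _⟩

theorem Item.exists_center (hτ : τ 1 = 1) (hψ : ψ 1 = 1) {x : Item Θ A B}
    (hx : x.Homogeneous ρ σ) :
    ∃ (z : Item Θ A B) (r : ℂ), z.Homogeneous ρ σ ∧ z.deg = x.deg ∧
      (∀ θ, Sum.elim (fun a => τ (ρ θ a) = 0) (fun b => ψ b = 0) (z.toSum θ)) ∧
      ∀ θ, x.val F θ = z.val F θ + (σ θ ^ x.deg * r) • 1 := by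
  rcases x with ⟨x, d⟩ | b
  · obtain ⟨X, hX⟩ := hx
    simp only at hX
    refine ⟨Sum.inl (fun θ => x θ - (σ θ ^ d * τ X) • 1, d), τ X, ⟨X - τ X • 1, fun θ => ?_⟩, rfl,
      fun θ => ?_, fun θ => ?_⟩
    · simp [hX, smul_sub, mul_smul]
    · simp [Item.toSum, hX, hτ]
    · simp [Item.val, Item.toSum, Item.deg, FreeProd.embed]
  · refine ⟨Sum.inr (b - ψ b • 1), ψ b, trivial, rfl, fun θ => ?_, fun θ => ?_⟩
    · simp [Item.toSum, hψ]
    · simp [Item.val, Item.toSum, Item.deg, FreeProd.embed]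

/-- The product of a list of factors. -/
def itemProd (F : FreeProd A B) (l : List (Item Θ A B)) (θ : Θ) : F.carrier :=
  (l.map fun x => x.val F θ).prod

theorem itemProd_append (l l' : List (Item Θ A B)) (θ : Θ) :
    itemProd F (l ++ l') θ = itemProd F l θ * itemProd F l' θ := by
  simp [itemProd]

theorem itemProd_cons (x : Item Θ A B) (l : List (Item Θ A B)) (θ : Θ) :
    itemProd F (x :: l) θ = x.val F θ * itemProd F l θ := by
  simp [itemProd]

theorem exists_freeProd_eq_pow_mul (hτ : τ 1 = 1) (hψ : ψ 1 = 1)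
    (hΨ : ∀ θ, F.IsFreeProdFunctional (τ ∘ₗ (ρ θ).toLinearMap) ψ (Ψ θ))
    (l : List (Item Θ A B)) (hl : ∀ x ∈ l, x.Homogeneous ρ σ) :
    ∃ C : ℂ, ∀ θ, Ψ θ (itemProd F l θ) = σ θ ^ (l.map Item.deg).sum * C := by
  induction hN : l.length using Nat.strong_induction_on generalizing l with
  | _ N IH =>
  suffices H : ∀ (l₂ l₁ : List (Item Θ A B)), (l₁.reverse ++ l₂).length = N →
      (∀ x ∈ l₁.reverse ++ l₂, x.Homogeneous ρ σ) →
      (∀ x ∈ l₁, ∀ θ, Sum.elim (fun a => τ (ρ θ a) = 0) (fun b => ψ b = 0) (x.toSum θ)) →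
      l₁.IsChain (fun x y => x.isLeft ≠ y.isLeft) →
      ∃ C : ℂ, ∀ θ, Ψ θ (itemProd F (l₁.reverse ++ l₂) θ) =
        σ θ ^ ((l₁.reverse ++ l₂).map Item.deg).sum * C by
    exact H l [] (by simpa) (by simpa using hl) (by simp) (by simp)
  intro l₂
  induction l₂ with
  | nil =>
    intro l₁ hlen hhom hcent hchain
    rcases eq_or_ne l₁ [] with rfl | hne
    · exact ⟨1, fun θ => by simpa [itemProd] using (hΨ θ).1⟩
    · refine ⟨0, fun θ => ?_⟩
      have := freeProd_centered (hΨ θ) ((l₁.reverse).map (Item.toSum θ)) (by simpa) ?_ ?_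
      · rw [mul_zero, ← this, itemProd, List.map_map, List.append_nil]
        rfl
      · rw [List.isChain_map, List.isChain_reverse]
        refine hchain.imp fun x y h => ?_
        rcases x with x | x <;> rcases y with y | y <;> simp_all [Item.toSum]
      · intro x hx
        simp only [List.mem_map, List.mem_reverse] at hx
        obtain ⟨y, hy, rfl⟩ := hx
        exact hcent y hy θ
  | cons x l₂ ih =>
    intro l₁ hlen hhom hcent hchain
    simp only [List.length_append, List.length_reverse, List.length_cons] at hlen
    obtain ⟨z, r, hz, hzd, hzc, hzv⟩ := Item.exists_center (F := F) hτ hψ (hhom x (by simp))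
    obtain ⟨C₁, hC₁⟩ := IH (l₁.reverse ++ l₂).length (by simp; omega) (l₁.reverse ++ l₂)
      (fun y hy => hhom y (by simp at hy ⊢; tauto)) rfl
    obtain ⟨C₂, hC₂⟩ : ∃ C : ℂ, ∀ θ, Ψ θ (itemProd F (l₁.reverse ++ z :: l₂) θ) =
        σ θ ^ ((l₁.reverse ++ z :: l₂).map Item.deg).sum * C := by
      have key : (z :: l₁).IsChain (fun x y => x.isLeft ≠ y.isLeft) →
          ∃ C : ℂ, ∀ θ, Ψ θ (itemProd F (l₁.reverse ++ z :: l₂) θ) =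
            σ θ ^ ((l₁.reverse ++ z :: l₂).map Item.deg).sum * C := by
        intro hch
        have := ih (z :: l₁) (by simp; omega) ?_ ?_ hch
        · simpa using this
        · intro y hy
          simp only [List.reverse_cons, List.append_assoc, List.singleton_append, List.mem_append,
            List.mem_cons, List.mem_reverse] at hy
          rcases hy with hy | rfl | hy
          · exact hhom y (by simp [hy])
          · exact hz
          · exact hhom y (by simp [hy])
        · intro y hy
          rcases List.mem_cons.1 hy with rfl | hy
          · exact hzc
          · exact hcent y hy
      rcases l₁ with _ | ⟨y, l₁⟩
      · exact key (by simp)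
      · by_cases hyz : y.isLeft = z.isLeft
        · obtain ⟨m, hm, hmd, hmv⟩ := Item.exists_merge (F := F) (hhom y (by simp)) hz hyz
          obtain ⟨C, hC⟩ := IH (l₁.reverse ++ m :: l₂).length (by simp at hlen ⊢; omega)
            (l₁.reverse ++ m :: l₂) (fun w hw => by
              simp only [List.mem_append, List.mem_cons, List.mem_reverse] at hw
              rcases hw with hw | rfl | hw
              · exact hhom w (by simp [hw])
              · exact hm
              · exact hhom w (by simp [hw])) rfl
          refine ⟨C, fun θ => ?_⟩
          have := hC θ
          simpa [itemProd, hmv, hmd, mul_assoc, add_assoc] using this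
        · exact key (List.isChain_cons_cons.2 ⟨fun h => hyz h.symm, hchain⟩)
    refine ⟨C₂ + r * C₁, fun θ => ?_⟩
    have e : itemProd F (l₁.reverse ++ x :: l₂) θ = itemProd F (l₁.reverse ++ z :: l₂) θ +
        (σ θ ^ x.deg * r) • itemProd F (l₁.reverse ++ l₂) θ := by
      simp only [itemProd_append, itemProd_cons, hzv, add_mul, mul_add, smul_mul_assoc, one_mul,
        mul_smul_comm]
    rw [e, map_add, map_smul, hC₁, hC₂]
    simp only [List.map_append, List.map_cons, List.sum_append, List.sum_cons, hzd, smul_eq_mul,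
      pow_add]
    ring

end Degree

end FreeProduct

end FreeHaar

namespace FreeHaar

section TestStates

variable {n : ℕ}

/-- The generator of the Brown algebra named by a letter. -/
def ev (U : BrownAlg n) (a : Letter n) : U.carrier :=
  bif a.1 then star (U.u a.2.2 a.2.1) else U.u a.2.1 a.2.2

theorem sum_ev_mul_ev (U : BrownAlg n) (ε : Bool) (p s : Fin n) :
    ∑ k, ev U (ε, p, k) * ev U (!ε, k, s) = if p = s then 1 else 0 := by
  cases ε
  · simpa [ev] using U.rel_right p s
  · simpa [ev] using U.rel_left p s

/-- The target of the test representations of the Brown algebra. -/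
abbrev TestAlg (n : ℕ) : Type := Matrix (Fin n) (Fin n) ℂ × Matrix (Fin n) (Fin n) ℂ

theorem sum_single_mul_single (i j : Fin n) :
    ∑ k, Matrix.single k i (1 : ℂ) * Matrix.single j k 1 = if i = j then 1 else 0 := by
  split_ifs with h
  · subst h
    simp only [Matrix.single_mul_single_same, mul_one]
    ext p s
    simp [Matrix.sum_apply, Matrix.single_apply, Matrix.one_apply, ite_and]
  · exact Finset.sum_eq_zero fun k _ => Matrix.single_mul_single_of_ne (h := h) ..

/-- A unitary matrix with entries in the algebra of matrices. -/
def rotation (c t : ℂ) (i j : Fin n) : Matrix (Fin n) (Fin n) ℂ :=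
  (if i = j then c else 0) • 1 + t • Matrix.single j i 1

theorem star_rotation {c t : ℂ} (hc : star c = c) (ht : star t = -t) (i j : Fin n) :
    star (rotation c t i j) = rotation c (-t) j i := by
  have hc' : star (if i = j then c else 0) = if j = i then c else 0 := by
    simp only [eq_comm (a := i)]
    split_ifs <;> simp [hc]
  rw [rotation, rotation, star_add, star_smul, star_smul, star_one, hc', ht,
    Matrix.star_eq_conjTranspose, Matrix.conjTranspose_single, star_one]

theorem sum_rotation_neg_mul_rotation {c t : ℂ} (h : c ^ 2 - t ^ 2 = 1) (i j : Fin n) :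
    (∑ k, rotation c (-t) i k * rotation c t k j) = if i = j then 1 else 0 := by
  have h2 : ∑ k : Fin n, (Matrix.single k i (1 : ℂ) * Matrix.single j k 1) = _ :=
    sum_single_mul_single i j
  simp only [rotation, add_mul, mul_add, one_mul, mul_one,
    Finset.sum_add_distrib, ite_mul, mul_ite, zero_mul, mul_zero, ite_smul, zero_smul,
    Finset.sum_ite_eq, Finset.mem_univ, if_true, ← Finset.smul_sum, h2, smul_mul_assoc,
    mul_smul_comm, Finset.sum_ite_eq']
  split_ifs with hij
  · trans (c ^ 2 - t ^ 2) • (1 : Matrix (Fin n) (Fin n) ℂ)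
    · module
    · rw [h, one_smul]
  · module

/-- The image of a centered generator under a test representation, up to a scalar. -/
def testGen (a : Letter n) : TestAlg n :=
  ((bif a.1 then -1 else 1) * Complex.I) •
    (Matrix.single a.2.2 a.2.1 1, -Matrix.single a.2.2 a.2.1 1)

theorem exists_testHom (U : BrownAlg n) (θ : ℝ) :
    ∃ ρ : U.carrier →⋆ₐ[ℂ] TestAlg n, ∀ a : Letter n,
      ρ (ev U a) = (if a.2.1 = a.2.2 then (Real.cos θ : ℂ) else 0) • 1 +
        (Real.sin θ : ℂ) • testGen a := by
  set c : ℂ := (Real.cos θ : ℂ) with hcdef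
  set t : ℂ := Complex.I * (Real.sin θ : ℂ) with htdef
  have hc : star c = c := by simp [hcdef, -Complex.ofReal_cos]
  have ht : star t = -t := by simp [htdef, -Complex.ofReal_sin]
  have h : c ^ 2 - t ^ 2 = 1 := by
    rw [hcdef, htdef, mul_pow, Complex.I_sq, neg_one_mul, sub_neg_eq_add]
    exact_mod_cast Real.cos_sq_add_sin_sq θ
  have ht' : star (-t) = - -t := by rw [star_neg, ht]
  have h' : c ^ 2 - (-t) ^ 2 = 1 := by rw [neg_sq, h]
  obtain ⟨ρ, hρ, -⟩ := U.universal (TestAlg n) (fun i j => (rotation c t i j, rotation c (-t) i j))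
    (fun i j => by
      have h1 := sum_rotation_neg_mul_rotation h i j
      have h2 := sum_rotation_neg_mul_rotation h' i j
      refine Prod.ext ?_ ?_
      · simp only [Prod.fst_sum, Prod.fst_mul, Prod.fst_star, star_rotation hc ht] at h1 ⊢
        rw [h1]
        split_ifs <;> rfl
      · simp only [Prod.snd_sum, Prod.snd_mul, Prod.snd_star, star_rotation hc ht', neg_neg] at h2 ⊢
        rw [h2]
        split_ifs <;> rfl)
    (fun i j => by
      have h1 := sum_rotation_neg_mul_rotation h' i j
      have h2 := sum_rotation_neg_mul_rotation h i j
      refine Prod.ext ?_ ?_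
      · simp only [Prod.fst_sum, Prod.fst_mul, Prod.fst_star, star_rotation hc ht, neg_neg] at h1 ⊢
        rw [h1]
        split_ifs <;> rfl
      · simp only [Prod.snd_sum, Prod.snd_mul, Prod.snd_star, star_rotation hc ht', neg_neg] at h2 ⊢
        rw [h2]
        split_ifs <;> rfl)
  refine ⟨ρ, ?_⟩
  rintro ⟨ε, p, s⟩
  cases ε
  · simp only [ev, cond_false, hρ, testGen, rotation]
    refine Prod.ext ?_ ?_
    · simp [htdef, mul_comm]
      split_ifs <;> simp
    · simp [htdef, mul_comm]
      split_ifs <;> simp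
  · simp only [ev, cond_true, map_star, hρ]
    refine Prod.ext ?_ ?_
    · simp only [Prod.fst_star, star_rotation hc ht]
      simp [htdef, mul_comm, testGen, rotation]
      split_ifs <;> simp
    · simp only [Prod.snd_star, star_rotation hc ht']
      simp [htdef, mul_comm, testGen, rotation]
      split_ifs <;> simp

/-- The normalized trace on the target of the test representations. -/
def testTrace (n : ℕ) : TestAlg n →ₗ[ℂ] ℂ :=
  (2 * (n : ℂ))⁻¹ • (Matrix.traceLinearMap (Fin n) ℂ ℂ ∘ₗ LinearMap.fst ℂ _ _ +
    Matrix.traceLinearMap (Fin n) ℂ ℂ ∘ₗ LinearMap.snd ℂ _ _)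

theorem testTrace_apply (x : TestAlg n) :
    testTrace n x = (2 * (n : ℂ))⁻¹ * (x.1.trace + x.2.trace) := by
  simp [testTrace, mul_add]

theorem isTracialState_testTrace (hn : 1 ≤ n) : IsTracialState (testTrace n) := by
  have hn0 : (n : ℂ) ≠ 0 := by exact_mod_cast (by omega : n ≠ 0)
  refine ⟨⟨?_, fun a => ?_⟩, fun a b => ?_⟩
  · simp only [testTrace_apply, Prod.fst_one, Prod.snd_one, Matrix.trace_one, Fintype.card_fin]
    field_simp
    norm_num
  · have key : ∀ X : Matrix (Fin n) (Fin n) ℂ, ∃ r : ℝ, 0 ≤ r ∧ (star X * X).trace = r := by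
      intro X
      refine ⟨∑ i, ∑ j, Complex.normSq (X j i), Finset.sum_nonneg fun i _ =>
        Finset.sum_nonneg fun j _ => Complex.normSq_nonneg _, ?_⟩
      simp [Matrix.trace, Matrix.mul_apply, Matrix.star_apply, Complex.normSq_eq_conj_mul_self]
    obtain ⟨r, hr, er⟩ := key a.1
    obtain ⟨r', hr', er'⟩ := key a.2
    have : testTrace n (star a * a) = (((2 * (n : ℝ))⁻¹ * (r + r') : ℝ) : ℂ) := by
      rw [testTrace_apply, Prod.fst_mul, Prod.snd_mul, Prod.fst_star, Prod.snd_star, er, er']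
      push_cast
      rfl
    rw [this]
    exact ⟨by rw [Complex.ofReal_re]; positivity, Complex.ofReal_im _⟩
  · rw [testTrace_apply, testTrace_apply, Prod.fst_mul, Prod.snd_mul, Prod.fst_mul, Prod.snd_mul,
      Matrix.trace_mul_comm a.1, Matrix.trace_mul_comm a.2]

theorem testTrace_testGen (a : Letter n) : testTrace n (testGen a) = 0 := by
  simp [testTrace_apply, testGen]

theorem testTrace_testGen_mul (hn : 1 ≤ n) (a b : Letter n) :
    testTrace n (testGen a * testGen b) =
      if a.2.1 = b.2.2 ∧ a.2.2 = b.2.1 then (if a.1 = b.1 then -1 else 1) * (n : ℂ)⁻¹ else 0 := by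
  have hn0 : (n : ℂ) ≠ 0 := by exact_mod_cast (by omega : n ≠ 0)
  obtain ⟨ε, p, s⟩ := a
  obtain ⟨ε', p', s'⟩ := b
  rw [testGen, testGen, smul_mul_smul_comm, map_smul, testTrace_apply]
  simp only [Prod.mk_mul_mk, neg_mul_neg]
  have e : (Matrix.single s p (1 : ℂ) * Matrix.single s' p' 1).trace =
      if p = s' ∧ s = p' then 1 else 0 := by
    by_cases h : p = s'
    · subst h
      rw [Matrix.single_mul_single_same]
      by_cases h' : s = p'
      · subst h'; simp
      · simp [h', Matrix.trace_single_eq_of_ne]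
    · rw [Matrix.single_mul_single_of_ne (h := h)]
      simp [h]
  rw [e]
  split_ifs with h1 h2
  · have h2' : ε = ε' := h2
    subst h2'
    cases ε <;> simp <;> ring_nf
  · cases ε <;> cases ε' <;> simp at h2 ⊢ <;> ring_nf
  · simp

end TestStates

end FreeHaar

namespace FreeHaar

section SchwingerDyson

open Asymptotics Filter Topology

theorem splitSum_isBigO {L E : Type} [NormedAddCommGroup E] {l : Filter ℝ} {g : ℝ → E} (w : List L)
    {f : ℝ → List L → L → List L → ℂ} (hf : ∀ x b y, (fun θ => f θ x b y) =O[l] g) :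
    (fun θ => splitSum w (f θ)) =O[l] g := by
  induction w generalizing f with
  | nil => simpa [splitSum] using isBigO_zero g l
  | cons a w ih => exact (hf [] a w).add (ih fun x b y => hf (a :: x) b y)

theorem prod_map_smul_add {L R : Type} [Ring R] [Algebra ℂ R] {c : ℂ} {g r d : L → R}
    (hg : ∀ a, g a = c • r a + d a) (w : List L) :
    (w.map g).prod = c ^ w.length • (w.map r).prod +
      splitSum w (fun x a v => c ^ x.length • ((x.map r).prod * d a * (v.map g).prod)) := by
  induction w with
  | nil => simp [splitSum]
  | cons a w ih =>
    have e : splitSum w (fun x b v => c ^ (a :: x).length •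
        (((a :: x).map r).prod * d b * (v.map g).prod)) =
        (c • r a) * splitSum w (fun x b v => c ^ x.length •
          ((x.map r).prod * d b * (v.map g).prod)) := by
      rw [mul_splitSum]
      refine splitSum_congr fun x b v _ => ?_
      simp only [List.map_cons, List.prod_cons, List.length_cons, pow_succ, mul_smul,
        smul_mul_assoc, mul_smul_comm, mul_assoc]
    rw [List.map_cons, List.prod_cons, hg, add_mul, splitSum, e]
    nth_rewrite 1 [ih]
    simp only [mul_add, List.map_nil, List.prod_nil, one_mul, List.length_nil, pow_zero, one_smul,
      List.length_cons, List.map_cons, List.prod_cons, smul_mul_assoc, mul_smul_comm, pow_succ,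
      mul_smul]
    abel

variable {n : ℕ}

/-- Test representations of the Brown algebra, together with the free products of the
corresponding states with a functional `h` which absorbs them. -/
structure TestFamily (U : BrownAlg n) (F : FreeProd U.carrier U.carrier)
    (Δ : U.carrier →⋆ₐ[ℂ] F.carrier) (h : U.carrier →ₗ[ℂ] ℂ) where
  /-- The test representations. -/
  ρ : ℝ → U.carrier →ₐ[ℂ] TestAlg n
  map_ev : ∀ θ a, ρ θ (ev U a) = (if a.2.1 = a.2.2 then (Real.cos θ : ℂ) else 0) • 1 +
    (Real.sin θ : ℂ) • testGen a
  /-- The free product functionals. -/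
  Ψ : ℝ → F.carrier →ₗ[ℂ] ℂ
  isFreeProd : ∀ θ, F.IsFreeProdFunctional (testTrace n ∘ₗ (ρ θ).toLinearMap) h (Ψ θ)
  absorb : ∀ θ a, Ψ θ (Δ a) = h a

theorem nonempty_testFamily (hn : 1 ≤ n) {U : BrownAlg n} {F : FreeProd U.carrier U.carrier}
    {Δ : U.carrier →⋆ₐ[ℂ] F.carrier} {h : U.carrier →ₗ[ℂ] ℂ}
    (hHaar : ∀ φ : U.carrier →ₗ[ℂ] ℂ, IsTracialState φ → U.FreeConv F Δ φ h h) :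
    Nonempty (TestFamily U F Δ h) := by
  choose ρ hρ using exists_testHom U
  obtain ⟨⟨h1, hpos⟩, htr⟩ := isTracialState_testTrace hn
  have hφ : ∀ θ, IsTracialState (testTrace n ∘ₗ (ρ θ : U.carrier →ₐ[ℂ] TestAlg n).toLinearMap) := by
    refine fun θ => ⟨⟨?_, fun a => ?_⟩, fun a b => ?_⟩
    · simpa using h1
    · have := hpos (ρ θ a)
      rw [← map_star, ← map_mul] at this
      exact this
    · simpa using htr (ρ θ a) (ρ θ b)
  choose Ψ hΨ using fun θ => hHaar _ (hφ θ)
  exact ⟨⟨fun θ => (ρ θ : U.carrier →ₐ[ℂ] TestAlg n), hρ, Ψ, fun θ => (hΨ θ).1,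
    fun θ => (hΨ θ).2⟩⟩

variable {U : BrownAlg n} {F : FreeProd U.carrier U.carrier} {Δ : U.carrier →⋆ₐ[ℂ] F.carrier}
  {h : U.carrier →ₗ[ℂ] ℂ}

/-- The element of the Brown algebra named by a word. -/
def evWord (U : BrownAlg n) (w : List (Letter n)) : U.carrier := (w.map (ev U)).prod

theorem evWord_append (x y : List (Letter n)) : evWord U (x ++ y) = evWord U x * evWord U y := by
  simp [evWord]

theorem evWord_cons (a : Letter n) (y : List (Letter n)) :
    evWord U (a :: y) = ev U a * evWord U y := by
  simp [evWord]

/-- The moment of a word. -/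
def wordMoment (U : BrownAlg n) (h : U.carrier →ₗ[ℂ] ℂ) (w : List (Letter n)) : ℂ :=
  h (evWord U w)

/-- A generator, centered for the test state. -/
def centeredEv (U : BrownAlg n) (a : Letter n) (θ : ℝ) : U.carrier :=
  ev U a - (if a.2.1 = a.2.2 then (Real.cos θ : ℂ) else 0) • 1

/-- The factors of the terms in `deviation`. -/
def deviationItems (U : BrownAlg n) (a : Letter n) (k : Fin n) :
    List (Item ℝ U.carrier U.carrier) :=
  bif a.1 then [Sum.inr (ev U (true, a.2.1, k)), Sum.inl (centeredEv U (true, k, a.2.2), 1)]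
  else [Sum.inl (centeredEv U (false, a.2.1, k), 1), Sum.inr (ev U (false, k, a.2.2))]

/-- The difference of the coproduct of a generator and a multiple of its right copy. -/
def deviation (F : FreeProd U.carrier U.carrier) (a : Letter n) (θ : ℝ) : F.carrier :=
  ∑ k, itemProd F (deviationItems U a k) θ

theorem deviation_false (p s : Fin n) (θ : ℝ) : deviation F (false, p, s) θ =
    ∑ k, F.inl (centeredEv U (false, p, k) θ) * F.inr (ev U (false, k, s)) := by
  simp [deviation, deviationItems, itemProd, Item.val, Item.toSum, FreeProd.embed]

theorem deviation_true (p s : Fin n) (θ : ℝ) : deviation F (true, p, s) θ =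
    ∑ k, F.inr (ev U (true, p, k)) * F.inl (centeredEv U (true, k, s) θ) := by
  simp [deviation, deviationItems, itemProd, Item.val, Item.toSum, FreeProd.embed]

theorem map_ev_eq_add_deviation (hΔ : U.IsCoprod F Δ) (a : Letter n) (θ : ℝ) :
    Δ (ev U a) = (Real.cos θ : ℂ) • F.inr (ev U a) + deviation F a θ := by
  obtain ⟨ε, p, s⟩ := a
  cases ε
  · rw [deviation_false]
    have : Δ (ev U (false, p, s)) = ∑ k, F.inl (ev U (false, p, k)) * F.inr (ev U (false, k, s)) :=
      hΔ p s
    simp only [this, centeredEv, map_sub, map_smul, map_one, sub_mul, Finset.sum_sub_distrib,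
      smul_mul_assoc, one_mul]
    simp only [ite_smul, zero_smul, Finset.sum_ite_eq, Finset.mem_univ, if_true]
    abel
  · rw [deviation_true]
    have : Δ (ev U (true, p, s)) = ∑ k, F.inr (ev U (true, p, k)) * F.inl (ev U (true, k, s)) := by
      simp [ev, map_star, hΔ s p, star_sum]
    simp only [this, centeredEv, map_sub, map_smul, map_one, mul_sub, Finset.sum_sub_distrib,
      mul_smul_comm, mul_one]
    simp only [ite_smul, zero_smul, Finset.sum_ite_eq', Finset.mem_univ, if_true]
    abel

namespace TestFamily

variable (T : TestFamily U F Δ h)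

theorem map_centeredEv (a : Letter n) (θ : ℝ) :
    T.ρ θ (centeredEv U a θ) = (Real.sin θ : ℂ) • testGen a := by
  simp only [centeredEv, map_sub, T.map_ev, map_smul, map_one, add_sub_cancel_left]

theorem homogeneous_deviationItems (a : Letter n) (k : Fin n) :
    ∀ x ∈ deviationItems U a k, x.Homogeneous T.ρ (fun θ => (Real.sin θ : ℂ)) := by
  intro x hx
  obtain ⟨ε, p, s⟩ := a
  cases ε <;> simp only [deviationItems, cond_true, cond_false, List.mem_cons, List.not_mem_nil,
    or_false] at hx <;> rcases hx with rfl | rfl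
  · exact ⟨_, fun θ => by simpa only [pow_one] using T.map_centeredEv _ θ⟩
  · trivial
  · trivial
  · exact ⟨_, fun θ => by simpa only [pow_one] using T.map_centeredEv _ θ⟩

theorem deg_deviationItems (a : Letter n) (k : Fin n) :
    ((deviationItems U a k).map Item.deg).sum = 1 := by
  obtain ⟨ε, p, s⟩ := a
  cases ε <;> simp [deviationItems, Item.deg]

/-- A family in the free product which is of order `sin θ ^ D` as a factor in products. -/
def Small (D : ℕ) (Y : ℝ → F.carrier) : Prop :=
  ∀ l : List (Item ℝ U.carrier U.carrier),
    (∀ x ∈ l, x.Homogeneous T.ρ (fun θ => (Real.sin θ : ℂ))) → ∀ t : List (Letter n),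
    (fun θ => T.Ψ θ (itemProd F l θ * Y θ * Δ (evWord U t))) =O[⊤]
      (fun θ => (Real.sin θ : ℂ) ^ ((l.map Item.deg).sum + D))

theorem Small.itemProd_mul {T : TestFamily U F Δ h} {D : ℕ} {Y : ℝ → F.carrier}
    (hY : T.Small D Y) (l : List (Item ℝ U.carrier U.carrier))
    (hl : ∀ x ∈ l, x.Homogeneous T.ρ (fun θ => (Real.sin θ : ℂ))) :
    T.Small ((l.map Item.deg).sum + D) (fun θ => itemProd F l θ * Y θ) := by
  intro l' hl' t
  have := hY (l' ++ l) (List.forall_mem_append.2 ⟨hl', hl⟩) t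
  simpa only [itemProd_append, List.map_append, List.sum_append, mul_assoc, add_assoc] using this

theorem Small.inr_mul {T : TestFamily U F Δ h} {D : ℕ} {Y : ℝ → F.carrier}
    (hY : T.Small D Y) (b : U.carrier) : T.Small D (fun θ => F.inr b * Y θ) := by
  have := hY.itemProd_mul [Sum.inr b] (by simp [Item.Homogeneous])
  simpa [itemProd, Item.val, Item.toSum, FreeProd.embed, Item.deg] using this

theorem Small.deviation_mul {T : TestFamily U F Δ h} {D : ℕ} {Y : ℝ → F.carrier}
    (hY : T.Small D Y) (a : Letter n) : T.Small (1 + D) (fun θ => deviation F a θ * Y θ) := by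
  intro l hl t
  simp only [deviation, Finset.sum_mul, Finset.mul_sum, map_sum]
  refine IsBigO.fun_sum fun k _ => ?_
  have := hY.itemProd_mul _ (T.homogeneous_deviationItems a k) l hl t
  rwa [deg_deviationItems] at this

theorem small_one (hΔ : U.IsCoprod F Δ) (hn : 1 ≤ n) (h1 : h 1 = 1) : T.Small 0 (fun _ => 1) := by
  intro l hl t
  induction t generalizing l with
  | nil =>
    obtain ⟨C, hC⟩ := exists_freeProd_eq_pow_mul (isTracialState_testTrace hn).1.1 h1 T.isFreeProd
      l hl
    simp only [evWord, List.map_nil, List.prod_nil, map_one, mul_one, hC, add_zero]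
    simpa only [mul_comm] using (isBigO_refl _ _).const_mul_left C
  | cons a t ih =>
    have e : ∀ θ, T.Ψ θ (itemProd F l θ * 1 * Δ (evWord U (a :: t))) =
        (Real.cos θ : ℂ) * T.Ψ θ (itemProd F (l ++ [Sum.inr (ev U a)]) θ * 1 * Δ (evWord U t)) +
        ∑ k, T.Ψ θ (itemProd F (l ++ deviationItems U a k) θ * 1 * Δ (evWord U t)) := by
      intro θ
      rw [evWord_cons, map_mul Δ, map_ev_eq_add_deviation hΔ a θ]
      simp only [deviation, itemProd_append, mul_one, add_mul, mul_add, Finset.sum_mul,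
        Finset.mul_sum, mul_assoc, smul_mul_assoc, mul_smul_comm, map_add, map_sum, map_smul,
        smul_eq_mul]
      simp [itemProd, Item.val, Item.toSum, FreeProd.embed]
    simp only [e]
    have hcos : (fun θ : ℝ => (Real.cos θ : ℂ)) =O[⊤] (fun _ => (1 : ℂ)) := by
      refine IsBigO.of_bound 1 (Eventually.of_forall fun θ => ?_)
      rw [Complex.norm_real, norm_one, mul_one]
      exact Real.abs_cos_le_one θ
    have hsin : (fun θ : ℝ => (Real.sin θ : ℂ)) =O[⊤] (fun _ => (1 : ℂ)) := by
      refine IsBigO.of_bound 1 (Eventually.of_forall fun θ => ?_)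
      rw [Complex.norm_real, norm_one, mul_one]
      exact Real.abs_sin_le_one θ
    refine IsBigO.add ?_ (IsBigO.fun_sum fun k _ => ?_)
    · have := ih (l ++ [Sum.inr (ev U a)]) (List.forall_mem_append.2
        ⟨hl, by simp [Item.Homogeneous]⟩)
      simpa [Item.deg] using hcos.mul this
    · have h2 := ih (l ++ deviationItems U a k) (List.forall_mem_append.2
        ⟨hl, T.homogeneous_deviationItems a k⟩)
      simp only [List.map_append, List.sum_append, deg_deviationItems, add_zero] at h2 ⊢
      refine h2.trans ?_
      simp only [pow_succ]
      simpa using (isBigO_refl (fun θ : ℝ => (Real.sin θ : ℂ) ^ (l.map Item.deg).sum) ⊤).mul hsin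

theorem trace_centeredEv (a : Letter n) (θ : ℝ) :
    (testTrace n ∘ₗ (T.ρ θ).toLinearMap) (centeredEv U a θ) = 0 := by
  simp only [LinearMap.comp_apply, AlgHom.toLinearMap_apply, map_centeredEv, map_smul,
    testTrace_testGen, smul_zero]

theorem trace_centeredEv_mul (hn : 1 ≤ n) (a b : Letter n) (θ : ℝ) :
    (testTrace n ∘ₗ (T.ρ θ).toLinearMap) (centeredEv U a θ * centeredEv U b θ) =
      (Real.sin θ : ℂ) ^ 2 * if a.2.1 = b.2.2 ∧ a.2.2 = b.2.1 then
        (if a.1 = b.1 then -1 else 1) * (n : ℂ)⁻¹ else 0 := by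
  rw [LinearMap.comp_apply, AlgHom.toLinearMap_apply, map_mul, map_centeredEv, map_centeredEv,
    smul_mul_smul_comm, map_smul, testTrace_testGen_mul hn, smul_eq_mul, sq]

theorem apply_two_left (hn : 1 ≤ n) (h1 : h 1 = 1) (a b : Letter n) (θ : ℝ)
    (x y z : U.carrier) :
    T.Ψ θ (F.inr x * F.inl (centeredEv U a θ) * F.inr y * F.inl (centeredEv U b θ) * F.inr z) =
      (Real.sin θ : ℂ) ^ 2 * (if a.2.1 = b.2.2 ∧ a.2.2 = b.2.1 then
        (if a.1 = b.1 then -1 else 1) * (n : ℂ)⁻¹ else 0) * (h y * h (x * z)) := by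
  rw [freeProd_two_left (by simpa using (isTracialState_testTrace hn).1.1) h1 (T.isFreeProd θ)
    (T.trace_centeredEv a θ) (T.trace_centeredEv b θ), trace_centeredEv_mul T hn]

theorem apply_deviation (hn : 1 ≤ n) (h1 : h 1 = 1) (x y : U.carrier) (a : Letter n) (θ : ℝ) :
    T.Ψ θ (F.inr x * deviation F a θ * F.inr y) = 0 := by
  have key := fun (b : Letter n) (x y : U.carrier) =>
    freeProd_inr_inl_inr (by simpa using (isTracialState_testTrace hn).1.1) h1 (T.isFreeProd θ)
      (centeredEv U b θ) x y
  simp only [T.trace_centeredEv, zero_mul] at key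
  obtain ⟨ε, p, s⟩ := a
  cases ε
  · rw [deviation_false, Finset.mul_sum, Finset.sum_mul, map_sum]
    refine Finset.sum_eq_zero fun k _ => ?_
    rw [← mul_assoc, mul_assoc, ← map_mul, key]
  · rw [deviation_true, Finset.mul_sum, Finset.sum_mul, map_sum]
    refine Finset.sum_eq_zero fun k _ => ?_
    rw [← mul_assoc, ← map_mul, key]

end TestFamily

end SchwingerDyson

end FreeHaar

namespace FreeHaar

section Expansion

open Asymptotics Filter Topology

variable {n : ℕ} {U : BrownAlg n} {F : FreeProd U.carrier U.carrier}
  {Δ : U.carrier →⋆ₐ[ℂ] F.carrier} {h : U.carrier →ₗ[ℂ] ℂ}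

namespace TestFamily

variable (T : TestFamily U F Δ h)

theorem apply_deviation_deviation (hn : 1 ≤ n) (h1 : h 1 = 1) (htr : ∀ a b, h (a * b) = h (b * a))
    (x : List (Letter n)) (a : Letter n) (y : List (Letter n)) (b : Letter n)
    (z : List (Letter n)) (θ : ℝ) :
    T.Ψ θ (F.inr (evWord U x) * deviation F a θ * F.inr (evWord U y) * deviation F b θ *
      F.inr (evWord U z)) =
      (Real.sin θ : ℂ) ^ 2 * (n : ℂ)⁻¹ * pairTerm (wordMoment U h) x a y b z := by
  obtain ⟨ε, p, s⟩ := a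
  obtain ⟨ε', p', s'⟩ := b
  have key := fun (a b : Letter n) => T.apply_two_left hn h1 a b θ
  cases ε <;> cases ε'
  · have e : ∀ k l, F.inr (evWord U x) * (F.inl (centeredEv U (false, p, k) θ) *
        F.inr (ev U (false, k, s))) * F.inr (evWord U y) *
        (F.inl (centeredEv U (false, p', l) θ) * F.inr (ev U (false, l, s'))) *
        F.inr (evWord U z) = F.inr (evWord U x) * F.inl (centeredEv U (false, p, k) θ) *
        F.inr (ev U (false, k, s) * evWord U y) * F.inl (centeredEv U (false, p', l) θ) *
        F.inr (ev U (false, l, s') * evWord U z) := by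
      intro k l
      simp only [map_mul, mul_assoc]
    simp only [deviation_false, Finset.mul_sum, Finset.sum_mul, map_sum, e, key]
    simp only [and_comm (a := p = _), ite_and, mul_ite, ite_mul, mul_zero, zero_mul,
      Finset.sum_ite_eq, Finset.sum_ite_eq', Finset.mem_univ, if_true, pairTerm, Letter.mix,
      wordMoment, evWord_append, evWord_cons]
    ring
  · have e : ∀ k l, F.inr (evWord U x) * (F.inl (centeredEv U (false, p, k) θ) *
        F.inr (ev U (false, k, s))) * F.inr (evWord U y) *
        (F.inr (ev U (true, p', l)) * F.inl (centeredEv U (true, l, s') θ)) *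
        F.inr (evWord U z) = F.inr (evWord U x) * F.inl (centeredEv U (false, p, k) θ) *
        F.inr (ev U (false, k, s) * evWord U y * ev U (true, p', l)) *
        F.inl (centeredEv U (true, l, s') θ) * F.inr (evWord U z) := by
      intro k l
      simp only [map_mul, mul_assoc]
    have hs : ∑ k, h (ev U (false, k, s) * evWord U y * ev U (true, p', k)) =
        if p' = s then h (evWord U y) else 0 := by
      have hu := sum_ev_mul_ev U true p' s
      simp only [Bool.not_true] at hu
      simp only [htr _ (ev U (true, _, _)), ← mul_assoc]
      rw [← map_sum, ← Finset.sum_mul, hu]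
      split_ifs <;> simp
    simp only [deviation_false, deviation_true, Finset.mul_sum, Finset.sum_mul, map_sum, e, key]
    simp only [and_comm (a := p = _), ite_and, mul_ite, ite_mul, mul_zero, zero_mul,
      Finset.sum_ite_eq', Finset.mem_univ, if_true, pairTerm, Letter.adj, wordMoment,
      evWord_append, Prod.mk.injEq, Bool.true_eq_false, Bool.false_eq_true, if_false,
      Bool.not_false, true_and]
    by_cases hp : p = s'
    · simp only [hp, if_true, ← Finset.mul_sum, ← Finset.sum_mul, hs]
      split_ifs <;> ring
    · simp [hp, Ne.symm hp]
  · have e : ∀ k l, F.inr (evWord U x) * (F.inr (ev U (true, p, k)) *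
        F.inl (centeredEv U (true, k, s) θ)) * F.inr (evWord U y) *
        (F.inl (centeredEv U (false, p', l) θ) * F.inr (ev U (false, l, s'))) *
        F.inr (evWord U z) = F.inr (evWord U x * ev U (true, p, k)) *
        F.inl (centeredEv U (true, k, s) θ) *
        F.inr (evWord U y) * F.inl (centeredEv U (false, p', l) θ) *
        F.inr (ev U (false, l, s') * evWord U z) := by
      intro k l
      simp only [map_mul, mul_assoc]
    have hs : ∑ k, h (evWord U x * ev U (true, p, k) * (ev U (false, k, s') * evWord U z)) =
        if p = s' then h (evWord U x * evWord U z) else 0 := by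
      have hu := sum_ev_mul_ev U true p s'
      simp only [Bool.not_true] at hu
      simp only [mul_assoc (evWord U x), ← mul_assoc (ev U _)]
      rw [← map_sum, ← Finset.mul_sum, ← Finset.sum_mul, hu]
      split_ifs <;> simp
    simp only [deviation_false, deviation_true, Finset.mul_sum, Finset.sum_mul, map_sum, e, key]
    simp only [ite_and, mul_ite, ite_mul, mul_zero, zero_mul, Finset.sum_ite_eq', Finset.mem_univ,
      if_true, pairTerm, Letter.adj, wordMoment, evWord_append, Prod.mk.injEq, Bool.true_eq_false,
      Bool.false_eq_true, if_false, Bool.not_true, true_and]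
    by_cases hp : s = p'
    · simp only [hp, if_true, ← Finset.mul_sum, hs, eq_comm (a := p)]
      split_ifs <;> ring
    · simp [hp, Ne.symm hp]
  · have e : ∀ k l, F.inr (evWord U x) * (F.inr (ev U (true, p, k)) *
        F.inl (centeredEv U (true, k, s) θ)) * F.inr (evWord U y) *
        (F.inr (ev U (true, p', l)) * F.inl (centeredEv U (true, l, s') θ)) *
        F.inr (evWord U z) = F.inr (evWord U x * ev U (true, p, k)) *
        F.inl (centeredEv U (true, k, s) θ) *
        F.inr (evWord U y * ev U (true, p', l)) * F.inl (centeredEv U (true, l, s') θ) *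
        F.inr (evWord U z) := by
      intro k l
      simp only [map_mul, mul_assoc]
    simp only [deviation_true, Finset.mul_sum, Finset.sum_mul, map_sum, e, key]
    simp only [ite_and, mul_ite, ite_mul, mul_zero, zero_mul, Finset.sum_ite_eq,
      Finset.sum_ite_eq', Finset.mem_univ, if_true, pairTerm, Letter.mix, wordMoment, evWord_append,
      evWord_cons, htr (evWord U y), mul_assoc]
    ring

theorem apply_mul_map_evWord (hΔ : U.IsCoprod F Δ) (θ : ℝ) (Y : F.carrier)
    (w : List (Letter n)) :
    T.Ψ θ (Y * Δ (evWord U w)) = (Real.cos θ : ℂ) ^ w.length * T.Ψ θ (Y * F.inr (evWord U w)) +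
      splitSum w (fun x a v => (Real.cos θ : ℂ) ^ x.length *
        T.Ψ θ (Y * F.inr (evWord U x) * deviation F a θ * Δ (evWord U v))) := by
  have e1 : ∀ v : List (Letter n), Δ (evWord U v) = (v.map fun a => Δ (ev U a)).prod := by
    intro v
    rw [evWord, map_list_prod, List.map_map]
    rfl
  have e2 : ∀ v : List (Letter n), F.inr (evWord U v) = (v.map fun a => F.inr (ev U a)).prod := by
    intro v
    rw [evWord, map_list_prod, List.map_map]
    rfl
  have := congrArg (fun X => T.Ψ θ (Y * X))
    (prod_map_smul_add (fun a => map_ev_eq_add_deviation hΔ a θ) w)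
  simp only [← e1, ← e2, mul_add, map_add, mul_smul_comm, map_smul, smul_eq_mul, mul_splitSum]
    at this
  rw [this]
  congr 1
  refine (map_splitSum (T.Ψ θ).toAddMonoidHom w _).trans ?_
  simp only [LinearMap.toAddMonoidHom_coe, map_smul, smul_eq_mul, mul_assoc]

/-- The expansion to second order of the invariance of `h` under free convolution. -/
theorem schwingerDyson_isBigO (T : TestFamily U F Δ h) (hΔ : U.IsCoprod F Δ) (hn : 1 ≤ n)
    (h1 : h 1 = 1) (htr : ∀ a b, h (a * b) = h (b * a)) (w : List (Letter n)) :
    (fun θ : ℝ => (1 - (Real.cos θ : ℂ) ^ w.length) * wordMoment U h w -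
      (Real.cos θ : ℂ) ^ (w.length - 2) * ((Real.sin θ : ℂ) ^ 2 * (n : ℂ)⁻¹ *
        splitSum w (fun x a v => splitSum v (fun y b z => pairTerm (wordMoment U h) x a y b z))))
      =O[⊤] (fun θ => (Real.sin θ : ℂ) ^ 3) := by
  have e : ∀ θ, (1 - (Real.cos θ : ℂ) ^ w.length) * wordMoment U h w -
      (Real.cos θ : ℂ) ^ (w.length - 2) * ((Real.sin θ : ℂ) ^ 2 * (n : ℂ)⁻¹ *
        splitSum w (fun x a v => splitSum v (fun y b z => pairTerm (wordMoment U h) x a y b z))) =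
      splitSum w (fun x a v => splitSum v (fun y b z => splitSum z (fun x' a' v' =>
        (Real.cos θ : ℂ) ^ x.length * ((Real.cos θ : ℂ) ^ y.length *
          ((Real.cos θ : ℂ) ^ x'.length *
        T.Ψ θ (F.inr (evWord U x) * deviation F a θ * F.inr (evWord U y) * deviation F b θ *
          F.inr (evWord U x') * deviation F a' θ * Δ (evWord U v'))))))) := by
    intro θ
    have key := T.absorb θ (evWord U w)
    rw [← one_mul (Δ _), T.apply_mul_map_evWord hΔ, one_mul, (T.isFreeProd θ).2.2.1] at key
    have first := fun x a => T.apply_mul_map_evWord hΔ θ (F.inr (evWord U x) * deviation F a θ)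
    have second := fun x a y b => T.apply_mul_map_evWord hΔ θ
      (F.inr (evWord U x) * deviation F a θ * F.inr (evWord U y) * deviation F b θ)
    simp only [T.apply_deviation hn h1, T.apply_deviation_deviation hn h1 htr, mul_zero, zero_add]
      at first second
    simp only [one_mul, first, second, mul_add, splitSum_add] at key
    have e2 : splitSum w (fun x a v => (Real.cos θ : ℂ) ^ x.length * splitSum v (fun y b z =>
        (Real.cos θ : ℂ) ^ y.length * ((Real.cos θ : ℂ) ^ z.length *
          ((Real.sin θ : ℂ) ^ 2 * (n : ℂ)⁻¹ * pairTerm (wordMoment U h) x a y b z)))) =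
      (Real.cos θ : ℂ) ^ (w.length - 2) * ((Real.sin θ : ℂ) ^ 2 * (n : ℂ)⁻¹ *
        splitSum w (fun x a v => splitSum v (fun y b z =>
          pairTerm (wordMoment U h) x a y b z))) := by
      simp only [mul_splitSum]
      refine splitSum_congr fun x a v hw => splitSum_congr fun y b z hv => ?_
      have : w.length - 2 = x.length + (y.length + z.length) := by
        rw [hw, hv]
        simp
        omega
      rw [this, pow_add, pow_add]
      ring
    rw [e2] at key
    simp only [mul_splitSum, wordMoment] at key ⊢
    linear_combination -key
  simp only [e]
  have hcos : ∀ k : ℕ, (fun θ : ℝ => (Real.cos θ : ℂ) ^ k) =O[⊤] (fun _ => (1 : ℂ)) := by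
    refine fun k => IsBigO.of_bound 1 (Eventually.of_forall fun θ => ?_)
    rw [norm_pow, Complex.norm_real, norm_one, mul_one]
    exact pow_le_one₀ (norm_nonneg _) (Real.abs_cos_le_one θ)
  refine splitSum_isBigO _ fun x a v => splitSum_isBigO _ fun y b z =>
    splitSum_isBigO _ fun x' a' v' => ?_
  have h3 := ((((((T.small_one hΔ hn h1).deviation_mul a').inr_mul (evWord U x')).deviation_mul
    b).inr_mul (evWord U y)).deviation_mul a).inr_mul (evWord U x) [] (by simp) v'
  simp only [itemProd, List.map_nil, List.prod_nil, one_mul, mul_one, List.sum_nil] at h3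
  simpa [mul_assoc] using (hcos x.length).mul ((hcos y.length).mul ((hcos x'.length).mul h3))

/-- The Schwinger–Dyson equation of the free Haar trace, summed over all letters. -/
theorem schwingerDyson (T : TestFamily U F Δ h) (hΔ : U.IsCoprod F Δ) (hn : 1 ≤ n) (h1 : h 1 = 1)
    (htr : ∀ a b, h (a * b) = h (b * a)) (w : List (Letter n)) :
    (n : ℂ) * w.length * wordMoment U h w =
      2 * splitSum w (fun x a v => splitSum v (fun y b z =>
        pairTerm (wordMoment U h) x a y b z)) := by
  obtain ⟨C, hC⟩ := (T.schwingerDyson_isBigO hΔ hn h1 htr w).bound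
  rw [eventually_top] at hC
  generalize (splitSum w fun x a v => splitSum v fun y b z =>
    pairTerm (wordMoment U h) x a y b z) = S at *
  set g : ℝ → ℂ := fun θ => (∑ i ∈ Finset.range w.length, (Real.cos θ : ℂ) ^ i) * wordMoment U h w -
    (1 + Real.cos θ) * (Real.cos θ : ℂ) ^ (w.length - 2) * ((n : ℂ)⁻¹ * S) with hg
  have hgC : ∀ θ, Real.sin θ ≠ 0 → ‖g θ‖ ≤ 2 * C * |Real.sin θ| := by
    intro θ hθ
    have hs : (Real.sin θ : ℂ) ^ 2 = (1 - Real.cos θ) * (1 + Real.cos θ) := by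
      have : Real.sin θ ^ 2 = (1 - Real.cos θ) * (1 + Real.cos θ) := by
        rw [Real.sin_sq]
        ring
      exact_mod_cast this
    have e : (Real.sin θ : ℂ) ^ 2 * g θ = (1 + Real.cos θ) *
        ((1 - (Real.cos θ : ℂ) ^ w.length) * wordMoment U h w -
          (Real.cos θ : ℂ) ^ (w.length - 2) * ((Real.sin θ : ℂ) ^ 2 * (n : ℂ)⁻¹ * S)) := by
      rw [hg, ← mul_neg_geom_sum, hs]
      ring
    have h2 : ‖(1 + Real.cos θ : ℂ)‖ ≤ 2 := by
      refine (norm_add_le _ _).trans ?_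
      rw [norm_one, Complex.norm_real]
      linarith [Real.abs_cos_le_one θ, Real.norm_eq_abs (Real.cos θ)]
    have h3 : |Real.sin θ| ^ 2 * ‖g θ‖ ≤ 2 * (C * |Real.sin θ| ^ 3) := by
      have := congrArg norm e
      rw [norm_mul, norm_mul, norm_pow, Complex.norm_real, Real.norm_eq_abs] at this
      rw [this]
      have h4 := hC θ
      rw [norm_pow, Complex.norm_real, Real.norm_eq_abs] at h4
      exact mul_le_mul h2 h4 (norm_nonneg _) zero_le_two
    have h5 : 0 < |Real.sin θ| ^ 2 := by positivity
    nlinarith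
  have hg0 : Tendsto g (𝓝[≠] 0) (𝓝 (g 0)) := by
    refine Continuous.continuousWithinAt ?_
    fun_prop
  have hne : ∀ᶠ θ in 𝓝[≠] (0 : ℝ), Real.sin θ ≠ 0 := by
    simpa using (Real.hasDerivAt_sin 0).eventually_ne (by simp) (c := 0)
  have hs0 : Tendsto (fun θ => 2 * C * |Real.sin θ|) (𝓝[≠] 0) (𝓝 0) := by
    have : ContinuousWithinAt (fun θ => 2 * C * |Real.sin θ|) {0}ᶜ 0 := by fun_prop
    simpa [ContinuousWithinAt] using this
  have hg1 : Tendsto g (𝓝[≠] 0) (𝓝 0) := squeeze_zero_norm' (hne.mono hgC) hs0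
  have := tendsto_nhds_unique hg0 hg1
  have hn0 : (n : ℂ) ≠ 0 := by
    rw [Nat.cast_ne_zero]
    omega
  simp only [hg, Real.cos_zero, Complex.ofReal_one, one_pow, Finset.sum_const, Finset.card_range,
    nsmul_eq_mul, mul_one] at this
  field_simp at this
  linear_combination this

end TestFamily

end Expansion

end FreeHaar

namespace FreeHaar

section Conclusion

variable {n : ℕ}

theorem pairTerm_congr {M M' : List (Letter n) → ℂ} {w x y z : List (Letter n)} {a b : Letter n}
    (hM : ∀ v : List (Letter n), v.length < w.length → M v = M' v)
    (hw : w = x ++ a :: (y ++ b :: z)) : pairTerm M x a y b z = pairTerm M' x a y b z := by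
  have hl : w.length = x.length + y.length + z.length + 2 := by
    rw [hw]
    simp
    omega
  simp only [pairTerm]
  rw [hM (a.mix b :: y) (by simp; omega), hM (x ++ b.mix a :: z) (by simp; omega),
    hM y (by omega), hM (x ++ z) (by simp; omega)]

theorem wordMoment_eq_freeMoment (hn : 1 ≤ n) {U : BrownAlg n}
    {F : FreeProd U.carrier U.carrier} {Δ : U.carrier →⋆ₐ[ℂ] F.carrier} (hΔ : U.IsCoprod F Δ)
    {h : U.carrier →ₗ[ℂ] ℂ} (htrace : IsTracialState h)
    (hHaar : ∀ φ : U.carrier →ₗ[ℂ] ℂ, IsTracialState φ → U.FreeConv F Δ φ h h)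
    (w : List (Letter n)) : wordMoment U h w = freeMoment haarCumulant w := by
  obtain ⟨T⟩ := nonempty_testFamily hn hHaar
  obtain ⟨⟨h1, -⟩, htr⟩ := htrace
  induction hl : w.length using Nat.strong_induction_on generalizing w with
  | _ k ih =>
    subst hl
    rcases eq_or_ne w [] with rfl | hw
    · simp [wordMoment, evWord, h1, freeMoment_nil]
    · have hc : (n : ℂ) * w.length ≠ 0 := by
        have : w.length ≠ 0 := by simpa using hw
        have : n ≠ 0 := by omega
        simp [*]
      refine mul_left_cancel₀ hc ?_
      rw [T.schwingerDyson hΔ hn h1 htr w,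
        freeMoment_haarCumulant_pairs hn (freeMoment_rotate haarCumulant_rotate) w]
      congr 1
      refine splitSum_congr fun x a v hx => splitSum_congr fun y b z hv => ?_
      subst hv
      exact pairTerm_congr (fun v hv => ih _ hv v rfl) hx

theorem cumulant_map_ev (hn : 1 ≤ n) {U : BrownAlg n}
    {F : FreeProd U.carrier U.carrier} {Δ : U.carrier →⋆ₐ[ℂ] F.carrier} (hΔ : U.IsCoprod F Δ)
    {h : U.carrier →ₗ[ℂ] ℂ} (htrace : IsTracialState h)
    (hHaar : ∀ φ : U.carrier →ₗ[ℂ] ℂ, IsTracialState φ → U.FreeConv F Δ φ h h)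
    {κ : List U.carrier → ℂ} (hκ : IsCumulantFamily h κ) {w : List (Letter n)} (hw : w ≠ []) :
    κ (w.map (ev U)) = haarCumulant w := by
  refine eq_of_freeMoment_eq (κ := fun v => κ (v.map (ev U))) (fun v => ?_) w hw
  rw [freeMoment_map, ← map_prod_eq_freeMoment htrace.1.1 hκ,
    ← wordMoment_eq_freeMoment hn hΔ htrace hHaar]
  rfl

/-- The alternating word of length `2 * r` with left indices `p 0, s 0, p 1, s 1, …`. -/
def altWord (ε : Bool) (p s : ℕ → Fin n) (r : ℕ) : List (Letter n) :=
  ((List.range r).map fun m => [(ε, p m, s m), (!ε, s m, p (m + 1))]).flatten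

theorem length_altWord (ε : Bool) (p s : ℕ → Fin n) (r : ℕ) :
    (altWord ε p s r).length = 2 * r := by
  simp [altWord, List.length_flatten, Function.comp_def, mul_comm]

theorem altWord_succ (ε : Bool) (p s : ℕ → Fin n) (r : ℕ) :
    altWord ε p s (r + 1) = (ε, p 0, s 0) :: (!ε, s 0, p 1) ::
      altWord ε (fun m => p (m + 1)) (fun m => s (m + 1)) r := by
  simp [altWord, List.range_succ_eq_map, Function.comp_def]

theorem altPath_altWord (ε : Bool) (p s : ℕ → Fin n) (r : ℕ) :
    AltPath (ε, p 0) (altWord ε p s r) (ε, p r) := by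
  induction r generalizing p s with
  | zero => simp [altWord, AltPath]
  | succ r ih => simpa [altWord_succ, AltPath] using ih (fun m => p (m + 1)) (fun m => s (m + 1))

theorem AltPath.exists_eq_altWord {ε : Bool} {e f : Fin n} {w : List (Letter n)}
    (hw : AltPath (ε, e) w (ε, f)) : ∃ r p s, p 0 = e ∧ p r = f ∧ w = altWord ε p s r := by
  induction hl : w.length using Nat.strong_induction_on generalizing w e with
  | _ k ih =>
    match w, hw with
    | [], hw =>
      obtain rfl : e = f := by simpa [AltPath] using hw
      exact ⟨0, fun _ => e, fun _ => e, rfl, rfl, rfl⟩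
    | [a], hw => simpa using hw.type_eq
    | (δ, e₀, g) :: (δ', g', e') :: t, hw =>
      simp only [AltPath, Prod.mk.injEq] at hw
      obtain ⟨⟨rfl, rfl⟩, ⟨rfl, rfl⟩, ht⟩ := hw
      rw [Bool.not_not] at ht
      obtain ⟨r, p, s, hp, hr, rfl⟩ := ih _ (by simp at hl; omega) ht rfl
      refine ⟨r + 1, Nat.rec e₀ fun m _ => p m, Nat.rec g' fun m _ => s m, rfl, hr, ?_⟩
      rw [altWord_succ, ← hp]
      rfl

theorem isAltCycle_altWord (ε : Bool) (p s : ℕ → Fin n) {r : ℕ} (hr : 0 < r) (hp : p r = p 0) :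
    IsAltCycle (altWord ε p s r) := by
  have := altPath_altWord ε p s r
  obtain ⟨r, rfl⟩ : ∃ k, r = k + 1 := ⟨r - 1, by omega⟩
  rw [hp] at this
  rw [altWord_succ] at this ⊢
  exact this

theorem IsAltCycle.exists_eq_altWord {w : List (Letter n)} (hw : IsAltCycle w) :
    ∃ ε r p s, 0 < r ∧ p r = p 0 ∧ w = altWord ε p s r := by
  cases w with
  | nil => exact hw.elim
  | cons a t =>
    obtain ⟨r, p, s, hp, hr, e⟩ := AltPath.exists_eq_altWord hw
    refine ⟨a.1, r, p, s, Nat.pos_of_ne_zero ?_, hr.trans hp.symm, e⟩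
    rintro rfl
    simp [altWord] at e

theorem haarCumulant_altWord (ε : Bool) (p s : ℕ → Fin n) {r : ℕ} (hr : 0 < r) (hp : p r = p 0) :
    haarCumulant (altWord ε p s r) =
      (n : ℂ) ^ ((1 : ℤ) - 2 * r) * (-1) ^ (r - 1) * (catalan (r - 1) : ℂ) := by
  rw [haarCumulant, if_pos (isAltCycle_altWord ε p s hr hp), length_altWord, altCumulant,
    if_pos ⟨even_two_mul r, by omega⟩, Nat.mul_div_cancel_left r two_pos]

theorem map_altWord_false (U : BrownAlg n) {i p : ℕ → Fin n} (j : ℕ → Fin n) {r : ℕ}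
    (h₁ : ∀ m < r, p m = i m) (h₂ : ∀ m < r, p (m + 1) = i ((m + 1) % r)) :
    (altWord false p j r).map (ev U) = altCycle1 U r i j := by
  rw [altWord, altCycle1, List.map_flatten, List.map_map]
  congr 1
  refine List.map_congr_left fun m hm => ?_
  rw [List.mem_range] at hm
  simp [ev, h₁ m hm, h₂ m hm]

theorem map_altWord_true (U : BrownAlg n) {j p : ℕ → Fin n} (i : ℕ → Fin n) {r : ℕ}
    (h₁ : ∀ m < r, p m = j m) (h₂ : ∀ m < r, p (m + 1) = j ((m + 1) % r)) :
    (altWord true p i r).map (ev U) = altCycle2 U r i j := by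
  rw [altWord, altCycle2, List.map_flatten, List.map_map]
  congr 1
  refine List.map_congr_left fun m hm => ?_
  rw [List.mem_range] at hm
  simp [ev, h₁ m hm, h₂ m hm]

theorem apply_succ_eq_apply_mod {p : ℕ → Fin n} {r : ℕ} (hp : p r = p 0) (m : ℕ) (hm : m < r) :
    p (m + 1) = p ((m + 1) % r) := by
  rcases Nat.lt_or_ge (m + 1) r with h | h
  · rw [Nat.mod_eq_of_lt h]
  · obtain rfl : r = m + 1 := by omega
    rw [Nat.mod_self, hp]

theorem genWord_eq_map_ev (U : BrownAlg n) (q : ℕ) (ε : ℕ → Bool) (a b : ℕ → Fin n) :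
    genWord U q ε a b = ((List.range q).map fun m =>
      if ε m then (true, b m, a m) else (false, a m, b m)).map (ev U) := by
  rw [genWord, List.map_map]
  refine List.map_congr_left fun m _ => ?_
  cases hm : ε m <;> simp [ev, hm]

end Conclusion

end FreeHaar

/-- The free cumulants of the generators under the free Haar trace:
cyclically alternating cumulants are given by signed Catalan numbers, and all other
cumulants of generators vanish. -/
theorem free_cumulants_of_free_haar_trace (n : ℕ) (hn : 1 ≤ n) (U : BrownAlg n)
    (F : FreeProd U.carrier U.carrier) (Δ : U.carrier →⋆ₐ[ℂ] F.carrier)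
    (hΔ : U.IsCoprod F Δ)
    (h : U.carrier →ₗ[ℂ] ℂ) (htrace : IsTracialState h)
    (hHaar : ∀ φ : U.carrier →ₗ[ℂ] ℂ, IsTracialState φ →
        U.FreeConv F Δ φ h h ∧ U.FreeConv F Δ h φ h)
    (κ : List U.carrier → ℂ) (hκ : IsCumulantFamily h κ) :
    (∀ r : ℕ, 0 < r → ∀ i j : ℕ → Fin n,
      κ (altCycle1 U r i j) =
        (n : ℂ) ^ ((1 : ℤ) - 2 * r) * (-1) ^ (r - 1) * (catalan (r - 1) : ℂ)) ∧
    (∀ r : ℕ, 0 < r → ∀ i j : ℕ → Fin n,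
      κ (altCycle2 U r i j) =
        (n : ℂ) ^ ((1 : ℤ) - 2 * r) * (-1) ^ (r - 1) * (catalan (r - 1) : ℂ)) ∧
    (∀ q : ℕ, 0 < q → ∀ (ε : ℕ → Bool) (a b : ℕ → Fin n),
      (¬ ∃ (r : ℕ) (i j : ℕ → Fin n), 0 < r ∧ genWord U q ε a b = altCycle1 U r i j) →
      (¬ ∃ (r : ℕ) (i j : ℕ → Fin n), 0 < r ∧ genWord U q ε a b = altCycle2 U r i j) →
      κ (genWord U q ε a b) = 0) := by
  have key : ∀ w : List (FreeHaar.Letter n), w ≠ [] →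
      κ (w.map (FreeHaar.ev U)) = FreeHaar.haarCumulant w := fun w hw =>
    FreeHaar.cumulant_map_ev hn hΔ htrace (fun φ hφ => (hHaar φ hφ).1) hκ hw
  have hne : ∀ (ε : Bool) (p s : ℕ → Fin n) (r : ℕ), 0 < r → FreeHaar.altWord ε p s r ≠ [] := by
    intro ε p s r hr e
    have := congrArg List.length e
    rw [FreeHaar.length_altWord] at this
    simp at this
    omega
  refine ⟨fun r hr i j => ?_, fun r hr i j => ?_, fun q hq ε a b h₁ h₂ => ?_⟩
  · rw [← FreeHaar.map_altWord_false U (p := fun m => i (m % r)) j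
      (fun m hm => by rw [Nat.mod_eq_of_lt hm]) (fun m _ => rfl), key _ (hne _ _ _ _ hr),
      FreeHaar.haarCumulant_altWord _ _ _ hr (by simp)]
  · rw [← FreeHaar.map_altWord_true U (p := fun m => j (m % r)) i
      (fun m hm => by rw [Nat.mod_eq_of_lt hm]) (fun m _ => rfl), key _ (hne _ _ _ _ hr),
      FreeHaar.haarCumulant_altWord _ _ _ hr (by simp)]
  · rw [FreeHaar.genWord_eq_map_ev] at h₁ h₂ ⊢
    rw [key _ (by simpa using hq.ne'), FreeHaar.haarCumulant, if_neg]
    intro hw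
    obtain ⟨δ, r, p, s, hr, hp, e⟩ := hw.exists_eq_altWord
    rw [e] at h₁ h₂
    cases δ
    · exact h₁ ⟨r, p, s, hr, FreeHaar.map_altWord_false U s (fun _ _ => rfl)
        (FreeHaar.apply_succ_eq_apply_mod hp)⟩
    · exact h₂ ⟨r, s, p, hr, FreeHaar.map_altWord_true U s (fun _ _ => rfl)
        (FreeHaar.apply_succ_eq_apply_mod hp)⟩
end
end

section
/- For every n ≥ 1, there exists a unique tracial state h on the Brown algebra U_n^nc such that φ ⋆_T h = h = h ⋆_T φ for every tracial state φ on U_n^nc (a tensor Haar trace on U⟨n⟩). Moreover h satisfies, for every even r ≥ 2 and all indices: h(u_{i_1 j_1} u_{i_2 j_2}* u_{i_3 j_3} ⋯ u_{i_{r−1} j_{r−1}} u_{i_r j_r}*) = (1/n)·δ_{i_1 i_2} δ_{j_2 j_3} δ_{i_3 i_4} ⋯ δ_{i_{r−1} i_r} δ_{j_r j_1} and h(u_{i_1 j_1}* u_{i_2 j_2} ⋯ u_{i_{r−1} j_{r−1}}* u_{i_r j_r}) = (1/n)·δ_{j_1 j_2} δ_{i_2 i_3} δ_{j_3 j_4}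 ⋯ δ_{j_{r−1} j_r} δ_{i_r i_1}. -/
noncomputable section

/-- The alternating word `u_{i₁j₁} u_{i₂j₂}* u_{i₃j₃} ⋯ u_{i_{r-1}j_{r-1}} u_{i_rj_r}*`
of even length `r = 2s` (indices are read `0`-based). -/
def altWord1 {n : ℕ} (U : BrownAlg n) (r : ℕ) (i j : ℕ → Fin n) : List U.carrier :=
  (List.range r).map (fun m =>
    if m % 2 = 0 then U.u (i m) (j m) else star (U.u (i m) (j m)))

/-- The alternating word `u_{i₁j₁}* u_{i₂j₂} ⋯ u_{i_{r-1}j_{r-1}}* u_{i_rj_r}`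
of even length `r = 2s` (indices are read `0`-based). -/
def altWord2 {n : ℕ} (U : BrownAlg n) (r : ℕ) (i j : ℕ → Fin n) : List U.carrier :=
  (List.range r).map (fun m =>
    if m % 2 = 0 then star (U.u (i m) (j m)) else U.u (i m) (j m))

open TensorProduct

/-- Induction principle for the Brown algebra: it is generated by the `u i j` and their adjoints. -/
theorem BrownAlg.induction {n : ℕ} (U : BrownAlg n) {p : U.carrier → Prop}
    (u : ∀ i j, p (U.u i j)) (star_u : ∀ i j, p (star (U.u i j)))
    (scalar : ∀ c : ℂ, p (algebraMap ℂ U.carrier c))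
    (add : ∀ a b, p a → p b → p (a + b)) (mul : ∀ a b, p a → p b → p (a * b))
    (a : U.carrier) : p a := by
  let S := StarAlgebra.adjoin ℂ (Set.range fun q : Fin n × Fin n => U.u q.1 q.2)
  have hu : ∀ i j, U.u i j ∈ S := fun i j => StarAlgebra.subset_adjoin ℂ _ ⟨(i, j), rfl⟩
  obtain ⟨f, hf, -⟩ := U.universal S (fun i j => ⟨U.u i j, hu i j⟩)
    (fun i j => Subtype.ext (by
      have h := U.rel_left i j
      split_ifs with hij <;> simpa [hij] using h))
    (fun i j => Subtype.ext (by
      have h := U.rel_right i j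
      split_ifs with hij <;> simpa [hij] using h))
  have hid : S.subtype.comp f = StarAlgHom.id ℂ U.carrier :=
    (U.universal U.carrier U.u U.rel_left U.rel_right).unique
      (fun i j => by simp [hf]) (fun i j => rfl)
  have ha : a ∈ S := by
    have h := DFunLike.congr_fun hid a
    have h' : ((f a : S) : U.carrier) = a := h
    rw [← h']
    exact (f a).2
  have ha' : a ∈ Algebra.adjoin ℂ _ := ha
  induction ha' using Algebra.adjoin_induction with
  | mem x hx =>
    rcases hx with ⟨q, rfl⟩ | ⟨q, hq⟩
    · exact u _ _
    · rw [← star_star x, ← hq]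
      exact star_u _ _
  | algebraMap c => exact scalar c
  | add x y hx hy px py => exact add x y (px hx) (py hy)
  | mul x y hx hy px py => exact mul x y (px hx) (py hy)

/-- Induction principle for the free product: it is generated by its two legs. -/
theorem FreeProd.induction {A B : Type} [Ring A] [Algebra ℂ A] [StarRing A]
    [Ring B] [Algebra ℂ B] [StarRing B] (F : FreeProd A B) {p : F.carrier → Prop}
    (inl : ∀ a, p (F.inl a)) (inr : ∀ b, p (F.inr b))
    (scalar : ∀ c : ℂ, p (algebraMap ℂ F.carrier c))
    (add : ∀ x y, p x → p y → p (x + y)) (mul : ∀ x y, p x → p y → p (x * y))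
    (x : F.carrier) : p x := by
  let S := StarAlgebra.adjoin ℂ (Set.range F.inl ∪ Set.range F.inr)
  have hl : ∀ a, F.inl a ∈ S := fun a => StarAlgebra.subset_adjoin ℂ _ (Or.inl ⟨a, rfl⟩)
  have hr : ∀ b, F.inr b ∈ S := fun b => StarAlgebra.subset_adjoin ℂ _ (Or.inr ⟨b, rfl⟩)
  obtain ⟨f, hf, -⟩ := F.universal S (F.inl.codRestrict S hl) (F.inr.codRestrict S hr)
  have hid : S.subtype.comp f = StarAlgHom.id ℂ F.carrier :=
    (F.universal F.carrier F.inl F.inr).unique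
      ⟨fun a => by simp [hf.1], fun b => by simp [hf.2]⟩ ⟨fun a => rfl, fun b => rfl⟩
  have hx : x ∈ S := by
    have h : ((f x : S) : F.carrier) = x := DFunLike.congr_fun hid x
    rw [← h]
    exact (f x).2
  have hx' : x ∈ Algebra.adjoin ℂ _ := hx
  induction hx' using Algebra.adjoin_induction with
  | mem y hy =>
    rcases hy with (⟨q, rfl⟩ | ⟨q, rfl⟩) | (⟨q, hq⟩ | ⟨q, hq⟩)
    · exact inl _
    · exact inr _
    · rw [← star_star y, ← hq, ← map_star]
      exact inl _
    · rw [← star_star y, ← hq, ← map_star]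
      exact inr _
  | algebraMap c => exact scalar c
  | add y z hy hz py pz => exact add y z (py hy) (pz hz)
  | mul y z hy hz py pz => exact mul y z (py hy) (pz hz)

section

variable {A : Type} [Ring A] [Algebra ℂ A]

/-- The functional `φ ⊗ ψ` on the algebraic tensor product. -/
def tensorFunctional (φ ψ : A →ₗ[ℂ] ℂ) : A ⊗[ℂ] A →ₗ[ℂ] ℂ :=
  LinearMap.mul' ℂ ℂ ∘ₗ TensorProduct.map φ ψ

@[simp]
theorem tensorFunctional_tmul (φ ψ : A →ₗ[ℂ] ℂ) (a b : A) :
    tensorFunctional φ ψ (a ⊗ₜ b) = φ a * ψ b := by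
  simp [tensorFunctional]

end

section TensorFunctional

variable {A : Type} [Ring A] [Algebra ℂ A] [StarRing A]

/-- The span of all alternating products of elements of the kernel of the counit. -/
def alternatingSpan (F : FreeProd A A) (δc : A →⋆ₐ[ℂ] ℂ) : Submodule ℂ F.carrier :=
  Submodule.span ℂ {x | ∃ l : List (A ⊕ A), l.IsChain (fun x y => x.isLeft ≠ y.isLeft) ∧
    (∀ x ∈ l, Sum.elim (fun a => δc a = 0) (fun b => δc b = 0) x) ∧ x = (l.map F.embed).prod}

theorem inl_mul_mem_alternatingSpan (F : FreeProd A A) (δc : A →⋆ₐ[ℂ] ℂ) (a : A)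
    {x : F.carrier} (hx : x ∈ alternatingSpan F δc) : F.inl a * x ∈ alternatingSpan F δc := by
  have ha : F.inl a = F.inl (a - algebraMap ℂ A (δc a)) + algebraMap ℂ F.carrier (δc a) := by
    rw [map_sub, AlgHomClass.commutes, sub_add_cancel]
  have hδa : δc (a - algebraMap ℂ A (δc a)) = 0 := by
    rw [map_sub, AlgHomClass.commutes]; simp
  rw [ha, add_mul, ← Algebra.smul_def]
  refine add_mem ?_ (Submodule.smul_mem _ _ hx)
  generalize a - algebraMap ℂ A (δc a) = b at hδa
  induction hx using Submodule.span_induction with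
  | mem x hx =>
    obtain ⟨l, hl, hδ, rfl⟩ := hx
    apply Submodule.subset_span
    rcases l with _ | ⟨c | c, l⟩
    · exact ⟨[Sum.inl b], by simp, by simpa using hδa, by simp [FreeProd.embed]⟩
    · refine ⟨Sum.inl (b * c) :: l, ?_, ?_, by simp [FreeProd.embed, mul_assoc]⟩
      · cases l <;> simp_all
      · simp_all
    · exact ⟨Sum.inl b :: Sum.inr c :: l, by simpa using hl, by simp_all,
        by simp [FreeProd.embed]⟩
  | zero => simp
  | add x y _ _ hx hy => rw [mul_add]; exact add_mem hx hy
  | smul c x _ hx => rw [mul_smul_comm]; exact Submodule.smul_mem _ _ hx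

theorem inr_mul_mem_alternatingSpan (F : FreeProd A A) (δc : A →⋆ₐ[ℂ] ℂ) (a : A)
    {x : F.carrier} (hx : x ∈ alternatingSpan F δc) : F.inr a * x ∈ alternatingSpan F δc := by
  have ha : F.inr a = F.inr (a - algebraMap ℂ A (δc a)) + algebraMap ℂ F.carrier (δc a) := by
    rw [map_sub, AlgHomClass.commutes, sub_add_cancel]
  have hδa : δc (a - algebraMap ℂ A (δc a)) = 0 := by
    rw [map_sub, AlgHomClass.commutes]; simp
  rw [ha, add_mul, ← Algebra.smul_def]
  refine add_mem ?_ (Submodule.smul_mem _ _ hx)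
  generalize a - algebraMap ℂ A (δc a) = b at hδa
  induction hx using Submodule.span_induction with
  | mem x hx =>
    obtain ⟨l, hl, hδ, rfl⟩ := hx
    apply Submodule.subset_span
    rcases l with _ | ⟨c | c, l⟩
    · exact ⟨[Sum.inr b], by simp, by simpa using hδa, by simp [FreeProd.embed]⟩
    · exact ⟨Sum.inr b :: Sum.inl c :: l, by simpa using hl, by simp_all,
        by simp [FreeProd.embed]⟩
    · refine ⟨Sum.inr (b * c) :: l, ?_, ?_, by simp [FreeProd.embed, mul_assoc]⟩
      · cases l <;> simp_all
      · simp_all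
  | zero => simp
  | add x y _ _ hx hy => rw [mul_add]; exact add_mem hx hy
  | smul c x _ hx => rw [mul_smul_comm]; exact Submodule.smul_mem _ _ hx

theorem alternatingSpan_eq_top (F : FreeProd A A) (δc : A →⋆ₐ[ℂ] ℂ) :
    alternatingSpan F δc = ⊤ := by
  refine Submodule.eq_top_iff'.2 fun x => ?_
  have key : ∀ y ∈ alternatingSpan F δc, x * y ∈ alternatingSpan F δc := by
    induction x using F.induction with
    | inl a => exact fun y hy => inl_mul_mem_alternatingSpan F δc a hy
    | inr a => exact fun y hy => inr_mul_mem_alternatingSpan F δc a hy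
    | scalar c =>
      intro y hy
      rw [← Algebra.smul_def]
      exact Submodule.smul_mem _ _ hy
    | add a b ha hb =>
      intro y hy
      rw [add_mul]
      exact add_mem (ha y hy) (hb y hy)
    | mul a b ha hb =>
      intro y hy
      rw [mul_assoc]
      exact ha _ (hb y hy)
  have h1 : (1 : F.carrier) ∈ alternatingSpan F δc :=
    Submodule.subset_span ⟨[], by simp, by simp, by simp⟩
  simpa using key 1 h1

/-- The tensor product functional is unique. -/
theorem IsTensorProdFunctional.unique {F : FreeProd A A} {δc : A →⋆ₐ[ℂ] ℂ}
    {φ ψ : A →ₗ[ℂ] ℂ} {Ψ Ψ' : F.carrier →ₗ[ℂ] ℂ} (h : IsTensorProdFunctional F δc φ ψ Ψ)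
    (h' : IsTensorProdFunctional F δc φ ψ Ψ') : Ψ = Ψ' := by
  refine LinearMap.ext_on (alternatingSpan_eq_top F δc) ?_
  rintro _ ⟨l, hl, hδ, rfl⟩
  by_cases hnil : l = []
  · simp [hnil, h.1, h'.1]
  · rw [h.2 l hnil hl hδ, h'.2 l hnil hl hδ]

variable [StarModule ℂ A]

theorem exists_toTensor (F : FreeProd A A) :
    ∃ π : F.carrier →⋆ₐ[ℂ] A ⊗[ℂ] A, (∀ a, π (F.inl a) = a ⊗ₜ 1) ∧ ∀ a, π (F.inr a) = 1 ⊗ₜ a := by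
  let f : A →⋆ₐ[ℂ] A ⊗[ℂ] A :=
    { Algebra.TensorProduct.includeLeft (R := ℂ) (S := ℂ) (A := A) (B := A) with
      map_star' := fun a => by simp }
  let g : A →⋆ₐ[ℂ] A ⊗[ℂ] A :=
    { Algebra.TensorProduct.includeRight (R := ℂ) (A := A) (B := A) with
      map_star' := fun a => by simp }
  obtain ⟨π, hπ, -⟩ := F.universal (A ⊗[ℂ] A) f g
  exact ⟨π, hπ⟩

/-- The canonical homomorphism from the free product to the tensor product. -/
def FreeProd.toTensor (F : FreeProd A A) : F.carrier →⋆ₐ[ℂ] A ⊗[ℂ] A :=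
  (exists_toTensor F).choose

@[simp]
theorem FreeProd.toTensor_inl (F : FreeProd A A) (a : A) : F.toTensor (F.inl a) = a ⊗ₜ 1 :=
  (exists_toTensor F).choose_spec.1 a

@[simp]
theorem FreeProd.toTensor_inr (F : FreeProd A A) (a : A) : F.toTensor (F.inr a) = 1 ⊗ₜ a :=
  (exists_toTensor F).choose_spec.2 a

theorem FreeProd.toTensor_prod_embed (F : FreeProd A A) (l : List (A ⊕ A)) :
    F.toTensor (l.map F.embed).prod =
      (l.filterMap Sum.getLeft?).prod ⊗ₜ (l.filterMap Sum.getRight?).prod := by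
  induction l with
  | nil => simp [Algebra.TensorProduct.one_def]
  | cons x l ih =>
    rw [List.map_cons, List.prod_cons, map_mul, ih]
    cases x <;> simp [FreeProd.embed, List.filterMap_cons]

theorem isTensorProdFunctional_toTensor (F : FreeProd A A) (δc : A →⋆ₐ[ℂ] ℂ)
    {φ ψ : A →ₗ[ℂ] ℂ} (hφ : φ 1 = 1) (hψ : ψ 1 = 1) :
    IsTensorProdFunctional F δc φ ψ
      (tensorFunctional φ ψ ∘ₗ F.toTensor.toAlgHom.toLinearMap) := by
  refine ⟨by simp [Algebra.TensorProduct.one_def, hφ, hψ], fun l _ _ _ => ?_⟩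
  simp [F.toTensor_prod_embed]

end TensorFunctional

namespace BrownAlg

variable {n : ℕ} (U : BrownAlg n) {F : FreeProd U.carrier U.carrier}
    {Δ : U.carrier →⋆ₐ[ℂ] F.carrier} {δc : U.carrier →⋆ₐ[ℂ] ℂ}

theorem toTensor_coprod_u (hΔ : U.IsCoprod F Δ) (i j : Fin n) :
    F.toTensor (Δ (U.u i j)) = ∑ k, U.u i k ⊗ₜ[ℂ] U.u k j := by
  simp [hΔ i j]

theorem toTensor_coprod_star_u (hΔ : U.IsCoprod F Δ) (i j : Fin n) :
    F.toTensor (Δ (star (U.u i j))) = ∑ k, star (U.u i k) ⊗ₜ[ℂ] star (U.u k j) := by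
  rw [map_star, map_star, U.toTensor_coprod_u hΔ, star_sum]
  simp

theorem tensorConv_iff {φ ψ χ : U.carrier →ₗ[ℂ] ℂ} (hφ : φ 1 = 1) (hψ : ψ 1 = 1) :
    U.TensorConv F Δ δc φ ψ χ ↔ ∀ a, tensorFunctional φ ψ (F.toTensor (Δ a)) = χ a := by
  have h := isTensorProdFunctional_toTensor F δc hφ hψ
  constructor
  · rintro ⟨Ψ, hΨ, hχ⟩ a
    rw [← hχ, hΨ.unique h]
    rfl
  · exact fun hχ => ⟨_, h, hχ⟩

end BrownAlg

section SiteEmbed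

variable {K R S : Type} [Fintype K] [DecidableEq K] [Ring R] [Ring S] {n : ℕ}

/-- The embedding of `n × n` matrices in the tensor power indexed by `K`, acting on the factor
`s`. -/
def siteEmbed (s : K) :
    Matrix (Fin n) (Fin n) R →+* Matrix (K → Fin n) (K → Fin n) R where
  toFun A := (Matrix.blockDiagonal fun _ : {j // j ≠ s} → Fin n => A).submatrix
    (Equiv.funSplitAt s (Fin n)) (Equiv.funSplitAt s (Fin n))
  map_one' := by
    rw [show (fun _ : {j // j ≠ s} → Fin n => (1 : Matrix (Fin n) (Fin n) R)) = 1 from rfl,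
      Matrix.blockDiagonal_one, Matrix.submatrix_one_equiv]
  map_mul' A B := by rw [Matrix.blockDiagonal_mul, Matrix.submatrix_mul_equiv]
  map_zero' := by
    rw [show (fun _ : {j // j ≠ s} → Fin n => (0 : Matrix (Fin n) (Fin n) R)) = 0 from rfl,
      Matrix.blockDiagonal_zero, Matrix.submatrix_zero]; rfl
  map_add' A B := by
    change ((Matrix.blockDiagonal ((fun _ => A) + fun _ => B)).submatrix _ _) = _
    rw [Matrix.blockDiagonal_add]
    rfl

theorem siteEmbed_apply (s : K) (A : Matrix (Fin n) (Fin n) R) (x y : K → Fin n) :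
    siteEmbed s A x y = if ∀ k, k ≠ s → x k = y k then A (x s) (y s) else 0 := by
  change Matrix.blockDiagonal (fun _ : {j // j ≠ s} → Fin n => A) _ _ = _
  rw [Matrix.blockDiagonal_apply]
  simp [Equiv.funSplitAt, Equiv.piSplitAt, funext_iff]

theorem siteEmbed_map (s : K) (A : Matrix (Fin n) (Fin n) R) (g : R →+* S) :
    (siteEmbed s A).map g = siteEmbed s (A.map g) := by
  ext x y
  simp only [Matrix.map_apply, siteEmbed_apply]
  split_ifs <;> simp

theorem siteEmbed_star [StarRing R] (s : K) (A : Matrix (Fin n) (Fin n) R) :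
    siteEmbed s (star A) = star (siteEmbed s A) := by
  ext x y
  simp only [Matrix.star_apply, siteEmbed_apply, eq_comm]
  split_ifs <;> simp

theorem siteEmbed_scalar (s : K) (a : R) :
    siteEmbed s (Matrix.scalar (Fin n) a) = Matrix.scalar (K → Fin n) a := by
  ext x y
  rw [siteEmbed_apply]
  by_cases h : x = y
  · simp [h]
  · rw [Matrix.scalar_apply, Matrix.scalar_apply, Matrix.diagonal_apply_ne _ h]
    split_ifs with h1
    · refine Matrix.diagonal_apply_ne _ fun h2 => h (funext fun k => ?_)
      by_cases hk : k = s
      · rw [hk, h2]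
      · exact h1 k hk
    · rfl

/-- Matrices on distinct sites commute as soon as their entries do. -/
theorem siteEmbed_commute {s t : K} (hst : s ≠ t) {A B : Matrix (Fin n) (Fin n) R}
    (hAB : ∀ i j k l, Commute (A i j) (B k l)) :
    Commute (siteEmbed s A) (siteEmbed t B) := by
  have key : ∀ {s t : K} (_ : s ≠ t) (A B : Matrix (Fin n) (Fin n) R) (x y : K → Fin n),
      (siteEmbed s A * siteEmbed t B) x y =
        if ∀ k, k ≠ s → k ≠ t → x k = y k then A (x s) (y s) * B (x t) (y t) else 0 := by
    intro s t hst A B x y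
    rw [Matrix.mul_apply, Finset.sum_eq_single (Function.update x s (y s))]
    · have h1 : ∀ k, k ≠ s → x k = Function.update x s (y s) k := fun k hk => by simp [hk]
      have h2 : (∀ k, k ≠ t → Function.update x s (y s) k = y k) ↔
          ∀ k, k ≠ s → k ≠ t → x k = y k := by
        refine forall_congr' fun k => ?_
        by_cases hk : k = s
        · subst hk; simp
        · simp [hk]
      simp only [siteEmbed_apply, if_pos h1, h2, Function.update_self,
        Function.update_of_ne hst.symm]
      split_ifs <;> simp
    · intro z _ hz
      simp only [siteEmbed_apply]
      split_ifs with h1 h2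
      · refine absurd (funext fun k => ?_) hz
        by_cases hk : k = s
        · subst hk; simpa using h2 k hst
        · simpa [hk] using (h1 k hk).symm
      all_goals simp
    · simp
  ext x y
  rw [key hst, key hst.symm]
  simp only [(hAB _ _ _ _).eq]
  exact if_congr (forall_congr' fun k => by tauto) rfl rfl

theorem siteEmbed_reindex (e : K ≃ K) (s : K) (A : Matrix (Fin n) (Fin n) R)
    (x y : K → Fin n) :
    siteEmbed (e s) A x y = siteEmbed s A (x ∘ e) (y ∘ e) := by
  rw [siteEmbed_apply, siteEmbed_apply]
  refine if_congr ?_ rfl rfl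
  rw [← e.forall_congr_right]
  simp

theorem trace_siteEmbed (s : K) (A : Matrix (Fin n) (Fin n) ℂ) (hn : 1 ≤ n) :
    (Fintype.card (K → Fin n) : ℂ)⁻¹ * (siteEmbed s A).trace = (n : ℂ)⁻¹ * A.trace := by
  have h : (siteEmbed s A).trace = Fintype.card ({j // j ≠ s} → Fin n) * A.trace := by
    rw [show (siteEmbed s A).trace =
      (Matrix.blockDiagonal fun _ : {j // j ≠ s} → Fin n => A).trace from
        (Equiv.funSplitAt s (Fin n)).sum_comp fun p => Matrix.blockDiagonal (fun _ => A) p p,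
      Matrix.trace_blockDiagonal]
    simp
  have h' : Fintype.card (K → Fin n) = n * Fintype.card ({j // j ≠ s} → Fin n) := by
    rw [Fintype.card_congr (Equiv.funSplitAt s (Fin n)), Fintype.card_prod, Fintype.card_fin]
  have : Nonempty (Fin n) := ⟨⟨0, hn⟩⟩
  have h0 : (Fintype.card ({j // j ≠ s} → Fin n) : ℂ) ≠ 0 := by
    exact_mod_cast Fintype.card_ne_zero
  have hn0 : (n : ℂ) ≠ 0 := by exact_mod_cast (by omega : n ≠ 0)
  rw [h, h']
  push_cast at h0 ⊢
  field_simp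

end SiteEmbed

section Walk

variable (N : ℕ) [NeZero N] (n : ℕ) (R : Type) [Ring R]

/-- Block matrices over the cycle `ZMod N` with entries in the `N`-fold tensor power of the
`n × n` matrices. -/
abbrev WalkAlg : Type :=
  Matrix (ZMod N) (ZMod N) (Matrix (ZMod N → Fin n) (ZMod N → Fin n) R)

variable {n R}

/-- The block diagonal matrix acting on the site at which the walker stands. -/
def onSite : Matrix (Fin n) (Fin n) R →+* WalkAlg N n R :=
  (Matrix.diagonalRingHom (ZMod N) (Matrix (ZMod N → Fin n) (ZMod N → Fin n) R)).comp
    (RingHom.pi fun t => siteEmbed t)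

variable (n R) in
/-- The step from each `t` to `t + 1`. -/
def step : WalkAlg N n R := Matrix.of fun t q => if q = t + 1 then 1 else 0

theorem onSite_mul_step_apply (A : Matrix (Fin n) (Fin n) R) (t q : ZMod N) :
    (onSite N A * step N n R) t q = if q = t + 1 then siteEmbed t A else 0 := by
  change ((Matrix.diagonal (fun t => siteEmbed t A) : WalkAlg N n R) * step N n R) t q = _
  rw [Matrix.diagonal_mul]
  simp [step]

variable [StarRing R]

theorem onSite_star (A : Matrix (Fin n) (Fin n) R) : onSite N (star A) = star (onSite N A) := by
  change Matrix.diagonal (fun t => siteEmbed t (star A)) =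
    (Matrix.diagonal (fun t => siteEmbed t A)).conjTranspose
  rw [Matrix.diagonal_conjTranspose]
  congr 1
  ext1 t
  exact siteEmbed_star t A

theorem star_step_mul_onSite_apply (A : Matrix (Fin n) (Fin n) R) (t q : ZMod N) :
    (star (step N n R) * onSite N A) t q = if t = q + 1 then siteEmbed q A else 0 := by
  rw [← star_star A, onSite_star, ← star_mul, Matrix.star_apply, onSite_mul_step_apply]
  split_ifs
  · rw [siteEmbed_star, star_star, star_star]
  · simp

variable (n R) in
theorem step_mul_star_step : step N n R * star (step N n R) = 1 := by
  ext1 t q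
  rw [Matrix.mul_apply, Finset.sum_eq_single (t + 1)]
  · by_cases h : t = q <;> simp [step, Matrix.star_apply, Matrix.one_apply, h]
  · intro z _ hz
    simp [step, hz]
  · simp

variable (n R) in
theorem star_step_mul_step : star (step N n R) * step N n R = 1 := by
  ext1 t q
  rw [Matrix.mul_apply, Finset.sum_eq_single (t - 1)]
  · by_cases h : t = q
    · simp [step, Matrix.star_apply, Matrix.one_apply, h]
    · simp [step, Matrix.star_apply, h, Ne.symm h]
  · intro z _ hz
    have : ¬ t = z + 1 := fun h => hz (by simp [h])
    simp [step, Matrix.star_apply, this]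
  · simp

end Walk

section WalkRep

variable {n : ℕ} (U : BrownAlg n) (N : ℕ) [NeZero N]

theorem BrownAlg.exists_walkRep : ∃ f : U.carrier →⋆ₐ[ℂ] WalkAlg N n ℂ,
    ∀ i j, f (U.u i j) = onSite N (Matrix.single j i 1) * step N n ℂ := by
  have hstar : ∀ i j : Fin n, star (Matrix.single i j (1 : ℂ)) = Matrix.single j i 1 := by
    intro i j
    simp [Matrix.star_eq_conjTranspose]
  have hsum : ∑ k, Matrix.single k k (1 : ℂ) = (1 : Matrix (Fin n) (Fin n) ℂ) :=
    Matrix.sum_single_one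
  refine (U.universal (WalkAlg N n ℂ)
    (fun i j => onSite N (Matrix.single j i 1) * step N n ℂ) (fun i j => ?_)
    (fun i j => ?_)).exists
  · have h : ∑ k, Matrix.single k i (1 : ℂ) * Matrix.single j k 1 = if i = j then 1 else 0 := by
      split_ifs with hij
      · subst hij; simp [hsum]
      · simp [hij]
    calc _ = star (step N n ℂ) *
          onSite N (∑ k, Matrix.single k i (1 : ℂ) * Matrix.single j k 1) * step N n ℂ := by
          rw [map_sum, Finset.mul_sum, Finset.sum_mul]
          refine Finset.sum_congr rfl fun k _ => ?_
          rw [star_mul, ← onSite_star, hstar, map_mul]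
          simp only [mul_assoc]
      _ = _ := by
          rw [h]
          split_ifs
          · rw [map_one, mul_one, star_step_mul_step]
          · rw [map_zero, mul_zero, zero_mul]
  · have h : ∑ k, Matrix.single k i (1 : ℂ) * Matrix.single j k 1 = if i = j then 1 else 0 := by
      split_ifs with hij
      · subst hij; simp [hsum]
      · simp [hij]
    calc _ = onSite N (∑ k, Matrix.single k i (1 : ℂ) * Matrix.single j k 1) := by
          rw [map_sum]
          refine Finset.sum_congr rfl fun k _ => ?_
          rw [star_mul, ← onSite_star, hstar, map_mul, mul_assoc, ← mul_assoc (step N n ℂ),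
            step_mul_star_step, one_mul]
      _ = _ := by rw [h]; split_ifs <;> simp

/-- The representation `u i j ↦ E_{ji} V` of the Brown algebra, where `V` is the step and
`E_{ji}` acts on the site at which the walker stands. -/
def BrownAlg.walkRep : U.carrier →⋆ₐ[ℂ] WalkAlg N n ℂ := (U.exists_walkRep N).choose

theorem BrownAlg.walkRep_u (i j : Fin n) :
    U.walkRep N (U.u i j) = onSite N (Matrix.single j i 1) * step N n ℂ :=
  (U.exists_walkRep N).choose_spec i j

theorem BrownAlg.walkRep_star_u (i j : Fin n) :
    U.walkRep N (star (U.u i j)) = star (step N n ℂ) * onSite N (Matrix.single i j 1) := by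
  rw [map_star, U.walkRep_u, star_mul, ← onSite_star]
  simp [Matrix.star_eq_conjTranspose]

/-- The walk representation is equivariant under simultaneous translation of the walker and of the
sites. -/
theorem BrownAlg.walkRep_translate (a : U.carrier) (t q : ZMod N) (x y : ZMod N → Fin n) :
    U.walkRep N a (t + 1) (q + 1) x y =
      U.walkRep N a t q (x ∘ Equiv.addRight 1) (y ∘ Equiv.addRight 1) := by
  induction a using U.induction generalizing t q x y with
  | u i j =>
    rw [U.walkRep_u, onSite_mul_step_apply, onSite_mul_step_apply]
    simp only [add_left_inj]
    split_ifs
    · exact siteEmbed_reindex (Equiv.addRight 1) t _ x y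
    · rfl
  | star_u i j =>
    rw [U.walkRep_star_u, star_step_mul_onSite_apply, star_step_mul_onSite_apply]
    simp only [add_left_inj]
    split_ifs
    · exact siteEmbed_reindex (Equiv.addRight 1) q _ x y
    · rfl
  | scalar c =>
    rw [AlgHomClass.commutes]
    simp only [Matrix.algebraMap_matrix_apply, add_left_inj]
    split_ifs
    · simp only [Matrix.algebraMap_matrix_apply]
      exact if_congr ((Equiv.addRight (1 : ZMod N)).surjective.injective_comp_right.eq_iff).symm
        rfl rfl
    · rfl
  | add a b ha hb => simp [ha, hb]
  | mul a b ha hb =>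
    have hsum : ∀ (A B : WalkAlg N n ℂ) (t q : ZMod N) (x y : ZMod N → Fin n),
        (A * B) t q x y = ∑ s, ∑ z, A t s x z * B s q z y := by
      intro A B t q x y
      rw [Matrix.mul_apply, Matrix.sum_apply]
      rfl
    rw [map_mul, hsum, hsum, ← Equiv.sum_comp (Equiv.addRight (1 : ZMod N))]
    refine Finset.sum_congr rfl fun s _ => ?_
    refine (Finset.sum_congr rfl fun z _ => ?_).trans
      (((Equiv.addRight (1 : ZMod N)).symm.arrowCongr (Equiv.refl (Fin n))).sum_comp fun z =>
        U.walkRep N a t s (x ∘ Equiv.addRight 1) z * U.walkRep N b s q z (y ∘ Equiv.addRight 1))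
    rw [Equiv.coe_addRight, ha, hb]
    rfl

theorem BrownAlg.trace_walkRep_apply_eq (a : U.carrier) (t : ZMod N) :
    (U.walkRep N a t t).trace = (U.walkRep N a 0 0).trace := by
  have h : ∀ t : ZMod N, (U.walkRep N a (t + 1) (t + 1)).trace = (U.walkRep N a t t).trace := by
    intro t
    simp only [Matrix.trace, Matrix.diag_apply, U.walkRep_translate N a]
    exact ((Equiv.addRight (1 : ZMod N)).symm.arrowCongr (Equiv.refl (Fin n))).sum_comp
      fun x => U.walkRep N a t t x x
  have h' : ∀ m : ℕ, (U.walkRep N a m m).trace = (U.walkRep N a 0 0).trace := by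
    intro m
    induction m with
    | zero => simp
    | succ m ih => rw [← ih, Nat.cast_succ, h]
  simpa using h' t.val

end WalkRep

section WalkState

open scoped ComplexOrder

variable {n : ℕ} (U : BrownAlg n) (N : ℕ) [NeZero N]

/-- The normalised trace in the walk representation. -/
def BrownAlg.walkState : U.carrier →ₗ[ℂ] ℂ :=
  ((N : ℂ) * Fintype.card (ZMod N → Fin n))⁻¹ •
    (Matrix.traceLinearMap (ZMod N → Fin n) ℂ ℂ ∘ₗ Matrix.traceLinearMap (ZMod N) ℂ _ ∘ₗ
      (U.walkRep N).toAlgHom.toLinearMap)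

theorem BrownAlg.walkState_eq_sum (a : U.carrier) :
    U.walkState N a = ((N : ℂ) * Fintype.card (ZMod N → Fin n))⁻¹ *
      ∑ t, (U.walkRep N a t t).trace := by
  change _ * Matrix.trace (Matrix.trace (U.walkRep N a)) = _
  exact congrArg _ (Matrix.trace_sum _ _)

theorem BrownAlg.walkState_apply (a : U.carrier) (t : ZMod N) :
    U.walkState N a = (Fintype.card (ZMod N → Fin n) : ℂ)⁻¹ * (U.walkRep N a t t).trace := by
  have hN : (N : ℂ) ≠ 0 := by exact_mod_cast NeZero.ne N
  rw [U.walkState_eq_sum, U.trace_walkRep_apply_eq N a t]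
  simp only [U.trace_walkRep_apply_eq N a, Finset.sum_const, Finset.card_univ, ZMod.card,
    nsmul_eq_mul, mul_inv]
  field_simp

theorem BrownAlg.isTracialState_walkState (hn : 1 ≤ n) : IsTracialState (U.walkState N) := by
  have : Nonempty (Fin n) := ⟨⟨0, hn⟩⟩
  have hX : (Fintype.card (ZMod N → Fin n) : ℂ) ≠ 0 := by exact_mod_cast Fintype.card_ne_zero
  refine ⟨⟨?_, fun a => ?_⟩, fun a b => ?_⟩
  · rw [U.walkState_apply N 1 0, map_one, Matrix.one_apply_eq, Matrix.trace_one,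
      inv_mul_cancel₀ hX]
  · suffices h : 0 ≤ U.walkState N (star a * a) from
      ⟨(Complex.nonneg_iff.1 h).1, (Complex.nonneg_iff.1 h).2.symm⟩
    rw [U.walkState_apply N _ 0]
    refine mul_nonneg (by positivity) ?_
    rw [map_mul, map_star, Matrix.mul_apply, Matrix.trace_sum]
    refine Finset.sum_nonneg fun s _ => ?_
    rw [Matrix.star_apply, Matrix.star_eq_conjTranspose]
    exact (Matrix.posSemidef_conjTranspose_mul_self _).trace_nonneg
  · rw [U.walkState_eq_sum, U.walkState_eq_sum]
    simp only [map_mul, Matrix.mul_apply (M := U.walkRep N _), Matrix.trace_sum]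
    rw [Finset.sum_comm]
    simp only [Matrix.trace_mul_comm (U.walkRep N a _ _)]

end WalkState

section Intertwine

variable {N : ℕ} {B : Type} [Ring B]

/-- `G` intertwines the rows `r ≤ m < N - r` of `T` and `T'`, and these rows of `T'` have
entries only within distance `r` of the diagonal. -/
def IntertwinesWithin (r : ℕ) (G : ZMod N → B) (T T' : Matrix (ZMod N) (ZMod N) B) : Prop :=
  ∀ m : ℕ, r ≤ m → m + r < N → ∀ q : ZMod N, G m * T m q = T' m q * G q ∧
    (T' m q ≠ 0 → ∃ k : ℕ, m ≤ k + r ∧ k ≤ m + r ∧ q = k)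

namespace IntertwinesWithin

variable {r r' : ℕ} {G : ZMod N → B} {T T' W W' : Matrix (ZMod N) (ZMod N) B}

theorem mono (h : IntertwinesWithin r G T T') (hr : r ≤ r') : IntertwinesWithin r' G T T' := by
  intro m h1 h2 q
  obtain ⟨h3, h4⟩ := h m (by omega) (by omega) q
  refine ⟨h3, fun hq => ?_⟩
  obtain ⟨k, hk⟩ := h4 hq
  exact ⟨k, by omega, by omega, hk.2.2⟩

theorem add (h : IntertwinesWithin r G T T') (h' : IntertwinesWithin r G W W') :
    IntertwinesWithin r G (T + W) (T' + W') := by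
  intro m h1 h2 q
  obtain ⟨h3, h4⟩ := h m h1 h2 q
  obtain ⟨h5, h6⟩ := h' m h1 h2 q
  refine ⟨by simp only [Matrix.add_apply, mul_add, add_mul, h3, h5], fun hq => ?_⟩
  by_cases hT : T' m q = 0
  · exact h6 fun hW => hq (by simp [hT, hW])
  · exact h4 hT

theorem mul [NeZero N] (h : IntertwinesWithin r G T T') (h' : IntertwinesWithin r' G W W') :
    IntertwinesWithin (r + r') G (T * W) (T' * W') := by
  intro m h1 h2 q
  have hrow := h m (by omega) (by omega)
  constructor
  · simp only [Matrix.mul_apply, Finset.mul_sum, Finset.sum_mul]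
    refine Finset.sum_congr rfl fun s _ => ?_
    rw [← mul_assoc, (hrow s).1]
    by_cases hT : T' m s = 0
    · simp [hT]
    · obtain ⟨k, hk1, hk2, rfl⟩ := (hrow s).2 hT
      rw [mul_assoc, (h' k (by omega) (by omega) q).1, mul_assoc]
  · intro hq
    rw [Matrix.mul_apply] at hq
    obtain ⟨s, -, hs⟩ := Finset.exists_ne_zero_of_sum_ne_zero hq
    obtain ⟨k, hk1, hk2, rfl⟩ := (hrow s).2 (left_ne_zero_of_mul hs)
    obtain ⟨l, hl1, hl2, rfl⟩ := (h' k (by omega) (by omega) q).2 (right_ne_zero_of_mul hs)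
    exact ⟨l, by omega, by omega, rfl⟩

theorem diagonal {d : B} (hd : ∀ m : ℕ, m < N → Commute (G m) d) :
    IntertwinesWithin 0 G (Matrix.diagonal fun _ => d) (Matrix.diagonal fun _ => d) := by
  intro m _ h2 q
  by_cases hq : (m : ZMod N) = q
  · subst hq
    exact ⟨by simpa using (hd m h2).eq, fun _ => ⟨m, by omega, by omega, rfl⟩⟩
  · simp [hq]

end IntertwinesWithin

variable [NeZero N] {n : ℕ} {R : Type} [Ring R]
  {G : ZMod N → Matrix (ZMod N → Fin n) (ZMod N → Fin n) R} {A A' : Matrix (Fin n) (Fin n) R}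

theorem intertwinesWithin_onSite_mul_step
    (h : ∀ m : ℕ, m + 1 < N → G m * siteEmbed (m : ZMod N) A =
      siteEmbed (m : ZMod N) A' * G (m + 1 : ℕ)) :
    IntertwinesWithin 1 G (onSite N A * step N n R) (onSite N A' * step N n R) := by
  intro m _ h2 q
  rw [onSite_mul_step_apply, onSite_mul_step_apply]
  split_ifs with hq
  · subst hq
    exact ⟨by exact_mod_cast h m h2, fun _ => ⟨m + 1, by omega, by omega, by simp⟩⟩
  · simp

theorem intertwinesWithin_star_step_mul_onSite [StarRing R]
    (h : ∀ m : ℕ, m + 1 < N → G (m + 1 : ℕ) * siteEmbed (m : ZMod N) A =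
      siteEmbed (m : ZMod N) A' * G m) :
    IntertwinesWithin 1 G (star (step N n R) * onSite N A) (star (step N n R) * onSite N A') := by
  intro m h1 h2 q
  obtain ⟨m, rfl⟩ := Nat.exists_eq_add_of_le' h1
  rw [star_step_mul_onSite_apply, star_step_mul_onSite_apply]
  split_ifs with hq
  · obtain rfl : q = m := by simpa using hq.symm
    exact ⟨h m (by omega), fun _ => ⟨m, by omega, by omega, rfl⟩⟩
  · simp

end Intertwine

section Gauge

variable {n : ℕ} (U : BrownAlg n) (N : ℕ) [NeZero N]

/-- The fundamental unitary matrix with entries in the Brown algebra. -/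
def BrownAlg.fundamental : Matrix (Fin n) (Fin n) U.carrier := Matrix.of U.u

theorem BrownAlg.fundamental_mem_unitary : U.fundamental ∈ unitary _ := by
  refine Unitary.mem_iff.2 ⟨?_, ?_⟩
  · ext i j
    simpa [Matrix.mul_apply, Matrix.one_apply, fundamental] using U.rel_left i j
  · ext i j
    simpa [Matrix.mul_apply, Matrix.one_apply, fundamental] using U.rel_right i j

theorem siteEmbed_mem_unitary {K R : Type} [Fintype K] [DecidableEq K] [Ring R] [StarRing R]
    (s : K) {A : Matrix (Fin n) (Fin n) R} (hA : A ∈ unitary _) :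
    siteEmbed s A ∈ unitary _ := by
  rw [Unitary.mem_iff] at hA ⊢
  rw [← siteEmbed_star, ← map_mul, ← map_mul, hA.1, hA.2, map_one]
  exact ⟨rfl, rfl⟩

/-- The fundamental unitaries on the sites `0, …, m - 1`, multiplied in increasing order. -/
def BrownAlg.gaugeBelow (m : ℕ) : Matrix (ZMod N → Fin n) (ZMod N → Fin n) U.carrier :=
  ((List.range m).map fun s : ℕ => siteEmbed (s : ZMod N) U.fundamental).prod

/-- The adjoint fundamental unitaries on the sites `N - 1, …, N - k`, multiplied in decreasing
order. -/
def BrownAlg.gaugeAbove (k : ℕ) : Matrix (ZMod N → Fin n) (ZMod N → Fin n) U.carrier :=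
  ((List.range k).map fun l : ℕ => siteEmbed ((N - (l + 1) : ℕ) : ZMod N) (star U.fundamental)).prod

theorem BrownAlg.gaugeBelow_mem_unitary (m : ℕ) : U.gaugeBelow N m ∈ unitary _ := by
  refine Submonoid.list_prod_mem _ fun x hx => ?_
  obtain ⟨s, -, rfl⟩ := List.mem_map.1 hx
  exact siteEmbed_mem_unitary _ U.fundamental_mem_unitary

theorem BrownAlg.gaugeAbove_mem_unitary (k : ℕ) : U.gaugeAbove N k ∈ unitary _ := by
  refine Submonoid.list_prod_mem _ fun x hx => ?_
  obtain ⟨s, -, rfl⟩ := List.mem_map.1 hx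
  exact siteEmbed_mem_unitary _ (Unitary.star_mem U.fundamental_mem_unitary)

theorem natCast_zmod_ne {N s t : ℕ} (hs : s < N) (ht : t < N) (h : s ≠ t) :
    (s : ZMod N) ≠ (t : ZMod N) := by
  intro h'
  rw [ZMod.natCast_eq_natCast_iff'] at h'
  rw [Nat.mod_eq_of_lt hs, Nat.mod_eq_of_lt ht] at h'
  exact h h'

theorem BrownAlg.gaugeBelow_commute {E : Matrix (Fin n) (Fin n) U.carrier}
    (hE : ∀ i j a, Commute a (E i j)) {m : ℕ} (hm : m < N) :
    Commute (U.gaugeBelow N m) (siteEmbed (m : ZMod N) E) := by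
  refine Commute.list_prod_left _ _ fun x hx => ?_
  obtain ⟨s, hs, rfl⟩ := List.mem_map.1 hx
  rw [List.mem_range] at hs
  exact siteEmbed_commute (natCast_zmod_ne (by omega) hm (by omega)) fun i j k l => hE k l _

theorem BrownAlg.gaugeAbove_commute {E : Matrix (Fin n) (Fin n) U.carrier}
    (hE : ∀ i j a, Commute a (E i j)) {m : ℕ} (hm : m < N) :
    Commute (U.gaugeAbove N (N - (m + 1))) (siteEmbed (m : ZMod N) E) := by
  refine Commute.list_prod_left _ _ fun x hx => ?_
  obtain ⟨s, hs, rfl⟩ := List.mem_map.1 hx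
  rw [List.mem_range] at hs
  exact siteEmbed_commute (natCast_zmod_ne (by omega) hm (by omega)) fun i j k l => hE k l _

theorem BrownAlg.gaugeBelow_succ (m : ℕ) :
    U.gaugeBelow N (m + 1) = U.gaugeBelow N m * siteEmbed (m : ZMod N) U.fundamental :=
  List.prod_range_succ _ _

theorem BrownAlg.gaugeAbove_sub {m : ℕ} (hm : m < N) :
    U.gaugeAbove N (N - m) =
      U.gaugeAbove N (N - (m + 1)) * siteEmbed (m : ZMod N) (star U.fundamental) := by
  rw [show N - m = (N - (m + 1)) + 1 by omega, BrownAlg.gaugeAbove, List.prod_range_succ,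
    show N - (N - (m + 1) + 1) = m by omega]
  rfl

theorem BrownAlg.siteEmbed_fundamental_mul_star (s : ZMod N) :
    siteEmbed s U.fundamental * siteEmbed s (star U.fundamental) = 1 := by
  rw [← map_mul, (Unitary.mem_iff.1 U.fundamental_mem_unitary).2, map_one]

theorem BrownAlg.siteEmbed_star_mul_fundamental (s : ZMod N) :
    siteEmbed s (star U.fundamental) * siteEmbed s U.fundamental = 1 := by
  rw [← map_mul, (Unitary.mem_iff.1 U.fundamental_mem_unitary).1, map_one]

variable {E : Matrix (Fin n) (Fin n) U.carrier}

theorem BrownAlg.gaugeBelow_intertwines_up (hE : ∀ i j a, Commute a (E i j)) :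
    IntertwinesWithin 1 (fun q : ZMod N => U.gaugeBelow N q.val)
      (onSite N (E * U.fundamental) * step N n _) (onSite N E * step N n _) := by
  refine intertwinesWithin_onSite_mul_step fun m hm => ?_
  rw [ZMod.val_natCast_of_lt (by omega), ZMod.val_natCast_of_lt hm, U.gaugeBelow_succ, map_mul,
    ← mul_assoc, (U.gaugeBelow_commute N hE (by omega)).eq, mul_assoc]

theorem BrownAlg.gaugeBelow_intertwines_down (hE : ∀ i j a, Commute a (E i j)) :
    IntertwinesWithin 1 (fun q : ZMod N => U.gaugeBelow N q.val)
      (star (step N n _) * onSite N (star U.fundamental * E))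
      (star (step N n _) * onSite N E) := by
  refine intertwinesWithin_star_step_mul_onSite fun m hm => ?_
  rw [ZMod.val_natCast_of_lt hm, ZMod.val_natCast_of_lt (show m < N by omega),
    U.gaugeBelow_succ, map_mul,
    mul_assoc, ← mul_assoc (siteEmbed _ U.fundamental), U.siteEmbed_fundamental_mul_star, one_mul,
    (U.gaugeBelow_commute N hE (by omega)).eq]

theorem BrownAlg.gaugeAbove_intertwines_up (hE : ∀ i j a, Commute a (E i j)) :
    IntertwinesWithin 1 (fun q : ZMod N => U.gaugeAbove N (N - q.val))
      (onSite N (U.fundamental * E) * step N n _) (onSite N E * step N n _) := by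
  refine intertwinesWithin_onSite_mul_step fun m hm => ?_
  rw [ZMod.val_natCast_of_lt (by omega), ZMod.val_natCast_of_lt hm,
    U.gaugeAbove_sub N (by omega), map_mul,
    mul_assoc, ← mul_assoc (siteEmbed _ (star U.fundamental)), U.siteEmbed_star_mul_fundamental,
    one_mul, (U.gaugeAbove_commute N hE (by omega)).eq]

theorem BrownAlg.gaugeAbove_intertwines_down (hE : ∀ i j a, Commute a (E i j)) :
    IntertwinesWithin 1 (fun q : ZMod N => U.gaugeAbove N (N - q.val))
      (star (step N n _) * onSite N (E * star U.fundamental))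
      (star (step N n _) * onSite N E) := by
  refine intertwinesWithin_star_step_mul_onSite fun m hm => ?_
  rw [ZMod.val_natCast_of_lt hm, ZMod.val_natCast_of_lt (show m < N by omega),
    U.gaugeAbove_sub N (m := m) (by omega), map_mul,
    ← mul_assoc, (U.gaugeAbove_commute N hE (by omega)).eq, mul_assoc]

end Gauge

section Coefficients

variable (N : ℕ) [NeZero N] (n : ℕ) (A : Type) [Ring A] [Algebra ℂ A]

/-- The extension of scalars from `ℂ` to `A` on block matrices. -/
def liftCoeff : WalkAlg N n ℂ →ₐ[ℂ] WalkAlg N n A :=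
  (Algebra.ofId ℂ A).mapMatrix.mapMatrix

/-- The inclusion of `A` as scalar block matrices. -/
def constBlock : A →ₐ[ℂ] WalkAlg N n A :=
  (Matrix.scalarAlgHom (ZMod N) ℂ).comp (Matrix.scalarAlgHom (ZMod N → Fin n) ℂ)

variable {n A}

theorem liftCoeff_apply (T : WalkAlg N n ℂ) (t q : ZMod N) (x y : ZMod N → Fin n) :
    liftCoeff N n A T t q x y = algebraMap ℂ A (T t q x y) := rfl

theorem constBlock_eq_diagonal (a : A) :
    constBlock N n A a = Matrix.diagonal fun _ => Matrix.diagonal fun _ => a := rfl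

theorem constBlock_mul_apply (a : A) (T : WalkAlg N n A) (t q : ZMod N) (x y : ZMod N → Fin n) :
    (constBlock N n A a * T) t q x y = a * T t q x y := by
  rw [constBlock_eq_diagonal, Matrix.diagonal_mul, Matrix.diagonal_mul]

theorem mul_constBlock_apply (a : A) (T : WalkAlg N n A) (t q : ZMod N) (x y : ZMod N → Fin n) :
    (T * constBlock N n A a) t q x y = T t q x y * a := by
  rw [constBlock_eq_diagonal, Matrix.mul_diagonal, Matrix.mul_diagonal]

theorem constBlock_commute_liftCoeff (a : A) (T : WalkAlg N n ℂ) :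
    Commute (constBlock N n A a) (liftCoeff N n A T) := by
  ext t q x y
  rw [constBlock_mul_apply, mul_constBlock_apply, liftCoeff_apply, Algebra.commutes]

theorem constBlock_eq_onSite (a : A) :
    constBlock N n A a = onSite N (Matrix.scalar (Fin n) a) := by
  change Matrix.diagonal (fun _ => Matrix.scalar _ a) =
    Matrix.diagonal fun t => siteEmbed t (Matrix.scalar (Fin n) a)
  simp only [siteEmbed_scalar]

theorem liftCoeff_onSite (E : Matrix (Fin n) (Fin n) ℂ) :
    liftCoeff N n A (onSite N E) = onSite N (E.map (algebraMap ℂ A)) := by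
  change (Matrix.diagonal fun t => siteEmbed t E).map
    (fun B : Matrix (ZMod N → Fin n) (ZMod N → Fin n) ℂ => B.map (algebraMap ℂ A)) =
    Matrix.diagonal fun t => siteEmbed t (E.map (algebraMap ℂ A))
  rw [Matrix.diagonal_map (by simp)]
  simp only [siteEmbed_map]

theorem liftCoeff_step : liftCoeff N n A (step N n ℂ) = step N n A := by
  ext t q x y
  rw [liftCoeff_apply]
  simp only [step, Matrix.of_apply]
  by_cases h : q = t + 1 <;> by_cases hxy : x = y <;> simp [h, hxy, Matrix.one_apply]

theorem liftCoeff_star_step [StarRing A] :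
    liftCoeff N n A (star (step N n ℂ)) = star (step N n A) := by
  ext t q x y
  rw [liftCoeff_apply]
  simp only [step, Matrix.star_apply, Matrix.of_apply]
  by_cases h : t = q + 1 <;> by_cases hxy : y = x <;> simp [h, hxy, Matrix.one_apply]

end Coefficients

section Convolve

variable {n : ℕ} (U : BrownAlg n) (N : ℕ) [NeZero N]

/-- The representation of the tensor square with the second leg acting through the walk. -/
def BrownAlg.walkRight : U.carrier ⊗[ℂ] U.carrier →ₐ[ℂ] WalkAlg N n U.carrier :=
  Algebra.TensorProduct.lift (constBlock N n U.carrier)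
    ((liftCoeff N n U.carrier).comp (U.walkRep N).toAlgHom)
    fun a _ => constBlock_commute_liftCoeff N a _

/-- The representation of the tensor square with the first leg acting through the walk. -/
def BrownAlg.walkLeft : U.carrier ⊗[ℂ] U.carrier →ₐ[ℂ] WalkAlg N n U.carrier :=
  Algebra.TensorProduct.lift ((liftCoeff N n U.carrier).comp (U.walkRep N).toAlgHom)
    (constBlock N n U.carrier) fun _ b => (constBlock_commute_liftCoeff N b _).symm

theorem BrownAlg.walkRight_tmul (a b : U.carrier) :
    U.walkRight N (a ⊗ₜ b) = constBlock N n _ a * liftCoeff N n _ (U.walkRep N b) := rfl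

theorem BrownAlg.walkLeft_tmul (a b : U.carrier) :
    U.walkLeft N (a ⊗ₜ b) = liftCoeff N n _ (U.walkRep N a) * constBlock N n _ b := rfl

theorem BrownAlg.liftCoeff_walkRep_u (i j : Fin n) :
    liftCoeff N n U.carrier (U.walkRep N (U.u i j)) =
      onSite N (Matrix.single j i 1) * step N n U.carrier := by
  rw [U.walkRep_u, map_mul, liftCoeff_onSite, liftCoeff_step, Matrix.map_single, map_one]

theorem BrownAlg.liftCoeff_walkRep_star_u (i j : Fin n) :
    liftCoeff N n U.carrier (U.walkRep N (star (U.u i j))) =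
      star (step N n U.carrier) * onSite N (Matrix.single i j 1) := by
  rw [U.walkRep_star_u, map_mul, liftCoeff_onSite, liftCoeff_star_step, Matrix.map_single,
    map_one]

theorem sum_scalar_mul_single (i j : Fin n) {A : Type} [Ring A] (M : Matrix (Fin n) (Fin n) A) :
    ∑ k, Matrix.scalar (Fin n) (M i k) * Matrix.single j k 1 = Matrix.single j i 1 * M := by
  ext x y
  rw [Matrix.sum_apply]
  by_cases hx : j = x
  · subst hx
    simp [Matrix.scalar_apply, Matrix.single_apply]
  · simp [Matrix.scalar_apply, hx, Ne.symm hx]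

theorem sum_single_mul_scalar (i j : Fin n) {A : Type} [Ring A] (M : Matrix (Fin n) (Fin n) A) :
    ∑ k, Matrix.single k i 1 * Matrix.scalar (Fin n) (M k j) = M * Matrix.single j i 1 := by
  ext x y
  rw [Matrix.sum_apply]
  by_cases hy : i = y
  · subst hy
    simp [Matrix.scalar_apply, Matrix.single_apply]
  · simp [Matrix.scalar_apply, hy, Ne.symm hy]

end Convolve

section Invariance

variable {n : ℕ} (U : BrownAlg n) {F : FreeProd U.carrier U.carrier}
  {Δ : U.carrier →⋆ₐ[ℂ] F.carrier}

theorem scalar_commute_single_one {A : Type} [Ring A] (i j : Fin n) (a : A) :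
    Commute (Matrix.scalar (Fin n) a) (Matrix.single i j 1) := by
  rw [Matrix.scalar_commute_iff]
  simp

section

variable (N : ℕ) [NeZero N]

theorem BrownAlg.walkRight_coprod_u (hΔ : U.IsCoprod F Δ) (i j : Fin n) :
    U.walkRight N (F.toTensor (Δ (U.u i j))) =
      onSite N (Matrix.single j i 1 * U.fundamental) * step N n _ := by
  rw [U.toTensor_coprod_u hΔ, map_sum, ← sum_scalar_mul_single, map_sum, Finset.sum_mul]
  refine Finset.sum_congr rfl fun k _ => ?_
  rw [U.walkRight_tmul, U.liftCoeff_walkRep_u, constBlock_eq_onSite, map_mul, mul_assoc]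
  rfl

theorem BrownAlg.walkRight_coprod_star_u (hΔ : U.IsCoprod F Δ) (i j : Fin n) :
    U.walkRight N (F.toTensor (Δ (star (U.u i j)))) =
      star (step N n _) * onSite N (star U.fundamental * Matrix.single i j 1) := by
  rw [U.toTensor_coprod_star_u hΔ, map_sum, ← sum_single_mul_scalar, map_sum, Finset.mul_sum]
  refine Finset.sum_congr rfl fun k _ => ?_
  rw [U.walkRight_tmul, (constBlock_commute_liftCoeff N _ _).eq, U.liftCoeff_walkRep_star_u,
    constBlock_eq_onSite, map_mul, mul_assoc]
  rfl

theorem BrownAlg.walkLeft_coprod_u (hΔ : U.IsCoprod F Δ) (i j : Fin n) :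
    U.walkLeft N (F.toTensor (Δ (U.u i j))) =
      onSite N (U.fundamental * Matrix.single j i 1) * step N n _ := by
  rw [U.toTensor_coprod_u hΔ, map_sum, ← sum_single_mul_scalar, map_sum, Finset.sum_mul]
  refine Finset.sum_congr rfl fun k _ => ?_
  rw [U.walkLeft_tmul, ← (constBlock_commute_liftCoeff N _ _).eq, U.liftCoeff_walkRep_u,
    constBlock_eq_onSite, ← mul_assoc, ← map_mul,
    (scalar_commute_single_one k i (U.u k j)).eq]
  rfl

theorem BrownAlg.walkLeft_coprod_star_u (hΔ : U.IsCoprod F Δ) (i j : Fin n) :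
    U.walkLeft N (F.toTensor (Δ (star (U.u i j)))) =
      star (step N n _) * onSite N (Matrix.single i j 1 * star U.fundamental) := by
  rw [U.toTensor_coprod_star_u hΔ, map_sum, ← sum_scalar_mul_single, map_sum, Finset.mul_sum]
  refine Finset.sum_congr rfl fun k _ => ?_
  rw [U.walkLeft_tmul, U.liftCoeff_walkRep_star_u,
    constBlock_eq_onSite, mul_assoc, ← map_mul, ← (scalar_commute_single_one i k _).eq]
  rfl

theorem single_one_commute {A : Type} [Ring A] (i j k l : Fin n) (a : A) :
    Commute a (Matrix.single i j 1 k l) := by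
  rw [Matrix.single_apply]
  split_ifs
  · exact Commute.one_right a
  · exact Commute.zero_right a

end

theorem BrownAlg.exists_intertwines (hΔ : U.IsCoprod F Δ) (a : U.carrier) :
    ∃ r : ℕ, ∀ (N : ℕ) [NeZero N],
      IntertwinesWithin r (fun q : ZMod N => U.gaugeBelow N q.val)
        (U.walkRight N (F.toTensor (Δ a))) (liftCoeff N n _ (U.walkRep N a)) ∧
      IntertwinesWithin r (fun q : ZMod N => U.gaugeAbove N (N - q.val))
        (U.walkLeft N (F.toTensor (Δ a))) (liftCoeff N n _ (U.walkRep N a)) := by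
  induction a using U.induction with
  | u i j =>
    refine ⟨1, fun N _ => ?_⟩
    rw [U.walkRight_coprod_u N hΔ, U.walkLeft_coprod_u N hΔ, U.liftCoeff_walkRep_u]
    exact ⟨U.gaugeBelow_intertwines_up N (single_one_commute _ _),
      U.gaugeAbove_intertwines_up N (single_one_commute _ _)⟩
  | star_u i j =>
    refine ⟨1, fun N _ => ?_⟩
    rw [U.walkRight_coprod_star_u N hΔ, U.walkLeft_coprod_star_u N hΔ,
      U.liftCoeff_walkRep_star_u]
    exact ⟨U.gaugeBelow_intertwines_down N (single_one_commute _ _),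
      U.gaugeAbove_intertwines_down N (single_one_commute _ _)⟩
  | scalar c =>
    refine ⟨0, fun N _ => ?_⟩
    have h : algebraMap ℂ (WalkAlg N n U.carrier) c =
        Matrix.diagonal fun _ => algebraMap ℂ _ c := Matrix.algebraMap_eq_diagonal c
    simp only [AlgHomClass.commutes, h]
    exact ⟨.diagonal fun m _ => (Algebra.commutes c _).symm,
      .diagonal fun m _ => (Algebra.commutes c _).symm⟩
  | add a b ha hb =>
    obtain ⟨r, hr⟩ := ha
    obtain ⟨r', hr'⟩ := hb
    refine ⟨max r r', fun N _ => ?_⟩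
    simp only [map_add]
    exact ⟨((hr N).1.mono (le_max_left _ _)).add ((hr' N).1.mono (le_max_right _ _)),
      ((hr N).2.mono (le_max_left _ _)).add ((hr' N).2.mono (le_max_right _ _))⟩
  | mul a b ha hb =>
    obtain ⟨r, hr⟩ := ha
    obtain ⟨r', hr'⟩ := hb
    refine ⟨r + r', fun N _ => ?_⟩
    simp only [map_mul]
    exact ⟨(hr N).1.mul (hr' N).1, (hr N).2.mul (hr' N).2⟩

/-- A tracial functional composed with the matrix trace is unitarily invariant. -/
theorem sum_apply_diag_eq_of_unitary {A X : Type} [Ring A] [Algebra ℂ A] [StarRing A] [Fintype X]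
    [DecidableEq X] {φ : A →ₗ[ℂ] ℂ} (hφ : ∀ a b, φ (a * b) = φ (b * a)) {G S T : Matrix X X A}
    (hG : G ∈ unitary (Matrix X X A)) (h : G * S = T * G) :
    ∑ x, φ (S x x) = ∑ x, φ (T x x) := by
  have hcomm : ∀ P Q : Matrix X X A, ∑ x, φ ((P * Q) x x) = ∑ x, φ ((Q * P) x x) := by
    intro P Q
    simp only [Matrix.mul_apply, map_sum]
    rw [Finset.sum_comm]
    simp only [hφ (P _ _)]
  have hS : S = star G * (T * G) := by
    rw [← h, ← mul_assoc, (Unitary.mem_iff.1 hG).1, one_mul]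
  rw [hS, hcomm, mul_assoc, (Unitary.mem_iff.1 hG).2, mul_one]

variable (N : ℕ) [NeZero N]

theorem BrownAlg.tensorFunctional_walkState_right (φ : U.carrier →ₗ[ℂ] ℂ) (t : ZMod N)
    (z : U.carrier ⊗[ℂ] U.carrier) :
    tensorFunctional φ (U.walkState N) z =
      (Fintype.card (ZMod N → Fin n) : ℂ)⁻¹ * ∑ x, φ (U.walkRight N z t t x x) := by
  induction z with
  | zero => simp
  | add z w hz hw => simp only [map_add, hz, hw, Matrix.add_apply, Finset.sum_add_distrib, mul_add]
  | tmul a b =>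
    rw [tensorFunctional_tmul, U.walkState_apply N b t, U.walkRight_tmul]
    simp only [constBlock_mul_apply, liftCoeff_apply, ← Algebra.commutes, ← Algebra.smul_def,
      map_smul, smul_eq_mul, Matrix.trace, Matrix.diag_apply, ← Finset.sum_mul]
    ring

theorem BrownAlg.tensorFunctional_walkState_left (φ : U.carrier →ₗ[ℂ] ℂ) (t : ZMod N)
    (z : U.carrier ⊗[ℂ] U.carrier) :
    tensorFunctional (U.walkState N) φ z =
      (Fintype.card (ZMod N → Fin n) : ℂ)⁻¹ * ∑ x, φ (U.walkLeft N z t t x x) := by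
  induction z with
  | zero => simp
  | add z w hz hw => simp only [map_add, hz, hw, Matrix.add_apply, Finset.sum_add_distrib, mul_add]
  | tmul a b =>
    rw [tensorFunctional_tmul, U.walkState_apply N a t, U.walkLeft_tmul]
    simp only [mul_constBlock_apply, liftCoeff_apply, ← Algebra.smul_def,
      map_smul, smul_eq_mul, Matrix.trace, Matrix.diag_apply, ← Finset.sum_mul]
    ring

theorem BrownAlg.walkState_eq_sum_liftCoeff {φ : U.carrier →ₗ[ℂ] ℂ} (hφ : φ 1 = 1) (t : ZMod N)
    (a : U.carrier) :
    (Fintype.card (ZMod N → Fin n) : ℂ)⁻¹ *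
      ∑ x, φ (liftCoeff N n _ (U.walkRep N a) t t x x) = U.walkState N a := by
  simp only [U.walkState_apply N a t, liftCoeff_apply, Algebra.algebraMap_eq_smul_one, map_smul,
    hφ, smul_eq_mul, mul_one, Matrix.trace, Matrix.diag_apply]

/-- Every tracial state convolves with the walk states of large size to these walk states. -/
theorem BrownAlg.exists_tensorFunctional_walkState (hΔ : U.IsCoprod F Δ) (a : U.carrier) :
    ∃ r : ℕ, ∀ (N : ℕ) [NeZero N], r ≤ N → ∀ φ : U.carrier →ₗ[ℂ] ℂ, IsTracialState φ →
      tensorFunctional φ (U.walkState N) (F.toTensor (Δ a)) = U.walkState N a ∧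
      tensorFunctional (U.walkState N) φ (F.toTensor (Δ a)) = U.walkState N a := by
  obtain ⟨r, hr⟩ := U.exists_intertwines hΔ a
  refine ⟨2 * r + 1, fun N _ hN φ hφ => ?_⟩
  rw [U.tensorFunctional_walkState_right N φ (r : ZMod N),
    U.tensorFunctional_walkState_left N φ (r : ZMod N),
    ← U.walkState_eq_sum_liftCoeff N hφ.1.1 (r : ZMod N)]
  exact ⟨congrArg _ (sum_apply_diag_eq_of_unitary hφ.2 (U.gaugeBelow_mem_unitary N _)
      ((hr N).1 r le_rfl (by omega) r).1),
    congrArg _ (sum_apply_diag_eq_of_unitary hφ.2 (U.gaugeAbove_mem_unitary N _)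
      ((hr N).2 r le_rfl (by omega) r).1)⟩

end Invariance

section AlternatingWords

variable {n : ℕ}

/-- The alternating product of matrix units `E_{j₀i₀} E_{i₁j₁} E_{j₂i₂} ⋯` of length `r`. -/
def altUnits (r : ℕ) (i j : ℕ → Fin n) : Matrix (Fin n) (Fin n) ℂ :=
  ((List.range r).map fun m =>
    if m % 2 = 0 then Matrix.single (j m) (i m) 1 else Matrix.single (i m) (j m) 1).prod

theorem altUnits_succ_succ (s : ℕ) (i j : ℕ → Fin n) :
    altUnits (2 * (s + 1)) i j = altUnits (2 * s) i j *
      (Matrix.single (j (2 * s)) (i (2 * s)) 1 *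
        Matrix.single (i (2 * s + 1)) (j (2 * s + 1)) 1) := by
  rw [altUnits, show 2 * (s + 1) = 2 * s + 1 + 1 by ring, List.prod_range_succ,
    List.prod_range_succ, if_pos (by omega), if_neg (by omega), mul_assoc]
  rfl

theorem single_mul_single_ite (a b c d : Fin n) (x y : ℂ) :
    Matrix.single a b x * Matrix.single c d y =
      Matrix.single a d (x * (if b = c then 1 else 0) * y) := by
  split_ifs with h
  · subst h; simp
  · simp [h]

theorem altUnits_eq_single (s : ℕ) (i j : ℕ → Fin n) :
    altUnits (2 * (s + 1)) i j = Matrix.single (j 0) (j (2 * s + 1))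
      (∏ m ∈ Finset.range (2 * s + 1),
        if m % 2 = 0 then (if i m = i (m + 1) then (1 : ℂ) else 0)
          else (if j m = j (m + 1) then (1 : ℂ) else 0)) := by
  induction s with
  | zero =>
    rw [altUnits_succ_succ, single_mul_single_ite]
    simp [altUnits]
  | succ s ih =>
    rw [altUnits_succ_succ, ih, single_mul_single_ite, single_mul_single_ite,
      show 2 * (s + 1) + 1 = 2 * s + 1 + 1 + 1 by ring, Finset.prod_range_succ _ (2 * s + 1 + 1),
      Finset.prod_range_succ _ (2 * s + 1), if_neg (show ¬ (2 * s + 1) % 2 = 0 by omega),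
      if_pos (show (2 * s + 1 + 1) % 2 = 0 by omega)]
    simp only [one_mul, mul_one]
    rfl

theorem trace_altUnits {s : ℕ} (hs : 0 < s) (i j : ℕ → Fin n) :
    (altUnits (2 * s) i j).trace = ∏ m ∈ Finset.range (2 * s),
      (if m % 2 = 0 then (if i m = i (m + 1) then (1 : ℂ) else 0)
        else (if j m = j ((m + 1) % (2 * s)) then (1 : ℂ) else 0)) := by
  obtain ⟨s, rfl⟩ := Nat.exists_eq_add_of_le' hs
  have hprod : ∀ m ∈ Finset.range (2 * s + 1), (m + 1) % (2 * s + 1 + 1) = m + 1 := by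
    intro m hm
    exact Nat.mod_eq_of_lt (by rw [Finset.mem_range] at hm; omega)
  rw [altUnits_eq_single, show 2 * (s + Nat.succ 0) = 2 * s + 1 + 1 by ring,
    Finset.prod_range_succ _ (2 * s + 1), if_neg (show ¬ (2 * s + 1) % 2 = 0 by omega),
    Nat.mod_self]
  split_ifs with h
  · rw [h, Matrix.trace_single_eq_same, mul_one]
    exact Finset.prod_congr rfl fun m hm => by rw [hprod m hm]
  · rw [Matrix.trace_single_eq_of_ne _ _ _ (Ne.symm h), mul_zero]

variable (U : BrownAlg n) (N : ℕ) [NeZero N]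

theorem BrownAlg.walkRep_altWord1 (s : ℕ) (i j : ℕ → Fin n) :
    U.walkRep N (altWord1 U (2 * s) i j).prod = onSite N (altUnits (2 * s) i j) := by
  induction s with
  | zero => simp [altWord1, altUnits]
  | succ s ih =>
    have h : (altWord1 U (2 * (s + 1)) i j).prod = (altWord1 U (2 * s) i j).prod *
        (U.u (i (2 * s)) (j (2 * s)) * star (U.u (i (2 * s + 1)) (j (2 * s + 1)))) := by
      rw [altWord1, show 2 * (s + 1) = 2 * s + 1 + 1 by ring, List.prod_range_succ,
        List.prod_range_succ, if_pos (by omega), if_neg (by omega), mul_assoc]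
      rfl
    rw [h, altUnits_succ_succ, map_mul, map_mul, ih, U.walkRep_u, U.walkRep_star_u, map_mul,
      map_mul, mul_assoc (onSite N (Matrix.single _ _ _)), ← mul_assoc (step N n ℂ),
      step_mul_star_step, one_mul]

theorem BrownAlg.walkRep_altWord2 (s : ℕ) (i j : ℕ → Fin n) :
    U.walkRep N (altWord2 U (2 * s) i j).prod =
      star (step N n ℂ) * onSite N (altUnits (2 * s) j i) * step N n ℂ := by
  induction s with
  | zero => simp [altWord2, altUnits, star_step_mul_step]
  | succ s ih =>
    have h : (altWord2 U (2 * (s + 1)) i j).prod = (altWord2 U (2 * s) i j).prod *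
        (star (U.u (i (2 * s)) (j (2 * s))) * U.u (i (2 * s + 1)) (j (2 * s + 1))) := by
      rw [altWord2, show 2 * (s + 1) = 2 * s + 1 + 1 by ring, List.prod_range_succ,
        List.prod_range_succ, if_pos (by omega), if_neg (by omega), mul_assoc]
      rfl
    rw [h, altUnits_succ_succ, map_mul, map_mul, ih, U.walkRep_u, U.walkRep_star_u, map_mul,
      map_mul]
    simp only [mul_assoc]
    rw [← mul_assoc (step N n ℂ), step_mul_star_step, one_mul]

theorem BrownAlg.walkState_altWord1 (hn : 1 ≤ n) (s : ℕ) (i j : ℕ → Fin n) :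
    U.walkState N (altWord1 U (2 * s) i j).prod =
      (n : ℂ)⁻¹ * (altUnits (2 * s) i j).trace := by
  rw [U.walkState_apply N _ 0, U.walkRep_altWord1, ← trace_siteEmbed (0 : ZMod N) _ hn]
  congr 2
  exact Matrix.diagonal_apply_eq _ _

theorem BrownAlg.walkState_altWord2 (hn : 1 ≤ n) (s : ℕ) (i j : ℕ → Fin n) :
    U.walkState N (altWord2 U (2 * s) i j).prod =
      (n : ℂ)⁻¹ * (altUnits (2 * s) j i).trace := by
  rw [U.walkState_apply N _ (0 + 1), U.walkRep_altWord2, ← trace_siteEmbed (0 : ZMod N) _ hn,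
    Matrix.mul_apply, Finset.sum_eq_single 0]
  · rw [star_step_mul_onSite_apply, if_pos rfl]
    simp [step]
  · intro q _ hq
    rw [star_step_mul_onSite_apply, if_neg fun h => hq (add_right_cancel h).symm, zero_mul]
  · simp

end AlternatingWords

section HaarTrace

open Filter

variable {n : ℕ} (U : BrownAlg n) {F : FreeProd U.carrier U.carrier}
  {Δ : U.carrier →⋆ₐ[ℂ] F.carrier}

theorem BrownAlg.exists_eventually_walkState_eq (hn : 1 ≤ n) (hΔ : U.IsCoprod F Δ) :
    ∃ h : U.carrier →ₗ[ℂ] ℂ, ∀ a, ∀ᶠ N in atTop, U.walkState (N + 1) a = h a := by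
  have hconst : ∀ a, ∃ c, ∀ᶠ N in atTop, U.walkState (N + 1) a = c := by
    intro a
    obtain ⟨r, hr⟩ := U.exists_tensorFunctional_walkState hΔ a
    refine ⟨U.walkState (r + 1) a, eventually_atTop.2 ⟨r, fun N hN => ?_⟩⟩
    rw [← (hr (N + 1) (by omega) _ (U.isTracialState_walkState (r + 1) hn)).2,
      (hr (r + 1) (by omega) _ (U.isTracialState_walkState (N + 1) hn)).1]
  choose h hh using hconst
  refine ⟨{ toFun := h, map_add' := fun a b => ?_, map_smul' := fun c a => ?_ }, hh⟩
  · obtain ⟨N, hab, ha, hb⟩ := ((hh (a + b)).and ((hh a).and (hh b))).exists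
    rw [← hab, ← ha, ← hb, map_add]
  · obtain ⟨N, hca, ha⟩ := ((hh (c • a)).and (hh a)).exists
    rw [← hca, ← ha, map_smul]
    rfl

theorem isTracialState_of_eventually_eq {A : Type} [Ring A] [Algebra ℂ A] [StarRing A]
    {φ : ℕ → A →ₗ[ℂ] ℂ} {h : A →ₗ[ℂ] ℂ} (hφ : ∀ N, IsTracialState (φ N))
    (hh : ∀ a, ∀ᶠ N in atTop, φ N a = h a) : IsTracialState h := by
  refine ⟨⟨?_, fun a => ?_⟩, fun a b => ?_⟩
  · obtain ⟨N, hN⟩ := (hh 1).exists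
    rw [← hN, (hφ N).1.1]
  · obtain ⟨N, hN⟩ := (hh (star a * a)).exists
    rw [← hN]
    exact (hφ N).1.2 a
  · obtain ⟨N, hab, hba⟩ := ((hh (a * b)).and (hh (b * a))).exists
    rw [← hab, ← hba, (hφ N).2]

theorem eventually_tensorFunctional_eq {A : Type} [Ring A] [Algebra ℂ A]
    {φ : ℕ → A →ₗ[ℂ] ℂ} {h : A →ₗ[ℂ] ℂ} (hh : ∀ a, ∀ᶠ N in atTop, φ N a = h a)
    (ψ : A →ₗ[ℂ] ℂ) (z : A ⊗[ℂ] A) :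
    ∀ᶠ N in atTop, tensorFunctional ψ (φ N) z = tensorFunctional ψ h z ∧
      tensorFunctional (φ N) ψ z = tensorFunctional h ψ z := by
  induction z with
  | zero => simp
  | add z w hz hw =>
    filter_upwards [hz, hw] with N hz hw
    simp only [map_add, hz.1, hz.2, hw.1, hw.2, and_self]
  | tmul a b =>
    filter_upwards [hh a, hh b] with N ha hb
    simp only [tensorFunctional_tmul, ha, hb, and_self]

/-- The eventual value of the walk states is a tensor Haar trace. -/
theorem BrownAlg.tensorConv_of_eventually_walkState_eq (hn : 1 ≤ n) (hΔ : U.IsCoprod F Δ)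
    {δc : U.carrier →⋆ₐ[ℂ] ℂ} {h : U.carrier →ₗ[ℂ] ℂ}
    (hh : ∀ a, ∀ᶠ N in atTop, U.walkState (N + 1) a = h a) {φ : U.carrier →ₗ[ℂ] ℂ}
    (hφ : IsTracialState φ) :
    U.TensorConv F Δ δc φ h h ∧ U.TensorConv F Δ δc h φ h := by
  have hstate := isTracialState_of_eventually_eq
    (fun N => U.isTracialState_walkState (N + 1) hn) hh
  have key : ∀ a, tensorFunctional φ h (F.toTensor (Δ a)) = h a ∧
      tensorFunctional h φ (F.toTensor (Δ a)) = h a := by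
    intro a
    obtain ⟨r, hr⟩ := U.exists_tensorFunctional_walkState hΔ a
    obtain ⟨N, hN, ha, hz⟩ := ((eventually_ge_atTop r).and ((hh a).and
      (eventually_tensorFunctional_eq hh φ (F.toTensor (Δ a))))).exists
    rw [← hz.1, ← hz.2, ← ha]
    exact hr (N + 1) (by omega) φ hφ
  rw [U.tensorConv_iff hφ.1.1 hstate.1.1, U.tensorConv_iff hstate.1.1 hφ.1.1]
  exact ⟨fun a => (key a).1, fun a => (key a).2⟩

theorem BrownAlg.tensorConv_unique {δc : U.carrier →⋆ₐ[ℂ] ℂ} {φ ψ χ χ' : U.carrier →ₗ[ℂ] ℂ}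
    (h : U.TensorConv F Δ δc φ ψ χ) (h' : U.TensorConv F Δ δc φ ψ χ') : χ = χ' := by
  obtain ⟨Ψ, hΨ, hχ⟩ := h
  obtain ⟨Ψ', hΨ', hχ'⟩ := h'
  ext a
  rw [← hχ, ← hχ', hΨ.unique hΨ']

end HaarTrace

/-- For every `n ≥ 1` there is a unique tracial state `h` on the
Brown algebra with `φ ⋆_T h = h = h ⋆_T φ` for every tracial state `φ` (the tensor
Haar trace on `U⟨n⟩`), and this `h` satisfies the stated explicit formulas on
alternating words. -/
theorem tensor_haar_trace_exists_unique (n : ℕ) (hn : 1 ≤ n) (U : BrownAlg n)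
    (F : FreeProd U.carrier U.carrier) (Δ : U.carrier →⋆ₐ[ℂ] F.carrier)
    (hΔ : U.IsCoprod F Δ) (δc : U.carrier →⋆ₐ[ℂ] ℂ) (hδ : U.IsCounit δc) :
    (∃! h : U.carrier →ₗ[ℂ] ℂ, IsTracialState h ∧
      ∀ φ : U.carrier →ₗ[ℂ] ℂ, IsTracialState φ →
        U.TensorConv F Δ δc φ h h ∧ U.TensorConv F Δ δc h φ h) ∧
    (∀ h : U.carrier →ₗ[ℂ] ℂ, IsTracialState h →
      (∀ φ : U.carrier →ₗ[ℂ] ℂ, IsTracialState φ →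
        U.TensorConv F Δ δc φ h h ∧ U.TensorConv F Δ δc h φ h) →
      ∀ s : ℕ, 0 < s → ∀ i j : ℕ → Fin n,
        (h (altWord1 U (2 * s) i j).prod =
          (n : ℂ)⁻¹ * ∏ m ∈ Finset.range (2 * s),
            (if m % 2 = 0 then (if i m = i (m + 1) then (1 : ℂ) else 0)
              else (if j m = j ((m + 1) % (2 * s)) then (1 : ℂ) else 0))) ∧
        (h (altWord2 U (2 * s) i j).prod =
          (n : ℂ)⁻¹ * ∏ m ∈ Finset.range (2 * s),
            (if m % 2 = 0 then (if j m = j (m + 1) then (1 : ℂ) else 0)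
              else (if i m = i ((m + 1) % (2 * s)) then (1 : ℂ) else 0)))) := by
  obtain ⟨h, hh⟩ := U.exists_eventually_walkState_eq hn hΔ
  have hstate := isTracialState_of_eventually_eq
    (fun N => U.isTracialState_walkState (N + 1) hn) hh
  have hconv : ∀ φ : U.carrier →ₗ[ℂ] ℂ, IsTracialState φ →
      U.TensorConv F Δ δc φ h h ∧ U.TensorConv F Δ δc h φ h :=
    fun φ hφ => U.tensorConv_of_eventually_walkState_eq hn hΔ hh hφ
  have huniq : ∀ g : U.carrier →ₗ[ℂ] ℂ, IsTracialState g →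
      (∀ φ : U.carrier →ₗ[ℂ] ℂ, IsTracialState φ →
        U.TensorConv F Δ δc φ g g ∧ U.TensorConv F Δ δc g φ g) → g = h :=
    fun g hg hgconv => U.tensorConv_unique (hgconv h hstate).2 (hconv g hg).1
  refine ⟨⟨h, ⟨hstate, hconv⟩, fun g hg => huniq g hg.1 hg.2⟩, ?_⟩
  intro g hg hgconv s hs i j
  obtain rfl := huniq g hg hgconv
  constructor
  · obtain ⟨N, hN⟩ := (hh (altWord1 U (2 * s) i j).prod).exists
    rw [← hN, U.walkState_altWord1 _ hn, trace_altUnits hs]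
  · obtain ⟨N, hN⟩ := (hh (altWord2 U (2 * s) i j).prod).exists
    rw [← hN, U.walkState_altWord2 _ hn, trace_altUnits hs]
end
end
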